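/- For every integer k ≥ 1, every real number a ≥ 1/3 and every ε > 0, as X → ∞ one has Σ_{d ∈ D^+(X,1,4)} (a^{ω(d)} f̃(d))^k = (1/(3^k · 2^{6k})) · Σ_{d ∈ D^+(X,1,4)} (3a)^{k·ω(d)} + O( X (log X)^{(3a)^k − a^k − 1 + ε} ). -/

import Mathlib

open Finset Filter Asymptotics

open scoped Classical

noncomputable section

/-- `D` is a fundamental discriminant: either `D ≡ 1 (mod 4)` and `D` is squarefree,
or `D = 4m` with `m` squarefree and `m ≡ 2, 3 (mod 4)`. -/
def IsFundDisc (D : ℤ) : Prop :=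
  (D % 4 = 1 ∧ Squarefree D) ∨
    ∃ m : ℤ, D = 4 * m ∧ Squarefree m ∧ (m % 4 = 2 ∨ m % 4 = 3)

/-- `ω(d)`, the number of distinct primes dividing `|d|`. -/
def omegaZ (d : ℤ) : ℕ := d.natAbs.primeFactors.card

/-- The Legendre symbol `(m/p)` for odd primes `p`, and the Kronecker symbol at `p = 2`
(`0` if `m` is even, `1` if `m ≡ ±1 (mod 8)`, `-1` if `m ≡ ±3 (mod 8)`). -/
def kron (m : ℤ) (p : ℕ) : ℤ :=
  if p = 2 then
    if m % 2 = 0 then 0 else if m % 8 = 1 ∨ m % 8 = 7 then 1 else -1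
  else jacobiSym m p

/-- `α(d) = 1` if `d > 0` and `α(d) = 0` if `d < 0`. -/
def alphaFD (d : ℤ) : ℕ := if 0 < d then 1 else 0

/-- Ordered triples `(d₁, d₂, d₃)` of pairwise coprime fundamental discriminants,
each `≠ 1`, with `d₁ * d₂ * d₃ = d`. -/
def fdTriples (d : ℤ) : Finset (ℤ × ℤ × ℤ) :=
  (Finset.Icc (-(d.natAbs : ℤ)) (d.natAbs : ℤ) ×ˢ
      Finset.Icc (-(d.natAbs : ℤ)) (d.natAbs : ℤ) ×ˢ
      Finset.Icc (-(d.natAbs : ℤ)) (d.natAbs : ℤ)).filter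
    fun t =>
      IsFundDisc t.1 ∧ IsFundDisc t.2.1 ∧ IsFundDisc t.2.2 ∧
      t.1 ≠ 1 ∧ t.2.1 ≠ 1 ∧ t.2.2 ≠ 1 ∧
      IsCoprime t.1 t.2.1 ∧ IsCoprime t.1 t.2.2 ∧ IsCoprime t.2.1 t.2.2 ∧
      t.1 * t.2.1 * t.2.2 = d

/-- The summand attached to a factorization `d = d₁ d₂ d₃`:
`∏_{p ∣ d₃} (1 + (d₁d₂/p)) · ∏_{p ∣ d₂} (1 + (d₁d₃/p)) · ∏_{p ∣ d₁} (1 + (d₂d₃/p))`. -/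
def tripleTerm (t : ℤ × ℤ × ℤ) : ℤ :=
  (∏ p ∈ t.2.2.natAbs.primeFactors, (1 + kron (t.1 * t.2.1) p)) *
    (∏ p ∈ t.2.1.natAbs.primeFactors, (1 + kron (t.1 * t.2.2) p)) *
    (∏ p ∈ t.1.natAbs.primeFactors, (1 + kron (t.2.1 * t.2.2) p))

/-- `f̃(d) = 2^{-3-α(d)} Σ_{{d₁,d₂,d₃}} (…)`, the sum over *unordered* triples of
pairwise coprime fundamental discriminants `≠ 1` with product `d`.  Since the summand is
symmetric and the entries of any such triple are pairwise distinct, the unordered sum is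
one sixth of the ordered sum. -/
def ftilde (d : ℤ) : ℝ :=
  (1 / 2 ^ (3 + alphaFD d) : ℝ) * ((1 : ℝ) / 6) * ∑ t ∈ fdTriples d, (tripleTerm t : ℝ)

/-- `D⁻(X, n, m)`: fundamental discriminants `d` with `0 < -d < X` and `d ≡ n (mod m)`. -/
def Dminus (X : ℝ) (n m : ℤ) : Finset ℤ :=
  (Finset.Icc (-⌈X⌉) ⌈X⌉).filter fun d =>
    IsFundDisc d ∧ d < 0 ∧ -X < (d : ℝ) ∧ d % m = n % m

/-- `D⁺(X, n, m)`: fundamental discriminants `d` with `0 < d < X` and `d ≡ n (mod m)`. -/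
def Dplus (X : ℝ) (n m : ℤ) : Finset ℤ :=
  (Finset.Icc (-⌈X⌉) ⌈X⌉).filter fun d =>
    IsFundDisc d ∧ 0 < d ∧ (d : ℝ) < X ∧ d % m = n % m

/-- The product of `h p` over the primes `p ∣ n`. -/
def primeProd (h : ℕ → ℝ) (n : ℕ) : ℝ := ∏ p ∈ n.primeFactors, h p

/-- The squarefree natural numbers below `x`. -/
def sqfreeBelow (x : ℝ) : Finset ℕ := (range ⌈x⌉₊).filter Squarefree

lemma mem_sqfreeBelow {x : ℝ} {n : ℕ} : n ∈ sqfreeBelow x ↔ (n : ℝ) < x ∧ Squarefree n := by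
  simp [sqfreeBelow, Nat.lt_ceil]

lemma primeProd_nonneg {h : ℕ → ℝ} (hh : ∀ p, p.Prime → 0 ≤ h p) (n : ℕ) : 0 ≤ primeProd h n :=
  prod_nonneg fun p hp => hh p (Nat.prime_of_mem_primeFactors hp)

lemma primeProd_const (H : ℝ) (n : ℕ) : primeProd (fun _ => H) n = H ^ n.primeFactors.card := by
  simp [primeProd]

lemma primeProd_rpow_neg (h : ℕ → ℝ) (s : ℝ) {n : ℕ} (hn : Squarefree n) :
    primeProd (fun p => h p * (p : ℝ) ^ (-s)) n = primeProd h n * (n : ℝ) ^ (-s) := by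
  have h1 : ((n : ℕ) : ℝ) = ∏ p ∈ n.primeFactors, (p : ℝ) := by
    rw [← Nat.cast_prod, Nat.prod_primeFactors_of_squarefree hn]
  rw [primeProd, prod_mul_distrib, primeProd]
  congr 1
  conv_rhs => rw [h1]
  rw [Real.finsetProd_rpow]
  intro i _; positivity

lemma log_eq_sum_primeFactors {n : ℕ} (hn : Squarefree n) :
    Real.log n = ∑ p ∈ n.primeFactors, Real.log p := by
  have h1 : ((n : ℕ) : ℝ) = ∏ p ∈ n.primeFactors, (p : ℝ) := by
    rw [← Nat.cast_prod, Nat.prod_primeFactors_of_squarefree hn]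
  rw [h1, Real.log_prod]
  intro p hp
  exact_mod_cast (Nat.prime_of_mem_primeFactors hp).ne_zero

lemma primeProd_mul_log_sum_le {h : ℕ → ℝ} {H : ℝ} (h0 : ∀ p, p.Prime → 0 ≤ h p)
    (hH : ∀ p, p.Prime → h p ≤ H) {x : ℝ} (hx : 0 ≤ x) :
    ∑ n ∈ sqfreeBelow x, primeProd h n * Real.log n ≤
      H * Real.log 4 * x * ∑ m ∈ sqfreeBelow x, primeProd h m / m := by
  have hH0 : 0 ≤ H := (h0 2 Nat.prime_two).trans (hH 2 Nat.prime_two)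
  have e1 : ∑ n ∈ sqfreeBelow x, primeProd h n * Real.log n =
      ∑ q ∈ (sqfreeBelow x).sigma (fun n => n.primeFactors),
        primeProd h (q.1 / q.2) * (h q.2 * Real.log q.2) := by
    rw [sum_sigma]
    refine sum_congr rfl fun n hn => ?_
    have hsq := (mem_sqfreeBelow.1 hn).2
    rw [log_eq_sum_primeFactors hsq, mul_sum]
    refine sum_congr rfl fun p hp => ?_
    have hpp := Nat.prime_of_mem_primeFactors hp
    have hd := Nat.dvd_of_mem_primeFactors hp
    have : primeProd h n = primeProd h (n / p) * h p := by
      obtain ⟨m, rfl⟩ := hd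
      rw [Nat.mul_div_cancel_left _ hpp.pos]
      have hc : Nat.Coprime p m := Nat.coprime_of_squarefree_mul hsq
      rw [primeProd, primeProd, hc.primeFactors_mul, hpp.primeFactors,
        prod_union (disjoint_singleton_left.2 fun hm =>
          (Nat.Prime.coprime_iff_not_dvd hpp).1 hc (Nat.dvd_of_mem_primeFactors hm)),
        prod_singleton, mul_comm]
    rw [this]; ring
  rw [e1]
  have e2 : ∑ q ∈ (sqfreeBelow x).sigma (fun n => n.primeFactors),
        primeProd h (q.1 / q.2) * (h q.2 * Real.log q.2) ≤
      ∑ q ∈ (sqfreeBelow x).sigma (fun m => (Ioc 0 ⌊x / m⌋₊).filter Nat.Prime),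
        primeProd h q.1 * (H * Real.log q.2) := by
    refine (sum_le_sum (g := fun q => primeProd h (q.1 / q.2) * (H * Real.log q.2))
      fun q hq => ?_).trans ?_
    · rw [mem_sigma] at hq
      have hpp := Nat.prime_of_mem_primeFactors hq.2
      refine mul_le_mul_of_nonneg_left ?_ (primeProd_nonneg h0 _)
      exact mul_le_mul_of_nonneg_right (hH _ hpp) (Real.log_natCast_nonneg _)
    · have inj : Set.InjOn (fun q : (Σ _ : ℕ, ℕ) => (⟨q.1 / q.2, q.2⟩ : Σ _ : ℕ, ℕ))
          ((sqfreeBelow x).sigma (fun n => n.primeFactors) : Finset (Σ _ : ℕ, ℕ)) := by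
        rintro ⟨n, p⟩ hq ⟨n', p'⟩ hq' he
        simp only [Sigma.mk.injEq, heq_eq_eq] at he
        rw [mem_coe, mem_sigma] at hq hq'
        obtain ⟨he, rfl⟩ := he
        have h1 := Nat.dvd_of_mem_primeFactors hq.2
        have h2 := Nat.dvd_of_mem_primeFactors hq'.2
        simp only at h1 h2
        have : n = n' := by
          rw [← Nat.div_mul_cancel h1, ← Nat.div_mul_cancel h2, he]
        subst this; rfl
      rw [← sum_image (g := fun q : (Σ _ : ℕ, ℕ) => (⟨q.1 / q.2, q.2⟩ : Σ _ : ℕ, ℕ))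
        (f := fun q : (Σ _ : ℕ, ℕ) => primeProd h q.1 * (H * Real.log q.2)) inj]
      refine sum_le_sum_of_subset_of_nonneg ?_ ?_
      · rintro ⟨m, p⟩ hmp
        obtain ⟨⟨n, p'⟩, hq, he⟩ := mem_image.1 hmp
        simp only [Sigma.mk.injEq, heq_eq_eq] at he
        obtain ⟨rfl, rfl⟩ := he
        rw [mem_sigma] at hq
        have hpp := Nat.prime_of_mem_primeFactors hq.2
        have hd := Nat.dvd_of_mem_primeFactors hq.2
        obtain ⟨hnx, hsq⟩ := mem_sqfreeBelow.1 hq.1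
        simp only at hd hnx hsq hpp
        rw [mem_sigma, mem_filter, mem_Ioc]
        have hn0 : 0 < n := Nat.pos_of_ne_zero hsq.ne_zero
        have hm0 : 0 < n / p' := Nat.div_pos (Nat.le_of_dvd hn0 hd) hpp.pos
        refine ⟨mem_sqfreeBelow.2 ⟨lt_of_le_of_lt ?_ hnx, hsq.squarefree_of_dvd (Nat.div_dvd_of_dvd hd)⟩,
          ⟨hpp.pos, ?_⟩, hpp⟩
        · exact_mod_cast Nat.div_le_self _ _
        · refine Nat.le_floor ?_
          rw [le_div_iff₀ (by exact_mod_cast hm0)]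
          refine le_trans ?_ hnx.le
          exact_mod_cast (Nat.mul_div_cancel' hd).le
      · intro q _ _
        exact mul_nonneg (primeProd_nonneg h0 _) (mul_nonneg hH0 (Real.log_natCast_nonneg _))
  refine e2.trans ?_
  rw [sum_sigma, mul_sum]
  refine sum_le_sum fun m hm => ?_
  simp only
  rw [← mul_sum, ← mul_sum]
  have hth := Chebyshev.theta_le_log4_mul_x (x := x / m) (by positivity)
  rw [Chebyshev.theta] at hth
  calc primeProd h m * (H * ∑ p ∈ Ioc 0 ⌊x / m⌋₊ with Nat.Prime p, Real.log p)
      ≤ primeProd h m * (H * (Real.log 4 * (x / m))) := by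
        refine mul_le_mul_of_nonneg_left ?_ (primeProd_nonneg h0 _)
        exact mul_le_mul_of_nonneg_left hth hH0
    _ = _ := by ring

/-- Sums of nonnegative multiplicative functions, in terms of the corresponding logarithmic sums. -/
lemma sum_primeProd_le_of_log_sum {h : ℕ → ℝ} {H : ℝ} (h0 : ∀ p, p.Prime → 0 ≤ h p)
    (hH : ∀ p, p.Prime → h p ≤ H) {x : ℝ} (hx : 1 < x) :
    ∑ n ∈ sqfreeBelow x, primeProd h n ≤
      (H * Real.log 4 + 1) * (x / Real.log x) * ∑ m ∈ sqfreeBelow x, primeProd h m / m := by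
  have hL := Real.log_pos hx
  have key : (∑ n ∈ sqfreeBelow x, primeProd h n) * Real.log x ≤
      (H * Real.log 4 + 1) * x * ∑ m ∈ sqfreeBelow x, primeProd h m / m := by
    have h1 := primeProd_mul_log_sum_le h0 hH (x := x) (by linarith)
    have h2 : (∑ n ∈ sqfreeBelow x, primeProd h n) * Real.log x ≤
        ∑ n ∈ sqfreeBelow x, primeProd h n * Real.log n +
          x * ∑ m ∈ sqfreeBelow x, primeProd h m / m := by
      rw [sum_mul, mul_sum, ← sum_add_distrib]
      refine sum_le_sum fun n hn => ?_
      obtain ⟨hnx, hsq⟩ := mem_sqfreeBelow.1 hn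
      have hn0 : (0 : ℝ) < n := by exact_mod_cast Nat.pos_of_ne_zero hsq.ne_zero
      have : Real.log x ≤ Real.log n + x / n := by
        have := Real.log_le_self (x := x / n) (by positivity)
        rw [Real.log_div (by linarith) hn0.ne'] at this
        linarith
      calc primeProd h n * Real.log x ≤ primeProd h n * (Real.log n + x / n) :=
            mul_le_mul_of_nonneg_left this (primeProd_nonneg h0 _)
        _ = _ := by ring
    linarith
  calc _ = ((∑ n ∈ sqfreeBelow x, primeProd h n) * Real.log x) / Real.log x := by field_simp
    _ ≤ _ := div_le_div_of_nonneg_right key hL.le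
    _ = _ := by ring

lemma sum_primeProd_le_prod {g : ℕ → ℝ} (hg : ∀ p, p.Prime → 0 ≤ g p) (x : ℝ) :
    ∑ n ∈ sqfreeBelow x, primeProd g n ≤ ∏ p ∈ (range ⌈x⌉₊).filter Nat.Prime, (1 + g p) := by
  rw [prod_one_add]
  have inj : Set.InjOn Nat.primeFactors (sqfreeBelow x : Set ℕ) := by
    intro m hm n hn he
    have h1 := (mem_sqfreeBelow.1 (mem_coe.1 hm)).2
    have h2 := (mem_sqfreeBelow.1 (mem_coe.1 hn)).2
    rw [← Nat.prod_primeFactors_of_squarefree h1, he, Nat.prod_primeFactors_of_squarefree h2]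
  have := sum_image (f := fun t : Finset ℕ => ∏ p ∈ t, g p) inj
  change ∑ n ∈ sqfreeBelow x, ∏ p ∈ n.primeFactors, g p ≤ _
  rw [← this]
  refine sum_le_sum_of_subset_of_nonneg ?_ ?_
  · intro t ht
    obtain ⟨n, hn, rfl⟩ := mem_image.1 ht
    rw [mem_powerset]
    intro p hp
    rw [mem_filter, mem_range, Nat.lt_ceil]
    have hnn := mem_sqfreeBelow.1 hn
    refine ⟨lt_of_le_of_lt ?_ hnn.1, Nat.prime_of_mem_primeFactors hp⟩
    exact_mod_cast Nat.le_of_mem_primeFactors hp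
  · intro t ht _
    rw [mem_powerset] at ht
    exact prod_nonneg fun p hp => hg p (mem_filter.1 (ht hp)).2

/-- Rankin's trick. -/
lemma log_sum_primeProd_le {h : ℕ → ℝ} (h0 : ∀ p, p.Prime → 0 ≤ h p) {x : ℝ} (hx : 1 < x) :
    ∑ m ∈ sqfreeBelow x, primeProd h m / m ≤
      Real.exp 1 * Real.exp (∑ p ∈ (range ⌈x⌉₊).filter Nat.Prime,
        h p * (p : ℝ) ^ (-(1 + 1 / Real.log x))) := by
  set s := 1 + 1 / Real.log x with hs
  have hL := Real.log_pos hx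
  calc ∑ m ∈ sqfreeBelow x, primeProd h m / m
      ≤ ∑ m ∈ sqfreeBelow x, Real.exp 1 * primeProd (fun p => h p * (p : ℝ) ^ (-s)) m := by
        refine sum_le_sum fun m hm => ?_
        obtain ⟨hmx, hsq⟩ := mem_sqfreeBelow.1 hm
        have hm0 : (0 : ℝ) < m := by exact_mod_cast Nat.pos_of_ne_zero hsq.ne_zero
        rw [primeProd_rpow_neg _ _ hsq, div_eq_mul_inv, mul_left_comm]
        refine mul_le_mul_of_nonneg_left ?_ (primeProd_nonneg h0 _)
        have e : (m : ℝ) ^ (-s) = (m : ℝ)⁻¹ * (m : ℝ) ^ (-(1 / Real.log x)) := by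
          rw [hs, neg_add, Real.rpow_add hm0, Real.rpow_neg_one]
        have e2 : Real.exp (-1) ≤ (m : ℝ) ^ (-(1 / Real.log x)) := by
          rw [Real.rpow_def_of_pos hm0]
          apply Real.exp_le_exp.2
          have : Real.log m ≤ Real.log x := Real.log_le_log hm0 hmx.le
          have h3 : Real.log m / Real.log x ≤ 1 := (div_le_one hL).2 this
          have : Real.log m * -(1 / Real.log x) = -(Real.log m / Real.log x) := by ring
          linarith
        rw [e]
        calc (m : ℝ)⁻¹ = Real.exp 1 * ((m : ℝ)⁻¹ * Real.exp (-1)) := by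
              rw [mul_left_comm, ← Real.exp_add]; simp
          _ ≤ _ := by gcongr
    _ = Real.exp 1 * ∑ m ∈ sqfreeBelow x, primeProd (fun p => h p * (p : ℝ) ^ (-s)) m := by
        rw [mul_sum]
    _ ≤ _ := by
        refine mul_le_mul_of_nonneg_left ?_ (Real.exp_pos _).le
        refine (sum_primeProd_le_prod (fun p hp => mul_nonneg (h0 p hp) (by positivity)) x).trans ?_
        rw [Real.exp_sum]
        refine prod_le_prod (fun p hp => ?_) fun p hp => ?_
        · have := h0 p (mem_filter.1 hp).2
          positivity
        · rw [add_comm]; exact Real.add_one_le_exp _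

lemma rpow_neg_le_telescope {σ : ℝ} (hσ : 0 < σ) {n : ℕ} (hn : 1 ≤ n) :
    ((n + 1 : ℕ) : ℝ) ^ (-(1 + σ)) ≤ 1 / σ * ((n : ℝ) ^ (-σ) - ((n + 1 : ℕ) : ℝ) ^ (-σ)) := by
  have hn0 : (0 : ℝ) < n := by exact_mod_cast hn
  set m : ℝ := ((n + 1 : ℕ) : ℝ) with hm
  have hm0 : 0 < m := by rw [hm]; positivity
  have hnm : (n : ℝ) = m - 1 := by rw [hm]; push_cast; ring
  have e1 : m ^ (-(1 + σ)) = m ^ (-σ) * m⁻¹ := by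
    rw [neg_add, Real.rpow_add hm0, Real.rpow_neg_one, mul_comm]
  have e2 : m ^ (-σ) * (1 + σ / m) ≤ (n : ℝ) ^ (-σ) := by
    have : (n : ℝ) = m * (1 - 1 / m) := by rw [hnm]; field_simp
    have hpos : 0 < 1 - 1 / m := by
      have : 0 < m * (1 - 1 / m) := this ▸ hn0
      exact (mul_pos_iff_of_pos_left hm0).1 this
    rw [this, Real.mul_rpow hm0.le hpos.le]
    refine mul_le_mul_of_nonneg_left ?_ (by positivity)
    rw [Real.rpow_def_of_pos hpos]
    have h1 := Real.add_one_le_exp (Real.log (1 - 1 / m) * -σ)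
    have h2 := Real.log_le_sub_one_of_pos hpos
    have : σ / m ≤ Real.log (1 - 1 / m) * -σ := by
      have : σ / m = (1 - 1 / m - 1) * -σ := by ring
      rw [this]
      exact mul_le_mul_of_nonpos_right h2 (by linarith)
    linarith
  rw [e1]
  have : m ^ (-σ) * m⁻¹ = 1 / σ * (m ^ (-σ) * (1 + σ / m) - m ^ (-σ)) := by
    field_simp; ring
  rw [this]
  gcongr

lemma sum_range_rpow_neg_le {σ : ℝ} (hσ : 0 < σ) (N : ℕ) :
    ∑ n ∈ range N, (n : ℝ) ^ (-(1 + σ)) ≤ 1 + 1 / σ := by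
  have key : ∀ N : ℕ, ∑ n ∈ range (N + 2), (n : ℝ) ^ (-(1 + σ)) ≤
      1 + 1 / σ * (1 - ((N + 1 : ℕ) : ℝ) ^ (-σ)) := by
    intro N
    induction N with
    | zero =>
      simp [sum_range_succ]
      rw [Real.zero_rpow (by linarith)]
    | succ N ih =>
      rw [sum_range_succ]
      have := rpow_neg_le_telescope hσ (n := N + 1) (by omega)
      have e : 1 / σ * (1 - ((N + 1 + 1 : ℕ) : ℝ) ^ (-σ)) = 1 / σ * (1 - ((N + 1 : ℕ) : ℝ) ^ (-σ))
        + 1 / σ * (((N + 1 : ℕ) : ℝ) ^ (-σ) - ((N + 1 + 1 : ℕ) : ℝ) ^ (-σ)) := by ring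
      rw [e]
      linarith
  calc ∑ n ∈ range N, (n : ℝ) ^ (-(1 + σ)) ≤ ∑ n ∈ range (N + 2), (n : ℝ) ^ (-(1 + σ)) :=
        sum_le_sum_of_subset_of_nonneg (range_mono (by omega)) fun _ _ _ => by positivity
    _ ≤ _ := key N
    _ ≤ 1 + 1 / σ := by
        have : 0 ≤ 1 / σ * ((N + 1 : ℕ) : ℝ) ^ (-σ) := by positivity
        linarith

lemma abs_sum_range_mul_le_of_antitone {w c : ℕ → ℝ} {B : ℝ} (hw : Antitone w) (hw0 : ∀ n, 0 ≤ w n)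
    (hc : ∀ N, |∑ n ∈ range N, c n| ≤ B) (N : ℕ) : |∑ n ∈ range N, w n * c n| ≤ B * w 0 := by
  have hB : 0 ≤ B := (abs_nonneg _).trans (hc 0)
  rcases Nat.eq_zero_or_pos N with rfl | hN
  · simpa using mul_nonneg hB (hw0 0)
  have := sum_range_by_parts w c N
  simp only [smul_eq_mul] at this
  rw [this]
  have tel : ∑ i ∈ range (N - 1), (w (i + 1) - w i) = w (N - 1) - w 0 := sum_range_sub w (N - 1)
  calc |w (N - 1) * ∑ i ∈ range N, c i - ∑ i ∈ range (N - 1), (w (i + 1) - w i) * ∑ i ∈ range (i + 1), c i|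
      ≤ |w (N - 1) * ∑ i ∈ range N, c i| +
        |∑ i ∈ range (N - 1), (w (i + 1) - w i) * ∑ i ∈ range (i + 1), c i| := abs_sub _ _
    _ ≤ w (N - 1) * B + ∑ i ∈ range (N - 1), -(w (i + 1) - w i) * B := by
        gcongr
        · rw [abs_mul, abs_of_nonneg (hw0 _)]
          exact mul_le_mul_of_nonneg_left (hc _) (hw0 _)
        · refine (abs_sum_le_sum_abs _ _).trans (sum_le_sum fun i _ => ?_)
          have : w (i + 1) - w i ≤ 0 := sub_nonpos.2 (hw (Nat.le_succ i))
          rw [abs_mul, abs_of_nonpos this]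
          exact mul_le_mul_of_nonneg_left (hc _) (by linarith)
    _ = B * w 0 := by
        rw [← sum_mul, sum_neg_distrib, tel]; ring

lemma tsum_le_log_add_three {Ψ : ℕ → ℝ} (h1 : ∀ n, |Ψ n| ≤ 1) {B : ℕ} (hB : 1 ≤ B)
    (hS : ∀ N, |∑ n ∈ range N, Ψ n| ≤ B) {s : ℝ} (hs : 1 < s)
    (hsum : Summable fun n : ℕ => Ψ n * (n : ℝ) ^ (-s)) :
    ∑' n : ℕ, Ψ n * (n : ℝ) ^ (-s) ≤ Real.log B + 3 := by
  have hB0 : (0 : ℝ) < B := by exact_mod_cast hB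
  refine le_of_tendsto hsum.hasSum.tendsto_sum_nat (Eventually.of_forall fun N => ?_)
  set w : ℕ → ℝ := fun n => ((max n B : ℕ) : ℝ) ^ (-s) with hw
  have hw0 : ∀ n, 0 ≤ w n := fun n => by positivity
  have hwa : Antitone w := by
    intro m n hmn
    refine Real.rpow_le_rpow_of_nonpos ?_ ?_ (by linarith)
    · exact_mod_cast lt_of_lt_of_le hB (le_max_right _ _)
    · exact_mod_cast max_le_max_right B hmn
  have hA := abs_sum_range_mul_le_of_antitone hwa hw0 hS N
  have hw1 : B * w 0 ≤ 1 := by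
    have : w 0 ≤ (B : ℝ)⁻¹ := by
      simp only [hw, zero_le, max_eq_right]
      rw [← Real.rpow_neg_one]
      exact Real.rpow_le_rpow_of_exponent_le (by exact_mod_cast hB) (by linarith)
    calc B * w 0 ≤ B * (B : ℝ)⁻¹ := by gcongr
      _ = 1 := mul_inv_cancel₀ hB0.ne'
  have hrest : ∑ n ∈ range N, Ψ n * ((n : ℝ) ^ (-s) - w n) ≤ Real.log B + 2 := by
    have hh := harmonic_le_one_add_log B
    calc ∑ n ∈ range N, Ψ n * ((n : ℝ) ^ (-s) - w n)
        ≤ ∑ n ∈ range N, if n < B ∧ n ≠ 0 then ((n : ℝ))⁻¹ else if n = 0 then 1 else 0 := by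
          refine sum_le_sum fun n _ => ?_
          rcases Nat.eq_zero_or_pos n with rfl | hn
          · have h0 : |(((0 : ℕ) : ℝ) ^ (-s) - w 0)| ≤ 1 := by
              rw [Nat.cast_zero, Real.zero_rpow (by linarith), zero_sub, abs_neg, abs_of_nonneg (hw0 0)]
              refine le_trans ?_ hw1
              have : (1 : ℝ) ≤ B := by exact_mod_cast hB
              nlinarith [hw0 0]
            simp only [ne_eq, not_true_eq_false, and_false, if_false, if_true]
            calc _ ≤ |Ψ 0 * (((0 : ℕ) : ℝ) ^ (-s) - w 0)| := le_abs_self _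
              _ = |Ψ 0| * |(((0 : ℕ) : ℝ) ^ (-s) - w 0)| := abs_mul _ _
              _ ≤ 1 * 1 := by gcongr; exact h1 0
              _ = 1 := one_mul 1
          · by_cases hnB : n < B
            · rw [if_pos ⟨hnB, hn.ne'⟩]
              have hn1 : (1 : ℝ) ≤ n := by exact_mod_cast hn
              have hle : w n ≤ (n : ℝ) ^ (-s) := by
                refine Real.rpow_le_rpow_of_nonpos (by linarith) ?_ (by linarith)
                exact_mod_cast le_max_left _ _
              calc Ψ n * ((n : ℝ) ^ (-s) - w n) ≤ 1 * ((n : ℝ) ^ (-s) - w n) := by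
                    refine mul_le_mul_of_nonneg_right ((le_abs_self _).trans (h1 n)) (by linarith)
                _ ≤ (n : ℝ) ^ (-s) := by linarith [hw0 n]
                _ ≤ (n : ℝ) ^ (-1 : ℝ) := Real.rpow_le_rpow_of_exponent_le hn1 (by linarith)
                _ = _ := Real.rpow_neg_one _
            · rw [if_neg (fun h => hnB h.1), if_neg hn.ne']
              have : w n = (n : ℝ) ^ (-s) := by
                simp only [hw]; rw [max_eq_left (by omega)]
              rw [this]; simp
      _ ≤ ∑ n ∈ range (B + N), if n < B ∧ n ≠ 0 then ((n : ℝ))⁻¹ else if n = 0 then 1 else 0 := by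
          refine sum_le_sum_of_subset_of_nonneg (range_mono (by omega)) fun n _ _ => ?_
          split_ifs <;> positivity
      _ ≤ 1 + ∑ n ∈ range B, ((n + 1 : ℕ) : ℝ)⁻¹ := by
          rw [show B + N = (B - 1 + N) + 1 by omega, sum_range_succ', add_comm]
          simp only [ne_eq, not_true_eq_false, and_false, if_false, if_true]
          gcongr
          calc _ ≤ ∑ n ∈ range (B - 1 + N), if n < B then ((n + 1 : ℕ) : ℝ)⁻¹ else 0 := by
                refine sum_le_sum fun n _ => ?_
                have : (0 : ℝ) ≤ ((n + 1 : ℕ) : ℝ)⁻¹ := by positivity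
                rw [if_neg (Nat.succ_ne_zero n)]
                by_cases h : n + 1 < B
                · rw [if_pos ⟨h, Nat.succ_ne_zero n⟩, if_pos (by omega)]
                · rw [if_neg fun h' => h h'.1]
                  split_ifs <;> positivity
            _ = ∑ n ∈ (range (B - 1 + N)).filter (· < B), ((n + 1 : ℕ) : ℝ)⁻¹ := (sum_filter _ _).symm
            _ ≤ _ := by
                refine sum_le_sum_of_subset_of_nonneg ?_ fun _ _ _ => by positivity
                intro n hn
                simpa using (mem_filter.1 hn).2
      _ ≤ Real.log B + 2 := by
          have : ((harmonic B : ℚ) : ℝ) = ∑ n ∈ range B, ((n + 1 : ℕ) : ℝ)⁻¹ := by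
            rw [harmonic]; push_cast; rfl
          linarith
  have e : ∑ n ∈ range N, Ψ n * (n : ℝ) ^ (-s) =
      ∑ n ∈ range N, Ψ n * ((n : ℝ) ^ (-s) - w n) + ∑ n ∈ range N, w n * Ψ n := by
    rw [← sum_add_distrib]; exact sum_congr rfl fun n _ => by ring
  rw [e]
  linarith [le_abs_self (∑ n ∈ range N, w n * Ψ n)]

lemma summable_nat_rpow_neg {s : ℝ} (hs : 1 < s) : Summable fun n : ℕ => (n : ℝ) ^ (-s) :=
  Real.summable_nat_rpow.2 (by linarith)

lemma summable_mul_rpow_neg {Ψ : ℕ → ℝ} (h1 : ∀ n, |Ψ n| ≤ 1) {s : ℝ} (hs : 1 < s) :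
    Summable fun n : ℕ => ‖Ψ n * (n : ℝ) ^ (-s)‖ := by
  refine Summable.of_nonneg_of_le (fun _ => norm_nonneg _) (fun n => ?_) (summable_nat_rpow_neg hs)
  rw [norm_mul, Real.norm_eq_abs, Real.norm_eq_abs, abs_of_nonneg (a := (n : ℝ) ^ (-s)) (by positivity)]
  exact mul_le_of_le_one_left (by positivity) (h1 n)

/-- `Ψ(n) n^{-s}` as a completely multiplicative function. -/
def twist (Ψ : ℕ →*₀ ℝ) (s : ℝ) : ℕ →*₀ ℝ where
  toFun n := Ψ n * (n : ℝ) ^ (-s)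
  map_zero' := by simp
  map_one' := by simp
  map_mul' m n := by
    rw [map_mul, Nat.cast_mul, Real.mul_rpow (by positivity) (by positivity)]; ring

lemma exp_tsum_primes_le (Ψ : ℕ →*₀ ℝ) (h1 : ∀ n, |Ψ n| ≤ 1) {s : ℝ} (hs : 1 < s) :
    Real.exp (∑' p : Nat.Primes, Ψ p * ((p : ℕ) : ℝ) ^ (-s)) ≤ ∑' n : ℕ, Ψ n * (n : ℝ) ^ (-s) := by
  have hsum := summable_mul_rpow_neg h1 hs
  have hE := EulerProduct.eulerProduct_completely_multiplicative_hasProd (f := twist Ψ s) hsum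
  have hP : Summable fun p : Nat.Primes => Ψ p * ((p : ℕ) : ℝ) ^ (-s) :=
    hsum.of_norm.comp_injective (i := fun p : Nat.Primes => (p : ℕ)) Subtype.val_injective
  refine le_of_tendsto_of_tendsto' ((Real.continuous_exp.tendsto _).comp hP.hasSum) hE fun F => ?_
  simp only [Function.comp_apply, Real.exp_sum]
  refine prod_le_prod (fun p _ => (Real.exp_pos _).le) fun p _ => ?_
  set y := Ψ p * ((p : ℕ) : ℝ) ^ (-s) with hy
  change Real.exp y ≤ (1 - y)⁻¹
  have hy1 : y < 1 := by
    have h2 : ((p : ℕ) : ℝ) ^ (-s) < 1 :=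
      Real.rpow_lt_one_of_one_lt_of_neg (by exact_mod_cast p.2.one_lt) (by linarith)
    have h3 : y ≤ ((p : ℕ) : ℝ) ^ (-s) := by
      rw [hy]
      exact mul_le_of_le_one_left (by positivity) ((le_abs_self _).trans (h1 _))
    linarith
  rw [le_inv_comm₀ (Real.exp_pos _) (by linarith), ← Real.exp_neg]
  linarith [Real.add_one_le_exp (-y)]

lemma sum_primes_le_tsum {h : ℕ → ℝ} (h0 : ∀ p, p.Prime → 0 ≤ h p)
    (hs : Summable fun p : Nat.Primes => h p) (N : ℕ) :
    ∑ p ∈ (range N).filter Nat.Prime, h p ≤ ∑' p : Nat.Primes, h p := by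
  have : ∑ p ∈ (range N).filter Nat.Prime, h p =
      ∑ p ∈ (range N).subtype Nat.Prime, h (p : ℕ) := by
    rw [← sum_subtype_eq_sum_filter]
  rw [this]
  exact hs.sum_le_tsum (f := fun p : Nat.Primes => h p) _ fun p _ => h0 p p.2

lemma one_le_tsum_primes_exp {s : ℝ} (hs : 1 < s) :
    ∑' n : ℕ, (n : ℝ) ^ (-s) ≤ 1 + 1 / (s - 1) := by
  refine le_of_tendsto (summable_nat_rpow_neg hs).hasSum.tendsto_sum_nat
    (Eventually.of_forall fun N => ?_)
  have := sum_range_rpow_neg_le (σ := s - 1) (by linarith) N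
  simpa using this

/-- The trivial completely multiplicative function, sending `0` to `0` and all else to `1`. -/
def unitHom : ℕ →*₀ ℝ where
  toFun n := if n = 0 then 0 else 1
  map_zero' := by simp
  map_one' := by simp
  map_mul' m n := by by_cases hm : m = 0 <;> by_cases hn : n = 0 <;> simp [hm, hn]

lemma tsum_primes_rpow_neg_le {x : ℝ} (hx : 1 < x) :
    ∑' p : Nat.Primes, ((p : ℕ) : ℝ) ^ (-(1 + 1 / Real.log x)) ≤ Real.log (1 + Real.log x) := by
  have hL := Real.log_pos hx
  have hs : 1 < 1 + 1 / Real.log x := by linarith [one_div_pos.2 hL]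
  rw [Real.le_log_iff_exp_le (by linarith)]
  have := exp_tsum_primes_le unitHom (fun n => by
    change |if n = 0 then (0 : ℝ) else 1| ≤ 1
    split_ifs <;> simp) hs
  have e : ∀ n : ℕ, unitHom n * (n : ℝ) ^ (-(1 + 1 / Real.log x)) = (n : ℝ) ^ (-(1 + 1 / Real.log x)) := by
    intro n
    change (if n = 0 then (0 : ℝ) else 1) * _ = _
    split_ifs with h
    · subst h; rw [zero_mul, Nat.cast_zero, Real.zero_rpow (by linarith)]
    · rw [one_mul]
  simp only [e] at this
  refine this.trans ((one_le_tsum_primes_exp hs).trans ?_)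
  simp

/-- Logarithmic sums of multiplicative functions equal on primes to at most `c + b Ψ(p)`. -/
lemma log_sum_primeProd_character_le {b c : ℝ} (hb : 0 ≤ b) (hc : 0 ≤ c) {Ψ : ℕ →*₀ ℝ}
    (h1 : ∀ n, |Ψ n| ≤ 1) {B : ℕ} (hB : 1 ≤ B) (hS : ∀ N, |∑ n ∈ range N, Ψ n| ≤ B)
    {h : ℕ → ℝ} (h0 : ∀ p, p.Prime → 0 ≤ h p) (hh : ∀ p, p.Prime → h p ≤ c + b * Ψ p)
    {x : ℝ} (hx : 1 < x) :
    ∑ m ∈ sqfreeBelow x, primeProd h m / m ≤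
      Real.exp 1 * ((1 + Real.log x) ^ c * (Real.log B + 3) ^ b) := by
  refine (log_sum_primeProd_le h0 hx).trans ?_
  refine mul_le_mul_of_nonneg_left ?_ (Real.exp_pos _).le
  have hL := Real.log_pos hx
  set s := 1 + 1 / Real.log x with hsdef
  have hs : 1 < s := by linarith [one_div_pos.2 hL]
  have hsum := (summable_mul_rpow_neg h1 hs).of_norm
  have hP1 : Summable fun p : Nat.Primes => Ψ p * ((p : ℕ) : ℝ) ^ (-s) :=
    hsum.comp_injective (i := fun p : Nat.Primes => (p : ℕ)) Subtype.val_injective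
  have hP0 : Summable fun p : Nat.Primes => ((p : ℕ) : ℝ) ^ (-s) :=
    (summable_nat_rpow_neg hs).comp_injective (i := fun p : Nat.Primes => (p : ℕ)) Subtype.val_injective
  have hlogB : 0 < Real.log B + 3 := by
    have := Real.log_natCast_nonneg B
    linarith
  have e0 : ∑' p : Nat.Primes, Ψ p * ((p : ℕ) : ℝ) ^ (-s) ≤ Real.log (Real.log B + 3) := by
    rw [Real.le_log_iff_exp_le hlogB]
    exact (exp_tsum_primes_le Ψ h1 hs).trans (tsum_le_log_add_three h1 hB hS hs hsum)
  have e1 := tsum_primes_rpow_neg_le hx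
  rw [← hsdef] at e1
  have hle : ∀ p : ℕ, p.Prime → h p * (p : ℝ) ^ (-s) ≤
      c * (p : ℝ) ^ (-s) + b * (Ψ p * (p : ℝ) ^ (-s)) := fun p hp => by
    calc h p * (p : ℝ) ^ (-s) ≤ (c + b * Ψ p) * (p : ℝ) ^ (-s) :=
          mul_le_mul_of_nonneg_right (hh p hp) (by positivity)
      _ = _ := by ring
  have hT : Summable fun p : Nat.Primes =>
      (fun q : ℕ => c * (q : ℝ) ^ (-s) + b * (Ψ q * (q : ℝ) ^ (-s))) p :=
    (hP0.mul_left c).add (hP1.mul_left b)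
  have e2 : ∑ p ∈ (range ⌈x⌉₊).filter Nat.Prime, h p * (p : ℝ) ^ (-s) ≤
      c * Real.log (1 + Real.log x) + b * Real.log (Real.log B + 3) := by
    calc _ ≤ ∑ p ∈ (range ⌈x⌉₊).filter Nat.Prime,
          (c * (p : ℝ) ^ (-s) + b * (Ψ p * (p : ℝ) ^ (-s))) :=
          sum_le_sum fun p hp => hle p (mem_filter.1 hp).2
      _ ≤ ∑' p : Nat.Primes, (c * ((p : ℕ) : ℝ) ^ (-s) + b * (Ψ p * ((p : ℕ) : ℝ) ^ (-s))) := by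
          refine sum_primes_le_tsum (h := fun q : ℕ => c * (q : ℝ) ^ (-s) + b * (Ψ q * (q : ℝ) ^ (-s)))
            (fun p hp => ?_) hT _
          exact (mul_nonneg (h0 p hp) (by positivity)).trans (hle p hp)
      _ = c * ∑' p : Nat.Primes, ((p : ℕ) : ℝ) ^ (-s) +
          b * ∑' p : Nat.Primes, Ψ p * ((p : ℕ) : ℝ) ^ (-s) := by
          rw [(hP0.mul_left c).tsum_add (hP1.mul_left b), tsum_mul_left, tsum_mul_left]
      _ ≤ _ := by gcongr
  calc Real.exp (∑ p ∈ (range ⌈x⌉₊).filter Nat.Prime, h p * (p : ℝ) ^ (-s))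
      ≤ Real.exp (c * Real.log (1 + Real.log x) + b * Real.log (Real.log B + 3)) :=
        Real.exp_le_exp.2 e2
    _ = _ := by
        rw [Real.exp_add, Real.rpow_def_of_pos (by linarith), Real.rpow_def_of_pos hlogB]
        ring_nf

lemma log_sum_primeProd_le_rpow {H : ℝ} (hH : 0 ≤ H) {h : ℕ → ℝ} (h0 : ∀ p, p.Prime → 0 ≤ h p)
    (hh : ∀ p, p.Prime → h p ≤ H) {x : ℝ} (hx : 1 < x) :
    ∑ m ∈ sqfreeBelow x, primeProd h m / m ≤ Real.exp 1 * (1 + Real.log x) ^ H := by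
  refine (log_sum_primeProd_le h0 hx).trans ?_
  refine mul_le_mul_of_nonneg_left ?_ (Real.exp_pos _).le
  have hL := Real.log_pos hx
  have e1 := tsum_primes_rpow_neg_le hx
  set s := 1 + 1 / Real.log x with hsdef
  have hs : 1 < s := by linarith [one_div_pos.2 hL]
  have hP0 : Summable fun p : Nat.Primes => ((p : ℕ) : ℝ) ^ (-s) :=
    (summable_nat_rpow_neg hs).comp_injective (i := fun p : Nat.Primes => (p : ℕ)) Subtype.val_injective
  rw [Real.rpow_def_of_pos (by linarith), mul_comm (Real.log _)]
  apply Real.exp_le_exp.2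
  calc _ ≤ ∑ p ∈ (range ⌈x⌉₊).filter Nat.Prime, H * (p : ℝ) ^ (-s) :=
        sum_le_sum fun p hp => mul_le_mul_of_nonneg_right (hh p (mem_filter.1 hp).2) (by positivity)
    _ ≤ ∑' p : Nat.Primes, H * ((p : ℕ) : ℝ) ^ (-s) :=
        sum_primes_le_tsum (h := fun q : ℕ => H * (q : ℝ) ^ (-s)) (fun p _ => by positivity)
          (hP0.mul_left H) _
    _ = H * ∑' p : Nat.Primes, ((p : ℕ) : ℝ) ^ (-s) := tsum_mul_left
    _ ≤ _ := by gcongr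

lemma sum_primeProd_character_le {b c : ℝ} (hb : 0 ≤ b) (hc : 0 ≤ c) {Ψ : ℕ →*₀ ℝ}
    (h1 : ∀ n, |Ψ n| ≤ 1) {B : ℕ} (hB : 1 ≤ B) (hS : ∀ N, |∑ n ∈ range N, Ψ n| ≤ B)
    {h : ℕ → ℝ} (h0 : ∀ p, p.Prime → 0 ≤ h p) (hh : ∀ p, p.Prime → h p ≤ c + b * Ψ p)
    {x : ℝ} (hx : 1 < x) :
    ∑ n ∈ sqfreeBelow x, primeProd h n ≤ ((c + b) * Real.log 4 + 1) * Real.exp 1 *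
      (x / Real.log x * ((1 + Real.log x) ^ c * (Real.log B + 3) ^ b)) := by
  have hL := Real.log_pos hx
  have hH : ∀ p, p.Prime → h p ≤ c + b := fun p hp => by
    refine (hh p hp).trans ?_
    have := mul_le_mul_of_nonneg_left ((le_abs_self _).trans (h1 p)) hb
    linarith
  refine (sum_primeProd_le_of_log_sum h0 hH hx).trans ?_
  have h4 : 0 ≤ Real.log 4 := Real.log_nonneg (by norm_num)
  calc _ ≤ ((c + b) * Real.log 4 + 1) * (x / Real.log x) *
        (Real.exp 1 * ((1 + Real.log x) ^ c * (Real.log B + 3) ^ b)) :=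
        mul_le_mul_of_nonneg_left (log_sum_primeProd_character_le hb hc h1 hB hS h0 hh hx)
          (by positivity)
    _ = _ := by ring

lemma sum_primeProd_le_rpow {H : ℝ} (hH : 0 ≤ H) {h : ℕ → ℝ} (h0 : ∀ p, p.Prime → 0 ≤ h p)
    (hh : ∀ p, p.Prime → h p ≤ H) {x : ℝ} (hx : 1 < x) :
    ∑ n ∈ sqfreeBelow x, primeProd h n ≤ (H * Real.log 4 + 1) * Real.exp 1 *
      (x / Real.log x * (1 + Real.log x) ^ H) := by
  have hL := Real.log_pos hx
  refine (sum_primeProd_le_of_log_sum h0 hh hx).trans ?_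
  have h4 : 0 ≤ Real.log 4 := Real.log_nonneg (by norm_num)
  calc _ ≤ (H * Real.log 4 + 1) * (x / Real.log x) * (Real.exp 1 * (1 + Real.log x) ^ H) :=
        mul_le_mul_of_nonneg_left (log_sum_primeProd_le_rpow hH h0 hh hx) (by positivity)
    _ = _ := by ring

/-- The Jacobi symbol of natural numbers, as a real number. -/
def jac (m n : ℕ) : ℝ := (jacobiSym (m : ℤ) n : ℝ)

/-- The nontrivial character modulo `4`, as a real-valued function of natural numbers. -/
def chi4 (n : ℕ) : ℝ := ((ZMod.χ₄ (n : ZMod 4) : ℤ) : ℝ)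

lemma jac_mul_left (m n r : ℕ) : jac (m * n) r = jac m r * jac n r := by
  simp [jac, jacobiSym.mul_left]

lemma jac_mul_right (m : ℕ) {n r : ℕ} (hn : n ≠ 0) (hr : r ≠ 0) :
    jac m (n * r) = jac m n * jac m r := by
  simp [jac, jacobiSym.mul_right' _ hn hr]

lemma jac_one_left (n : ℕ) : jac 1 n = 1 := by simp [jac]

lemma jac_one_right (m : ℕ) : jac m 1 = 1 := by simp [jac]

lemma jac_trichotomy (m n : ℕ) : jac m n = 0 ∨ jac m n = 1 ∨ jac m n = -1 := by
  rcases jacobiSym.trichotomy (m : ℤ) n with h | h | h <;> simp [jac, h]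

lemma abs_jac_le_one (m n : ℕ) : |jac m n| ≤ 1 := by
  rcases jac_trichotomy m n with h | h | h <;> simp [h]

lemma jac_eq_zero_of_not_coprime {m n : ℕ} (hn : n ≠ 0) (h : ¬ Nat.Coprime m n) : jac m n = 0 := by
  have : NeZero n := ⟨hn⟩
  have : jacobiSym (m : ℤ) n = 0 := jacobiSym.eq_zero_iff_not_coprime.2 (by simpa using h)
  simp [jac, this]

lemma jac_sq_eq_one {m n : ℕ} (h : Nat.Coprime m n) : jac m n * jac m n = 1 := by
  have := jacobiSym.sq_one (a := (m : ℤ)) (b := n) (by simpa using h)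
  have h2 : jac m n ^ 2 = 1 := by rw [jac]; exact_mod_cast this
  rw [← h2]; ring

lemma jac_mod_left (m n : ℕ) : jac (m % n) n = jac m n := by
  rw [jac, jac, jacobiSym.mod_left (m : ℤ)]; simp

lemma chi4_mul (m n : ℕ) : chi4 (m * n) = chi4 m * chi4 n := by
  rw [chi4, Nat.cast_mul, map_mul, Int.cast_mul, chi4, chi4]

lemma chi4_of_mod {n : ℕ} : (n % 4 = 1 → chi4 n = 1) ∧ (n % 4 = 3 → chi4 n = -1) ∧
    (n % 2 = 0 → chi4 n = 0) := by
  refine ⟨fun h => ?_, fun h => ?_, fun h => ?_⟩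
  · simp [chi4, ZMod.χ₄_nat_one_mod_four h]
  · simp [chi4, ZMod.χ₄_nat_three_mod_four h]
  · rw [chi4, ZMod.χ₄_nat_eq_if_mod_four, if_pos h, Int.cast_zero]

lemma chi4_cases (n : ℕ) : chi4 n = 0 ∨ chi4 n = 1 ∨ chi4 n = -1 := by
  have := @chi4_of_mod n
  rcases (by omega : n % 4 = 1 ∨ n % 4 = 3 ∨ n % 2 = 0) with h | h | h
  · exact Or.inr (Or.inl (this.1 h))
  · exact Or.inr (Or.inr (this.2.1 h))
  · exact Or.inl (this.2.2 h)

lemma abs_chi4_le_one (n : ℕ) : |chi4 n| ≤ 1 := by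
  rcases chi4_cases n with h | h | h <;> simp [h]

lemma chi4_one : chi4 1 = 1 := chi4_of_mod.1 rfl

/-- The completely multiplicative function `J(n | Q) χ₄(n)^c`, vanishing at `0`. -/
def charHom (Q c : ℕ) : ℕ →*₀ ℝ where
  toFun n := if n = 0 then 0 else jac n Q * chi4 n ^ c
  map_zero' := by simp
  map_one' := by simp [jac_one_left, chi4_one]
  map_mul' m n := by
    by_cases hm : m = 0 <;> by_cases hn : n = 0 <;>
      simp [hm, hn, jac_mul_left, chi4_mul, mul_pow]
    ring

lemma charHom_apply {Q c n : ℕ} (hn : n ≠ 0) : charHom Q c n = jac n Q * chi4 n ^ c := by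
  change (if n = 0 then 0 else jac n Q * chi4 n ^ c) = _
  rw [if_neg hn]

lemma abs_charHom_le_one (Q c n : ℕ) : |charHom Q c n| ≤ 1 := by
  by_cases hn : n = 0
  · simp [hn]
  · rw [charHom_apply hn, abs_mul, abs_pow]
    exact mul_le_one₀ (abs_jac_le_one _ _) (by positivity) (pow_le_one₀ (abs_nonneg _) (abs_chi4_le_one _))

lemma abs_sum_range_le_of_periodic {f : ℕ → ℝ} {q : ℕ} (hq : 0 < q) (hper : ∀ n, f (n + q) = f n)
    (h1 : ∀ n, |f n| ≤ 1) {a : ℕ} (ha : Nat.Coprime a q) (hf : ∀ n, f (a * n) = -f n) (N : ℕ) :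
    |∑ n ∈ range N, f n| ≤ q := by
  have hmod : ∀ n, f (n % q) = f n := Function.Periodic.map_mod_nat hper
  have h0 : ∑ n ∈ range q, f n = 0 := by
    have : ∑ n ∈ range q, f n = ∑ n ∈ range q, f (a * n) := by
      symm
      refine sum_bij (fun n _ => (a * n) % q) (fun n _ => mem_range.2 (Nat.mod_lt _ hq)) ?_ ?_ ?_
      · intro m hm n hn he
        have : m ≡ n [MOD q] := Nat.ModEq.cancel_left_of_coprime (by rw [Nat.gcd_comm]; exact ha) he
        rwa [Nat.ModEq, Nat.mod_eq_of_lt (mem_range.1 hm), Nat.mod_eq_of_lt (mem_range.1 hn)] at this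
      · have hinj : Set.InjOn (fun n => (a * n) % q) (range q : Set ℕ) := by
          intro m hm n hn he
          have : m ≡ n [MOD q] := Nat.ModEq.cancel_left_of_coprime (by rw [Nat.gcd_comm]; exact ha) he
          rwa [Nat.ModEq, Nat.mod_eq_of_lt (mem_range.1 hm), Nat.mod_eq_of_lt (mem_range.1 hn)] at this
        have hsurj := surjOn_of_injOn_of_card_le (s := range q) (t := range q)
          (fun n => (a * n) % q) (fun n _ => mem_coe.2 (mem_range.2 (Nat.mod_lt _ hq))) hinj le_rfl
        intro n hn
        obtain ⟨m, hm, he⟩ := hsurj (mem_coe.2 hn)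
        exact ⟨m, hm, he⟩
      · intro n _
        exact (hmod _).symm
    have h2 : ∑ n ∈ range q, f (a * n) = -∑ n ∈ range q, f n := by
      rw [← sum_neg_distrib]; exact sum_congr rfl fun n _ => hf n
    linarith
  induction N using Nat.strong_induction_on with
  | _ N ih =>
    by_cases hN : N < q
    · calc _ ≤ ∑ n ∈ range N, |f n| := abs_sum_le_sum_abs _ _
        _ ≤ ∑ n ∈ range N, 1 := sum_le_sum fun n _ => h1 n
        _ = N := by simp
        _ ≤ q := by exact_mod_cast hN.le
    · obtain ⟨t, rfl⟩ := Nat.exists_eq_add_of_le (not_lt.1 hN)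
      rw [sum_range_add, h0, zero_add]
      have := ih t (by omega)
      convert this using 3 with i
      rw [add_comm, hper]

lemma exists_jac_eq_neg_one {p : ℕ} (hp : p.Prime) (hp2 : p ≠ 2) : ∃ g : ℕ, jac g p = -1 := by
  have := Fact.mk hp
  obtain ⟨a, ha⟩ := FiniteField.exists_nonsquare (F := ZMod p) (by rwa [ZMod.ringChar_zmod_n])
  refine ⟨a.val, ?_⟩
  have h : jacobiSym (a.val : ℤ) p = -1 := by
    rw [ZMod.nonsquare_iff_jacobiSym_eq_neg_one]
    simpa only [Int.cast_natCast, ZMod.natCast_zmod_val] using ha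
  rw [jac, h]; norm_num

lemma jac_add_mul (m n t : ℕ) : jac (m + n * t) n = jac m n := by
  rw [← jac_mod_left (m + n * t), Nat.add_mul_mod_self_left, jac_mod_left]

lemma chi4_add_mul (m t : ℕ) : chi4 (m + 4 * t) = chi4 m := by
  have : ((m + 4 * t : ℕ) : ZMod 4) = (m : ZMod 4) := by
    push_cast
    rw [show (4 : ZMod 4) = 0 from rfl, zero_mul, add_zero]
  rw [chi4, chi4, this]

lemma abs_sum_charHom_le {Q c p : ℕ} (hQ : Odd Q) (hp : p.Prime) (hpQ : p ∣ Q)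
    (hp2 : ¬ p * p ∣ Q) (N : ℕ) : |∑ n ∈ range N, charHom Q c n| ≤ (4 * Q : ℕ) := by
  obtain ⟨R, rfl⟩ := hpQ
  have hpo : Odd p := (Nat.odd_mul.1 hQ).1
  have hRo : Odd R := (Nat.odd_mul.1 hQ).2
  have hR0 : R ≠ 0 := hRo.pos.ne'
  have hcop : Nat.Coprime p R := (Nat.Prime.coprime_iff_not_dvd hp).2 fun h => hp2 (Nat.mul_dvd_mul_left p h)
  have hcop4 : Nat.Coprime p 4 := by
    have := Nat.coprime_two_right.2 hpo
    exact Nat.Coprime.mul_right this this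
  have hc : Nat.Coprime p (4 * R) := Nat.Coprime.mul_right hcop4 hcop
  obtain ⟨g, hg⟩ := exists_jac_eq_neg_one hp (by rintro rfl; exact absurd hpo (by decide))
  obtain ⟨a, ha1, ha2⟩ := Nat.chineseRemainder hc g 1
  have haR : a ≡ 1 [MOD R] := ha2.of_mul_left _
  have ha4 : a ≡ 1 [MOD 4] := ha2.of_mul_right _
  have hcgp : Nat.Coprime g p := by
    by_contra h
    have := jac_eq_zero_of_not_coprime hp.ne_zero h
    rw [hg] at this; norm_num at this
  have hap : Nat.Coprime a p := by
    have := ha1.gcd_eq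
    rw [Nat.Coprime, this]; exact hcgp
  have haR' : Nat.Coprime a (4 * R) := by
    have := ha2.gcd_eq
    rw [Nat.Coprime, this]; simp
  have hacop : Nat.Coprime a (4 * (p * R)) := by
    rw [show 4 * (p * R) = p * (4 * R) by ring]
    exact Nat.Coprime.mul_right hap haR'
  have hja : jac a (p * R) = -1 := by
    rw [jac_mul_right _ hp.ne_zero hR0, ← jac_mod_left a p, ha1, jac_mod_left, hg,
      ← jac_mod_left a R, haR, jac_mod_left, jac_one_left, mul_one]
  have hchi : chi4 a = 1 := chi4_of_mod.1 ha4
  have hQ1 : p * R ≠ 1 := by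
    intro h
    exact hp.one_lt.ne' (Nat.eq_one_of_mul_eq_one_right h)
  have hpos : 0 < p * R := hQ.pos
  have e : ∀ n, charHom (p * R) c n = jac n (p * R) * chi4 n ^ c := by
    intro n
    by_cases hn : n = 0
    · subst hn
      rw [map_zero, jac_eq_zero_of_not_coprime hpos.ne' (by simpa using hQ1), zero_mul]
    · exact charHom_apply hn
  refine abs_sum_range_le_of_periodic (q := 4 * (p * R)) (by omega) (fun n => ?_)
    (abs_charHom_le_one _ _) hacop (fun n => ?_) N
  · rw [e, e, show n + 4 * (p * R) = n + (p * R) * 4 by ring, jac_add_mul,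
      show n + (p * R) * 4 = n + 4 * (p * R) by ring, chi4_add_mul]
  · rw [e, e, jac_mul_left, chi4_mul, hja, hchi]; ring

lemma abs_sum_chi4_le (N : ℕ) : |∑ n ∈ range N, charHom 1 1 n| ≤ (4 : ℕ) := by
  have e : ∀ n, charHom 1 1 n = chi4 n := by
    intro n
    by_cases hn : n = 0
    · subst hn; rw [map_zero]; exact (chi4_of_mod.2.2 rfl).symm
    · rw [charHom_apply hn, jac_one_right, one_mul, pow_one]
  refine abs_sum_range_le_of_periodic (q := 4) (a := 3) (by omega) (fun n => ?_)
    (abs_charHom_le_one _ _) (by norm_num) (fun n => ?_) N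
  · rw [e, e]; exact chi4_add_mul n 1
  · rw [e, e, chi4_mul, chi4_of_mod.2.1 rfl]; ring

lemma exists_prime_exactly_dvd_mul {m n : ℕ} (hm : Squarefree m) (hn : Squarefree n) (hmn : m ≠ n) :
    ∃ p, p.Prime ∧ p ∣ m * n ∧ ¬ p * p ∣ m * n := by
  have key : ∀ {m n : ℕ}, Squarefree m → ∀ {p : ℕ}, p.Prime → p ∣ m → ¬ p ∣ n →
      p ∣ m * n ∧ ¬ p * p ∣ m * n := by
    intro m n hm p hp hpm hpn
    refine ⟨hpm.mul_right n, fun h => ?_⟩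
    have hc : Nat.Coprime (p * p) n := by
      have := (Nat.Prime.coprime_iff_not_dvd hp).2 hpn
      exact Nat.Coprime.mul_left this this
    have := hm p (hc.dvd_of_dvd_mul_right h)
    exact hp.one_lt.ne' (Nat.isUnit_iff.1 this)
  have : m.primeFactors ≠ n.primeFactors := fun h => hmn (by
    rw [← Nat.prod_primeFactors_of_squarefree hm, h, Nat.prod_primeFactors_of_squarefree hn])
  by_contra! hcon
  apply this
  ext p
  rw [Nat.mem_primeFactors_of_ne_zero hm.ne_zero, Nat.mem_primeFactors_of_ne_zero hn.ne_zero]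
  refine and_congr_right fun hp => ⟨fun h => ?_, fun h => ?_⟩
  · by_contra h2
    have := key hm hp h h2
    exact this.2 (hcon p hp this.1)
  · by_contra h2
    have := key hn hp h h2
    rw [mul_comm n m] at this
    exact this.2 (hcon p hp this.1)

lemma abs_sum_jac_mul_le {m n : ℕ} (hm : Squarefree m) (hn : Squarefree n) (hmn : m ≠ n)
    (hmo : Odd m) (hno : Odd n) (N : ℕ) :
    |∑ r ∈ range N, jac r m * jac r n| ≤ 4 * (m * n : ℝ) := by
  obtain ⟨p, hp, h1, h2⟩ := exists_prime_exactly_dvd_mul hm hn hmn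
  have := abs_sum_charHom_le (c := 0) (hmo.mul hno) hp h1 h2 N
  push_cast at this
  convert this using 3 with r
  by_cases hr : r = 0
  · subst hr
    rw [map_zero, ← jac_mul_right _ hm.ne_zero hn.ne_zero]
    refine jac_eq_zero_of_not_coprime (mul_ne_zero hm.ne_zero hn.ne_zero) fun h => ?_
    rw [Nat.coprime_zero_left] at h
    rw [h] at h1
    exact hp.one_lt.ne' (Nat.dvd_one.1 h1)
  · rw [charHom_apply hr, pow_zero, mul_one, jac_mul_right _ hm.ne_zero hn.ne_zero]

lemma sum_pow_four_le (A : Finset ℕ) (f : ℕ → ℝ) :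
    (∑ m ∈ A, f m) ^ 4 ≤ (#A : ℝ) ^ 3 * ∑ m ∈ A, f m ^ 4 := by
  have h1 := sq_sum_le_card_mul_sum_sq (s := A) (f := f)
  have h2 := sq_sum_le_card_mul_sum_sq (s := A) (f := fun m => f m ^ 2)
  calc (∑ m ∈ A, f m) ^ 4 = ((∑ m ∈ A, f m) ^ 2) ^ 2 := by ring
    _ ≤ (#A * ∑ m ∈ A, f m ^ 2) ^ 2 := by gcongr
    _ = (#A : ℝ) ^ 2 * (∑ m ∈ A, f m ^ 2) ^ 2 := by ring
    _ ≤ (#A : ℝ) ^ 2 * (#A * ∑ m ∈ A, (f m ^ 2) ^ 2) := by gcongr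
    _ = _ := by
      simp only [← pow_mul]; ring

lemma card_primeFactors_mul_le {m n : ℕ} :
    #(m * n).primeFactors ≤ #m.primeFactors + #n.primeFactors := by
  by_cases hm : m = 0
  · simp [hm]
  by_cases hn : n = 0
  · simp [hn]
  rw [Nat.primeFactors_mul hm hn]
  exact card_union_le _ _

lemma card_fiber_quadruples_le {B : Finset ℕ} {W : ℕ}
    (hB : ∀ n ∈ B, Squarefree n ∧ #n.primeFactors ≤ W) (r : ℕ) :
    #(((B ×ˢ B) ×ˢ (B ×ˢ B)).filter fun q => q.1.1 * q.1.2 * (q.2.1 * q.2.2) = r) ≤ 2 ^ (16 * W) := by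
  rcases eq_empty_or_nonempty
    (((B ×ˢ B) ×ˢ (B ×ˢ B)).filter fun q => q.1.1 * q.1.2 * (q.2.1 * q.2.2) = r) with h | ⟨q0, hq0⟩
  · rw [h]; simp
  simp only [mem_filter, mem_product] at hq0
  have hr0 : r ≠ 0 := by
    rw [← hq0.2]
    have := fun n hn => (hB n hn).1.ne_zero
    exact mul_ne_zero (mul_ne_zero (this _ hq0.1.1.1) (this _ hq0.1.1.2))
      (mul_ne_zero (this _ hq0.1.2.1) (this _ hq0.1.2.2))
  have hW : #r.primeFactors ≤ 4 * W := by
    rw [← hq0.2]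
    have h1 := (hB _ hq0.1.1.1).2
    have h2 := (hB _ hq0.1.1.2).2
    have h3 := (hB _ hq0.1.2.1).2
    have h4 := (hB _ hq0.1.2.2).2
    have a1 := @card_primeFactors_mul_le (q0.1.1 * q0.1.2) (q0.2.1 * q0.2.2)
    have a2 := @card_primeFactors_mul_le q0.1.1 q0.1.2
    have a3 := @card_primeFactors_mul_le q0.2.1 q0.2.2
    omega
  set P := r.primeFactors.powerset with hP
  have hPc : #P ≤ 2 ^ (4 * W) := by
    rw [hP, card_powerset]; exact Nat.pow_le_pow_right (by norm_num) hW
  have hle := card_le_card_of_injOn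
    (s := ((B ×ˢ B) ×ˢ (B ×ˢ B)).filter fun q => q.1.1 * q.1.2 * (q.2.1 * q.2.2) = r)
    (t := (P ×ˢ P) ×ˢ (P ×ˢ P))
    (fun q => ((q.1.1.primeFactors, q.1.2.primeFactors), (q.2.1.primeFactors, q.2.2.primeFactors)))
    (by
      rintro ⟨⟨a, b⟩, ⟨c, d⟩⟩ hq
      simp only [coe_filter, mem_product, Set.mem_ofPred_eq] at hq
      simp only [coe_product, Set.mem_prod, mem_coe, hP, mem_powerset]
      have hd : ∀ n, n ∣ r → n.primeFactors ⊆ r.primeFactors := fun n hn =>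
        Nat.primeFactors_mono hn hr0
      refine ⟨⟨hd _ ?_, hd _ ?_⟩, ⟨hd _ ?_, hd _ ?_⟩⟩
      · exact ⟨b * (c * d), by rw [← hq.2]; ring⟩
      · exact ⟨a * (c * d), by rw [← hq.2]; ring⟩
      · exact ⟨a * b * d, by rw [← hq.2]; ring⟩
      · exact ⟨a * b * c, by rw [← hq.2]; ring⟩)
    (by
      have hinj : ∀ m ∈ B, ∀ n ∈ B, m.primeFactors = n.primeFactors → m = n := by
        intro m hm n hn he
        rw [← Nat.prod_primeFactors_of_squarefree (hB m hm).1, he,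
          Nat.prod_primeFactors_of_squarefree (hB n hn).1]
      rintro ⟨⟨a, b⟩, ⟨c, d⟩⟩ hq ⟨⟨a', b'⟩, ⟨c', d'⟩⟩ hq' he
      simp only [coe_filter, mem_product, Set.mem_ofPred_eq] at hq hq'
      simp only [Prod.mk.injEq] at he
      rw [hinj _ hq.1.1.1 _ hq'.1.1.1 he.1.1, hinj _ hq.1.1.2 _ hq'.1.1.2 he.1.2,
        hinj _ hq.1.2.1 _ hq'.1.2.1 he.2.1, hinj _ hq.1.2.2 _ hq'.1.2.2 he.2.2])
  refine hle.trans ?_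
  rw [card_product, card_product]
  calc #P * #P * (#P * #P) ≤ 2 ^ (4 * W) * 2 ^ (4 * W) * (2 ^ (4 * W) * 2 ^ (4 * W)) := by gcongr
    _ = 2 ^ (16 * W) := by rw [← pow_add, ← pow_add]; congr 1; ring

lemma sum_sq_character_sums_le {A : Finset ℕ} {M N : ℕ}
    (hA : ∀ m ∈ A, Squarefree m ∧ Odd m ∧ m ≤ M) (hMN : M ≤ N) (hM : 1 ≤ M) :
    (∑ r ∈ range (N ^ 4 + 1), |∑ m ∈ A, jac r m|) ^ 2 ≤ 12 * M * (N : ℝ) ^ 8 := by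
  have hM' : (1 : ℝ) ≤ M := by exact_mod_cast hM
  have hMN' : (M : ℝ) ≤ N := by exact_mod_cast hMN
  have hN1 : (1 : ℝ) ≤ (N : ℝ) ^ 4 := one_le_pow₀ (hM'.trans hMN')
  have hcard : (#A : ℝ) ≤ M := by
    have : A ⊆ Icc 1 M := fun m hm =>
      mem_Icc.2 ⟨(hA m hm).2.1.pos, (hA m hm).2.2⟩
    have := card_le_card this
    simp only [Nat.card_Icc, Nat.add_sub_cancel] at this
    exact_mod_cast this
  have hdiag : ∑ r ∈ range (N ^ 4 + 1), (∑ m ∈ A, jac r m) ^ 2 ≤ 6 * M * (N : ℝ) ^ 4 := by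
    have e : ∑ r ∈ range (N ^ 4 + 1), (∑ m ∈ A, jac r m) ^ 2 =
        ∑ m ∈ A, ∑ n ∈ A, ∑ r ∈ range (N ^ 4 + 1), jac r m * jac r n := by
      simp only [sq, sum_mul_sum]
      rw [sum_comm]
      exact sum_congr rfl fun m _ => sum_comm
    rw [e]
    calc _ ≤ ∑ m ∈ A, ∑ n ∈ A, ((if m = n then 2 * (N : ℝ) ^ 4 else 0) + 4 * ((M : ℝ) * M)) := by
          refine sum_le_sum fun m hm => sum_le_sum fun n hn => ?_
          by_cases hmn : m = n
          · rw [if_pos hmn]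
            calc _ ≤ ∑ r ∈ range (N ^ 4 + 1), (1 : ℝ) := by
                  refine sum_le_sum fun r _ => (le_abs_self _).trans ?_
                  rw [abs_mul]
                  exact mul_le_one₀ (abs_jac_le_one _ _) (abs_nonneg _) (abs_jac_le_one _ _)
              _ = (N : ℝ) ^ 4 + 1 := by simp
              _ ≤ _ := by nlinarith [mul_self_nonneg (M : ℝ)]
          · rw [if_neg hmn, zero_add]
            obtain ⟨a1, a2, a3⟩ := hA m hm
            obtain ⟨b1, b2, b3⟩ := hA n hn
            have a3' : (m : ℝ) ≤ M := by exact_mod_cast a3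
            have b3' : (n : ℝ) ≤ M := by exact_mod_cast b3
            calc _ ≤ 4 * ((m : ℝ) * n) :=
                  (le_abs_self _).trans (abs_sum_jac_mul_le a1 b1 hmn a2 b2 _)
              _ ≤ _ := by gcongr
      _ = #A * (2 * (N : ℝ) ^ 4) + #A * (#A * (4 * ((M : ℝ) * M))) := by
          simp only [sum_add_distrib, sum_ite_eq, sum_const, nsmul_eq_mul]
          congr 1
          rw [sum_congr rfl fun m hm => if_pos hm]
          simp
      _ ≤ M * (2 * (N : ℝ) ^ 4) + M * (M * (4 * ((M : ℝ) * M))) := by gcongr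
      _ ≤ M * (2 * (N : ℝ) ^ 4) + M * (N * (4 * ((N : ℝ) * N))) := by gcongr
      _ ≤ M * (2 * (N : ℝ) ^ 4) + M * (N * (4 * ((N : ℝ) * N))) * N :=
          add_le_add_right (le_mul_of_one_le_right (by positivity) (hM'.trans hMN')) _
      _ = _ := by ring
  calc _ ≤ (#(range (N ^ 4 + 1)) : ℝ) * ∑ r ∈ range (N ^ 4 + 1), |∑ m ∈ A, jac r m| ^ 2 :=
        sq_sum_le_card_mul_sum_sq
    _ = ((N : ℝ) ^ 4 + 1) * ∑ r ∈ range (N ^ 4 + 1), (∑ m ∈ A, jac r m) ^ 2 := by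
        simp [sq_abs]
    _ ≤ (2 * (N : ℝ) ^ 4) * (6 * M * (N : ℝ) ^ 4) := by
        gcongr
        linarith
    _ = _ := by ring

/-- Bilinear sums of Jacobi symbols with the longer variable in the numerator. -/
lemma bilinear_jac_of_le {A B : Finset ℕ} {M N W : ℕ} {κ : ℝ} {α β : ℕ → ℝ}
    (hA : ∀ m ∈ A, Squarefree m ∧ Odd m ∧ m ≤ M)
    (hB : ∀ n ∈ B, Squarefree n ∧ #n.primeFactors ≤ W ∧ n ≤ N) (hM : 1 ≤ M) (hMN : M ≤ N)
    (hα : ∀ m ∈ A, |α m| ≤ κ) (hβ : ∀ n ∈ B, |β n| ≤ κ) (hκ : 0 ≤ κ) :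
    (∑ m ∈ A, ∑ n ∈ B, α m * β n * jac n m) ^ 8 * M ≤
      12 * κ ^ 16 * 2 ^ (32 * W) * ((M : ℝ) * N) ^ 8 := by
  set S := ∑ m ∈ A, ∑ n ∈ B, α m * β n * jac n m with hS
  set T : ℕ → ℝ := fun m => ∑ n ∈ B, β n * jac n m with hT
  set C : ℕ → ℝ := fun r => |∑ m ∈ A, jac r m| with hC
  have hcard : (#A : ℝ) ≤ M := by
    have : A ⊆ Icc 1 M := fun m hm =>
      mem_Icc.2 ⟨(hA m hm).2.1.pos, (hA m hm).2.2⟩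
    have := card_le_card this
    simp only [Nat.card_Icc, Nat.add_sub_cancel] at this
    exact_mod_cast this
  have s1 : |S| ≤ κ * ∑ m ∈ A, |T m| := by
    rw [hS, mul_sum]
    refine (abs_sum_le_sum_abs _ _).trans (sum_le_sum fun m hm => ?_)
    have : ∑ n ∈ B, α m * β n * jac n m = α m * T m := by
      rw [hT, mul_sum]; exact sum_congr rfl fun n _ => by ring
    rw [this, abs_mul]
    exact mul_le_mul_of_nonneg_right (hα m hm) (abs_nonneg _)
  have s2 : (∑ m ∈ A, |T m|) ^ 4 ≤ (M : ℝ) ^ 3 * ∑ m ∈ A, T m ^ 4 := by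
    refine (sum_pow_four_le A _).trans ?_
    have e : ∑ m ∈ A, |T m| ^ 4 = ∑ m ∈ A, T m ^ 4 :=
      sum_congr rfl fun m _ => by rw [← abs_pow, abs_of_nonneg (by positivity)]
    rw [e]
    have : 0 ≤ ∑ m ∈ A, T m ^ 4 := sum_nonneg fun m _ => by positivity
    gcongr
  have s3 : ∑ m ∈ A, T m ^ 4 ≤ κ ^ 4 * (2 ^ (16 * W) * ∑ r ∈ range (N ^ 4 + 1), C r) := by
    have e : ∀ m, T m ^ 4 = ∑ q ∈ (B ×ˢ B) ×ˢ (B ×ˢ B),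
        β q.1.1 * β q.1.2 * (β q.2.1 * β q.2.2) * jac (q.1.1 * q.1.2 * (q.2.1 * q.2.2)) m := by
      intro m
      have e2 : T m ^ 2 = ∑ q ∈ B ×ˢ B, β q.1 * β q.2 * jac (q.1 * q.2) m := by
        rw [sq, hT, sum_mul_sum, sum_product]
        refine sum_congr rfl fun a _ => sum_congr rfl fun b _ => ?_
        rw [jac_mul_left]; ring
      have : T m ^ 4 = T m ^ 2 * T m ^ 2 := by ring
      rw [this, e2, sum_mul_sum]
      conv_rhs => rw [sum_product]
      refine sum_congr rfl fun a _ => sum_congr rfl fun b _ => ?_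
      rw [jac_mul_left (a.1 * a.2)]; ring
    rw [sum_congr rfl fun m _ => e m, sum_comm]
    calc _ ≤ ∑ q ∈ (B ×ˢ B) ×ˢ (B ×ˢ B), κ ^ 4 * C (q.1.1 * q.1.2 * (q.2.1 * q.2.2)) := by
          refine sum_le_sum fun q hq => ?_
          simp only [mem_product] at hq
          rw [← mul_sum]
          refine (le_abs_self _).trans ?_
          rw [abs_mul]
          refine mul_le_mul_of_nonneg_right ?_ (abs_nonneg _)
          rw [abs_mul, abs_mul, abs_mul]
          calc _ ≤ κ * κ * (κ * κ) := by
                gcongr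
                exacts [hβ _ hq.1.1, hβ _ hq.1.2, hβ _ hq.2.1, hβ _ hq.2.2]
            _ = _ := by ring
      _ = κ ^ 4 * ∑ q ∈ (B ×ˢ B) ×ˢ (B ×ˢ B), C (q.1.1 * q.1.2 * (q.2.1 * q.2.2)) := by
          rw [mul_sum]
      _ ≤ _ := by
          refine mul_le_mul_of_nonneg_left ?_ (by positivity)
          rw [← sum_fiberwise_of_maps_to (t := range (N ^ 4 + 1))
            (g := fun q : (ℕ × ℕ) × (ℕ × ℕ) => q.1.1 * q.1.2 * (q.2.1 * q.2.2)), mul_sum]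
          · refine sum_le_sum fun r _ => ?_
            have hc : ∀ q ∈ ((B ×ˢ B) ×ˢ (B ×ˢ B)).filter
                (fun q => q.1.1 * q.1.2 * (q.2.1 * q.2.2) = r),
                C (q.1.1 * q.1.2 * (q.2.1 * q.2.2)) = C r := fun q hq => by rw [(mem_filter.1 hq).2]
            rw [sum_congr rfl hc, sum_const, nsmul_eq_mul]
            refine mul_le_mul_of_nonneg_right ?_ (abs_nonneg _)
            exact_mod_cast card_fiber_quadruples_le (fun n hn => ⟨(hB n hn).1, (hB n hn).2.1⟩) r
          · intro q hq
            simp only [mem_product] at hq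
            rw [mem_range, Nat.lt_succ_iff]
            calc _ ≤ N * N * (N * N) := by
                  gcongr
                  exacts [(hB _ hq.1.1).2.2, (hB _ hq.1.2).2.2, (hB _ hq.2.1).2.2, (hB _ hq.2.2).2.2]
              _ = N ^ 4 := by ring
  have s4 := sum_sq_character_sums_le hA hMN hM
  have hC0 : 0 ≤ ∑ r ∈ range (N ^ 4 + 1), C r := sum_nonneg fun r _ => abs_nonneg _
  have s5 : |S| ^ 4 ≤ κ ^ 8 * (M : ℝ) ^ 3 * 2 ^ (16 * W) * ∑ r ∈ range (N ^ 4 + 1), C r := by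
    calc |S| ^ 4 ≤ (κ * ∑ m ∈ A, |T m|) ^ 4 := by gcongr
      _ = κ ^ 4 * (∑ m ∈ A, |T m|) ^ 4 := by ring
      _ ≤ κ ^ 4 * ((M : ℝ) ^ 3 * (κ ^ 4 * (2 ^ (16 * W) * ∑ r ∈ range (N ^ 4 + 1), C r))) := by
          gcongr
          exact s2.trans (by gcongr)
      _ = _ := by ring
  calc S ^ 8 * M = (|S| ^ 4) ^ 2 * M := by
        rw [← pow_mul, show 4 * 2 = 8 from rfl, Even.pow_abs (by decide)]
    _ ≤ (κ ^ 8 * (M : ℝ) ^ 3 * 2 ^ (16 * W) * ∑ r ∈ range (N ^ 4 + 1), C r) ^ 2 * M := by gcongr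
    _ = κ ^ 16 * (M : ℝ) ^ 7 * 2 ^ (32 * W) * (∑ r ∈ range (N ^ 4 + 1), C r) ^ 2 := by
        rw [mul_pow, mul_pow, mul_pow, ← pow_mul, ← pow_mul, ← pow_mul]; ring
    _ ≤ κ ^ 16 * (M : ℝ) ^ 7 * 2 ^ (32 * W) * (12 * M * (N : ℝ) ^ 8) := by gcongr
    _ = _ := by ring

lemma jac_reciprocity {m n : ℕ} (hm : Odd m) (hn : Odd n) :
    jac n m = (if m % 4 = 3 ∧ n % 4 = 3 then -1 else 1) * jac m n := by
  have hm2 := Nat.odd_iff.1 hm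
  have hn2 := Nat.odd_iff.1 hn
  split_ifs with h
  · simp only [jac]
    rw [jacobiSym.quadratic_reciprocity_three_mod_four h.2 h.1]; push_cast; ring
  · simp only [jac, one_mul]
    rcases (by omega : n % 4 = 1 ∨ m % 4 = 1) with h1 | h1
    · rw [jacobiSym.quadratic_reciprocity_one_mod_four h1 hm]
    · rw [jacobiSym.quadratic_reciprocity_one_mod_four h1 hn]

/-- Bilinear sums of Jacobi symbols. -/
lemma bilinear_jac {A B : Finset ℕ} {M N W c : ℕ} {κ Z : ℝ} {α β : ℕ → ℝ}
    (hA : ∀ m ∈ A, Squarefree m ∧ Odd m ∧ #m.primeFactors ≤ W ∧ m ≤ M) (hAc : ∀ m ∈ A, m % 4 = c)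
    (hB : ∀ n ∈ B, Squarefree n ∧ Odd n ∧ #n.primeFactors ≤ W ∧ n ≤ N) (hM : 1 ≤ M) (hN : 1 ≤ N)
    (hα : ∀ m ∈ A, |α m| ≤ κ) (hβ : ∀ n ∈ B, |β n| ≤ κ) (hκ : 0 ≤ κ) (hZM : Z ≤ M) (hZN : Z ≤ N) :
    (∑ m ∈ A, ∑ n ∈ B, α m * β n * jac n m) ^ 8 * Z ≤
      12 * κ ^ 16 * 2 ^ (32 * W) * ((M : ℝ) * N) ^ 8 := by
  rcases le_total M N with hMN | hMN
  · refine le_trans ?_ (bilinear_jac_of_le (α := α) (β := β) (fun m hm => ⟨(hA m hm).1, (hA m hm).2.1, (hA m hm).2.2.2⟩)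
      (fun n hn => ⟨(hB n hn).1, (hB n hn).2.2⟩) hM hMN hα hβ hκ)
    gcongr
  · have e : ∑ m ∈ A, ∑ n ∈ B, α m * β n * jac n m =
        ∑ n ∈ B, ∑ m ∈ A, ((if c = 3 ∧ n % 4 = 3 then -1 else 1) * β n) * α m * jac m n := by
      rw [sum_comm]
      refine sum_congr rfl fun n hn => sum_congr rfl fun m hm => ?_
      rw [jac_reciprocity (hA m hm).2.1 (hB n hn).2.1, hAc m hm]; ring
    rw [e, mul_comm (M : ℝ)]
    refine le_trans ?_ (bilinear_jac_of_le
      (α := fun n => (if c = 3 ∧ n % 4 = 3 then -1 else 1) * β n) (β := α)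
      (fun m hm => ⟨(hB m hm).1, (hB m hm).2.1, (hB m hm).2.2.2⟩)
      (fun n hn => ⟨(hA n hn).1, (hA n hn).2.2⟩) hN hMN (fun n hn => ?_) hα hκ)
    · gcongr
    · rw [abs_mul]
      refine le_trans ?_ (hβ n hn)
      split_ifs <;> simp

/-- Labels attached to the primes dividing `n` when expanding the `k`-th power of `f̃(n)`. -/
abbrev Lab (k : ℕ) := Fin k → Fin 3 × Bool

/-- The exponent of `J(D_u | D_w)` in the expansion of the `k`-th power. -/
def phi {k : ℕ} (u w : Lab k) : ℕ := ∑ j, if (u j).2 = true ∧ (w j).1 ≠ (u j).1 then 1 else 0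

/-- Two labels are linked when this number is odd. -/
def linkNum {k : ℕ} (u w : Lab k) : ℕ := ∑ j, if (u j).1 ≠ (w j).1 ∧ (u j).2 ≠ (w j).2 then 1 else 0

/-- The maximal unlinked sets. -/
def maxUnlinked {k : ℕ} (σ : Fin k → Bool) : Finset (Lab k) := univ.filter fun u => ∀ j, (u j).2 = σ j

lemma mem_maxUnlinked {k : ℕ} {σ : Fin k → Bool} {u : Lab k} :
    u ∈ maxUnlinked σ ↔ ∀ j, (u j).2 = σ j := by simp [maxUnlinked]

lemma phi_self {k : ℕ} (u : Lab k) : phi u u = 0 := by simp [phi]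

lemma phi_add_phi_parity {k : ℕ} (u w : Lab k) : Odd (phi u w + phi w u) ↔ Odd (linkNum u w) := by
  have : phi u w + phi w u = linkNum u w +
      2 * ∑ j, if (u j).1 ≠ (w j).1 ∧ (u j).2 = true ∧ (w j).2 = true then 1 else 0 := by
    rw [phi, phi, linkNum, mul_sum, ← sum_add_distrib, ← sum_add_distrib]
    refine sum_congr rfl fun j _ => ?_
    by_cases h : (u j).1 = (w j).1
    · simp [h]
    · have h' : (w j).1 ≠ (u j).1 := fun e => h e.symm
      cases (u j).2 <;> cases (w j).2 <;> simp [h, h']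
  rw [this]
  simp [Nat.odd_add]

/-- Prepend a coordinate to a label. -/
def consLab {k : ℕ} (a : Fin 3 × Bool) (w : Lab k) : Lab (k + 1) := Fin.cons a w

lemma linkNum_cons {k : ℕ} (a b : Fin 3 × Bool) (u w : Lab k) :
    linkNum (consLab a u) (consLab b w) = (if a.1 ≠ b.1 ∧ a.2 ≠ b.2 then 1 else 0) + linkNum u w := by
  simp [linkNum, consLab, Fin.sum_univ_succ]

lemma linkNum_eq_zero {k : ℕ} {σ : Fin k → Bool} {u w : Lab k} (hu : u ∈ maxUnlinked σ)
    (hw : w ∈ maxUnlinked σ) : linkNum u w = 0 := by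
  rw [mem_maxUnlinked] at hu hw
  simp [linkNum, hu, hw]

lemma card_maxUnlinked {k : ℕ} (σ : Fin k → Bool) : #(maxUnlinked σ) = 3 ^ k := by
  have : #(maxUnlinked σ) = #(univ : Finset (Fin k → Fin 3)) := by
    symm
    refine card_bij (fun f _ j => (f j, σ j)) (fun f _ => by simp [mem_maxUnlinked]) ?_ ?_
    · intro f _ g _ h
      funext j
      exact congrArg Prod.fst (congrFun h j)
    · intro u hu
      rw [mem_maxUnlinked] at hu
      exact ⟨fun j => (u j).1, mem_univ _, funext fun j => Prod.ext rfl (hu j).symm⟩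
  rw [this]; simp

/-- A parity obstruction between two maximal unlinked sets. -/
lemma maxUnlinked_eq_of_parity {k : ℕ} {σ τ : Fin k → Bool} {f g : Lab k → ℕ}
    (h : ∀ x ∈ maxUnlinked σ, ∀ y ∈ maxUnlinked τ, Even (linkNum x y + f x + g y)) : σ = τ := by
  by_contra hne
  obtain ⟨j0, hj0⟩ := Function.ne_iff.1 hne
  set x : Fin 3 → Lab k := fun i j => (if j = j0 then i else 0, σ j) with hx
  set y : Fin 3 → Lab k := fun i j => (if j = j0 then i else 0, τ j) with hy
  have hxm : ∀ i, x i ∈ maxUnlinked σ := fun i => by simp [mem_maxUnlinked, hx]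
  have hym : ∀ i, y i ∈ maxUnlinked τ := fun i => by simp [mem_maxUnlinked, hy]
  have hl : ∀ i i', linkNum (x i) (y i') = if i ≠ i' then 1 else 0 := by
    intro i i'
    rw [linkNum, sum_eq_single j0]
    · simp [hx, hy, hj0]
    · intro j _ hj
      simp [hx, hy, hj]
    · simp
  have h00 := h _ (hxm 0) _ (hym 0)
  have h02 := h _ (hxm 0) _ (hym 2)
  have h10 := h _ (hxm 1) _ (hym 0)
  have h12 := h _ (hxm 1) _ (hym 2)
  rw [hl] at h00 h02 h10 h12
  simp at h00 h02 h10 h12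
  grind

/-- An unlinked set of labels has at most `3^k` elements, with equality only for the
maximal unlinked sets. -/
lemma unlinked_classification (k : ℕ) : ∀ A : Finset (Lab k),
    (∀ u ∈ A, ∀ w ∈ A, Even (linkNum u w)) →
      #A ≤ 3 ^ k ∧ (#A = 3 ^ k → ∃ σ, A = maxUnlinked σ) := by
  induction k with
  | zero =>
    intro A _
    refine ⟨by simpa using card_le_univ A, fun h => ⟨fun _ => true, ?_⟩⟩
    rw [pow_zero] at h
    refine eq_of_subset_of_card_le (fun u _ => mem_maxUnlinked.2 fun j => j.elim0) ?_
    rw [h]; simpa using card_maxUnlinked (fun _ : Fin 0 => true) |>.le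
  | succ k ih =>
    intro A hA
    set Sl : Fin 3 → Bool → Finset (Lab k) := fun i s => univ.filter fun w => consLab (i, s) w ∈ A
      with hSl
    have mSl : ∀ i s w, w ∈ Sl i s ↔ consLab (i, s) w ∈ A := by simp [hSl]
    have hcons : ∀ u : Lab (k + 1), consLab (u 0) (Fin.tail u) = u := fun u => Fin.cons_self_tail u
    have hcard : #A = ∑ i, (#(Sl i false) + #(Sl i true)) := by
      have h1 : #A = ∑ q : Fin 3 × Bool, #(A.filter fun u => u 0 = q) :=
        card_eq_sum_card_fiberwise fun _ _ => mem_univ _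
      rw [h1, Fintype.sum_prod_type]
      refine sum_congr rfl fun i _ => ?_
      have h2 : ∀ s, #(A.filter fun u => u 0 = (i, s)) = #(Sl i s) := by
        intro s
        symm
        refine card_bij (fun w _ => consLab (i, s) w) ?_ ?_ ?_
        · intro w hw
          rw [mem_filter]
          exact ⟨(mSl _ _ _).1 hw, by simp [consLab]⟩
        · intro w _ w' _ h
          exact (Fin.cons_right_injective (α := fun _ => Fin 3 × Bool) (i, s)) h
        · intro u hu
          rw [mem_filter] at hu
          have := hcons u
          rw [hu.2] at this
          exact ⟨Fin.tail u, (mSl _ _ _).2 (by rw [this]; exact hu.1), this⟩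
      rw [Fintype.sum_bool, h2, h2, add_comm]
    have hsame : ∀ i s s', ∀ u ∈ Sl i s, ∀ w ∈ Sl i s', Even (linkNum u w) := by
      intro i s s' u hu w hw
      have := hA _ ((mSl _ _ _).1 hu) _ ((mSl _ _ _).1 hw)
      rw [linkNum_cons] at this
      simpa using this
    have hdiff : ∀ i i' s s', i ≠ i' → ∀ u ∈ Sl i s, ∀ w ∈ Sl i' s',
        (s = s' → Even (linkNum u w)) ∧ (s ≠ s' → Odd (linkNum u w)) := by
      intro i i' s s' hi u hu w hw
      have := hA _ ((mSl _ _ _).1 hu) _ ((mSl _ _ _).1 hw)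
      rw [linkNum_cons] at this
      refine ⟨fun h => ?_, fun h => ?_⟩
      · simpa [h] using this
      · rw [if_pos ⟨hi, h⟩] at this
        grind
    have hC : ∀ i, ∀ u ∈ Sl i false ∪ Sl i true, ∀ w ∈ Sl i false ∪ Sl i true,
        Even (linkNum u w) := by
      intro i u hu w hw
      rw [mem_union] at hu hw
      rcases hu with hu | hu <;> rcases hw with hw | hw <;> exact hsame i _ _ u hu w hw
    have hCc := fun i => (ih _ (hC i)).1
    by_cases hdis : ∃ i, (Sl i false ∩ Sl i true).Nonempty
    · obtain ⟨i, x, hx⟩ := hdis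
      rw [mem_inter] at hx
      have hemp : ∀ i', i' ≠ i → ∀ s, Sl i' s = ∅ := by
        intro i' hi s
        by_contra hne
        obtain ⟨y, hy⟩ := nonempty_of_ne_empty hne
        have h1 := hdiff i i' false s hi.symm x hx.1 y hy
        have h2 := hdiff i i' true s hi.symm x hx.2 y hy
        cases s
        · exact Nat.not_even_iff_odd.2 (h2.2 (by simp)) (h1.1 rfl)
        · exact Nat.not_even_iff_odd.2 (h1.2 (by simp)) (h2.1 rfl)
      have htot : #A = #(Sl i false) + #(Sl i true) := by
        rw [hcard, sum_eq_single i]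
        · intro i' _ hi
          simp [hemp i' hi]
        · simp
      have h1 := (ih _ (hsame i false false)).1
      have h2 := (ih _ (hsame i true true)).1
      have h3 : 0 < 3 ^ k := by positivity
      have h4 : 3 ^ (k + 1) = 3 * 3 ^ k := by ring
      exact ⟨by omega, fun h => by omega⟩
    · have hdisj : ∀ i, Disjoint (Sl i false) (Sl i true) := by
        intro i
        rw [disjoint_iff_inter_eq_empty]
        by_contra hne
        exact hdis ⟨i, nonempty_of_ne_empty hne⟩
      have hcard' : #A = ∑ i, #(Sl i false ∪ Sl i true) := by
        rw [hcard]
        exact sum_congr rfl fun i _ => (card_union_of_disjoint (hdisj i)).symm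
      have h4 : 3 ^ (k + 1) = ∑ _i : Fin 3, 3 ^ k := by simp; ring
      refine ⟨?_, fun heq => ?_⟩
      · rw [hcard', h4]
        exact sum_le_sum fun i _ => hCc i
      have heach : ∀ i, #(Sl i false ∪ Sl i true) = 3 ^ k := by
        rw [hcard', h4] at heq
        intro i
        exact (sum_eq_sum_iff_of_le fun i _ => hCc i).1 heq i (mem_univ i)
      choose σ hσ using fun i => (ih _ (hC i)).2 (heach i)
      have hσeq : ∀ i i', i ≠ i' → σ i = σ i' := by
        intro i i' hi
        refine maxUnlinked_eq_of_parity (f := fun x => if x ∈ Sl i true then 1 else 0)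
          (g := fun y => if y ∈ Sl i' true then 1 else 0) fun x hx y hy => ?_
        rw [← hσ] at hx hy
        rw [mem_union] at hx hy
        have ex : ∀ i x, x ∈ Sl i false → x ∉ Sl i true := fun i x h1 h2 =>
          disjoint_left.1 (hdisj i) h1 h2
        rcases hx with hx | hx <;> rcases hy with hy | hy
        · simpa [ex _ _ hx, ex _ _ hy] using (hdiff i i' _ _ hi x hx y hy).1 rfl
        · have := (hdiff i i' _ _ hi x hx y hy).2 (by simp)
          simp only [ex _ _ hx, hy, if_true, if_false]
          grind
        · have := (hdiff i i' _ _ hi x hx y hy).2 (by simp)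
          simp only [ex _ _ hy, hx, if_true, if_false]
          grind
        · have := (hdiff i i' _ _ hi x hx y hy).1 rfl
          simp only [hy, hx, if_true]
          grind
      have hσ0 : ∀ i, σ i = σ 0 := fun i => by
        by_cases h : i = 0
        · rw [h]
        · exact hσeq i 0 h
      have hmemσ : ∀ i s w, w ∈ Sl i s → w ∈ maxUnlinked (σ 0) := by
        intro i s w hw
        rw [← hσ0 i, ← hσ i, mem_union]
        cases s
        · exact Or.inl hw
        · exact Or.inr hw
      have hside : ∀ i i' s s', i ≠ i' → ∀ w ∈ Sl i s, ∀ w' ∈ Sl i' s', s = s' := by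
        intro i i' s s' hi w hw w' hw'
        by_contra hs
        have := (hdiff i i' s s' hi w hw w' hw').2 hs
        rw [linkNum_eq_zero (hmemσ _ _ _ hw) (hmemσ _ _ _ hw')] at this
        exact absurd this (by decide)
      have hne : ∀ i, ∃ s w, w ∈ Sl i s := by
        intro i
        have : (Sl i false ∪ Sl i true).Nonempty := by
          rw [← card_pos, heach]; positivity
        obtain ⟨w, hw⟩ := this
        rcases mem_union.1 hw with h | h
        · exact ⟨_, _, h⟩
        · exact ⟨_, _, h⟩
      obtain ⟨t0, w0, hw0⟩ := hne 0
      obtain ⟨t1, w1, hw1⟩ := hne 1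
      have ht : t1 = t0 := hside 1 0 _ _ (by decide) _ hw1 _ hw0
      refine ⟨Fin.cons t0 (σ 0), eq_of_subset_of_card_le (fun u hu => ?_) ?_⟩
      · have hu' : Fin.tail u ∈ Sl (u 0).1 (u 0).2 := (mSl _ _ _).2 (by
          rw [show ((u 0).1, (u 0).2) = u 0 from rfl, hcons]; exact hu)
        rw [mem_maxUnlinked]
        refine Fin.cases ?_ fun j => ?_
        · rw [Fin.cons_zero]
          by_cases h0 : (u 0).1 = 0
          · rw [← ht]
            exact hside _ 1 _ _ (by rw [h0]; decide) _ hu' _ hw1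
          · exact hside _ 0 _ _ h0 _ hu' _ hw0
        · rw [Fin.cons_succ]
          exact mem_maxUnlinked.1 (hmemσ _ _ _ hu') j
      · rw [card_maxUnlinked, heq]

/-- Families of natural numbers indexed by `V` with product `n` (for `n ≠ 0`). -/
def tup (V : Type) [Fintype V] (n : ℕ) : Finset (V → ℕ) :=
  (Fintype.piFinset fun _ => n.divisors).filter fun D => ∏ u, D u = n

/-- The family of integers attached to a labelling of the primes dividing `n`. -/
def tupOf {V : Type} {n : ℕ} (l : n.primeFactors → V) (u : V) : ℕ := ∏ p, if l p = u then (p : ℕ) else 1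

lemma prime_coe {n : ℕ} (p : n.primeFactors) : (p : ℕ).Prime := Nat.prime_of_mem_primeFactors p.2

lemma dvd_tupOf_iff {V : Type} {n : ℕ} {l : n.primeFactors → V} {u : V} (p : n.primeFactors) :
    (p : ℕ) ∣ tupOf l u ↔ l p = u := by
  rw [tupOf, Prime.dvd_finsetProd_iff (prime_coe p).prime]
  constructor
  · rintro ⟨q, _, hq⟩
    split_ifs at hq with h
    · have := (Nat.prime_dvd_prime_iff_eq (prime_coe p) (prime_coe q)).1 hq
      rw [Subtype.ext this]; exact h
    · exact absurd (Nat.dvd_one.1 hq) (prime_coe p).one_lt.ne'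
  · intro h
    exact ⟨p, mem_univ p, by rw [if_pos h]⟩

section tuples
variable {V : Type} [Fintype V]

lemma mem_tup {n : ℕ} (hn : n ≠ 0) {D : V → ℕ} : D ∈ tup V n ↔ ∏ u, D u = n := by
  rw [tup, mem_filter, Fintype.mem_piFinset]
  refine ⟨fun h => h.2, fun h => ⟨fun u => ?_, h⟩⟩
  rw [Nat.mem_divisors, ← h]
  exact ⟨dvd_prod_of_mem D (mem_univ u), by rw [h]; exact hn⟩

lemma mul_dvd_prod_of_ne {D : V → ℕ} {u w : V} (h : u ≠ w) : D u * D w ∣ ∏ v, D v := by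
  rw [← mul_prod_erase univ D (mem_univ u)]
  exact Nat.mul_dvd_mul_left _ (dvd_prod_of_mem D (mem_erase.2 ⟨h.symm, mem_univ w⟩))

lemma coprime_of_squarefree_prod {D : V → ℕ} (hD : Squarefree (∏ v, D v)) {u w : V} (h : u ≠ w) :
    Nat.Coprime (D u) (D w) :=
  Nat.coprime_of_squarefree_mul (hD.squarefree_of_dvd (mul_dvd_prod_of_ne h))

lemma squarefree_of_squarefree_prod {D : V → ℕ} (hD : Squarefree (∏ v, D v)) (u : V) :
    Squarefree (D u) :=
  hD.squarefree_of_dvd (dvd_prod_of_mem D (mem_univ u))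

lemma prod_tupOf {n : ℕ} (hn : Squarefree n) (l : n.primeFactors → V) : ∏ u, tupOf l u = n := by
  simp only [tupOf]
  rw [Finset.prod_comm]
  simp only [prod_ite_eq, mem_univ, if_true]
  rw [prod_coe_sort n.primeFactors fun p => p, Nat.prod_primeFactors_of_squarefree hn]

lemma sum_tupOf {n : ℕ} (hn : Squarefree n) (F : (V → ℕ) → ℝ) :
    ∑ l : n.primeFactors → V, F (tupOf l) = ∑ D ∈ tup V n, F D := by
  have hn0 := hn.ne_zero
  refine sum_bij (fun l _ => tupOf l) (fun l _ => (mem_tup hn0).2 (prod_tupOf hn l)) ?_ ?_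
    fun _ _ => rfl
  · intro l _ l' _ h
    funext p
    have := (dvd_tupOf_iff (l := l) (u := l p) p).2 rfl
    rw [h, dvd_tupOf_iff] at this
    exact this.symm
  · intro D hD
    rw [mem_tup hn0] at hD
    have hex : ∀ p : n.primeFactors, ∃ u, (p : ℕ) ∣ D u := by
      intro p
      have := (Nat.dvd_of_mem_primeFactors p.2).trans (dvd_of_eq hD.symm)
      rw [Prime.dvd_finsetProd_iff (prime_coe p).prime] at this
      obtain ⟨u, _, hu⟩ := this
      exact ⟨u, hu⟩
    choose l hl using hex
    refine ⟨l, mem_univ _, ?_⟩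
    have hsq : Squarefree (∏ v, D v) := by rw [hD]; exact hn
    funext u
    have hu := squarefree_of_squarefree_prod hsq u
    have ht : Squarefree (tupOf l u) :=
      squarefree_of_squarefree_prod (D := tupOf l) (by rw [prod_tupOf hn]; exact hn) u
    rw [← Nat.prod_primeFactors_of_squarefree hu, ← Nat.prod_primeFactors_of_squarefree ht]
    refine prod_congr ?_ fun _ _ => rfl
    ext p
    rw [Nat.mem_primeFactors_of_ne_zero hu.ne_zero, Nat.mem_primeFactors_of_ne_zero ht.ne_zero]
    refine and_congr_right fun hp => ?_
    by_cases hpn : p ∣ n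
    · have hm : p ∈ n.primeFactors := (Nat.mem_primeFactors_of_ne_zero hn0).2 ⟨hp, hpn⟩
      have := dvd_tupOf_iff (l := l) (u := u) ⟨p, hm⟩
      simp only at this
      rw [this]
      refine ⟨fun h => h ▸ hl ⟨p, hm⟩, fun h => ?_⟩
      by_contra hne
      have hc := coprime_of_squarefree_prod hsq hne
      exact hp.one_lt.ne' (Nat.dvd_one.1 (hc ▸ Nat.dvd_gcd (hl ⟨p, hm⟩) h))
    · refine ⟨fun h => absurd (h.trans ?_) hpn, fun h => absurd (h.trans ?_) hpn⟩
      · conv_rhs => rw [← prod_tupOf hn l]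
        exact dvd_prod_of_mem _ (mem_univ u)
      · rw [← hD]; exact dvd_prod_of_mem _ (mem_univ u)

lemma primeFactors_tupOf {n : ℕ} (hn : Squarefree n) (l : n.primeFactors → V) (u : V) :
    (tupOf l u).primeFactors = (univ.filter fun p => l p = u).map (Function.Embedding.subtype _) := by
  have ht : Squarefree (tupOf l u) :=
    squarefree_of_squarefree_prod (D := tupOf l) (by rw [prod_tupOf hn]; exact hn) u
  ext p
  rw [Nat.mem_primeFactors_of_ne_zero ht.ne_zero, Finset.mem_map]
  constructor
  · rintro ⟨hp, hd⟩
    have : p ∣ n := hd.trans (by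
      conv_rhs => rw [← prod_tupOf hn l]
      exact dvd_prod_of_mem _ (mem_univ u))
    have hm : p ∈ n.primeFactors := (Nat.mem_primeFactors_of_ne_zero hn.ne_zero).2 ⟨hp, this⟩
    exact ⟨⟨p, hm⟩, mem_filter.2 ⟨mem_univ _, (dvd_tupOf_iff ⟨p, hm⟩).1 hd⟩, rfl⟩
  · rintro ⟨q, hq, rfl⟩
    exact ⟨prime_coe q, (dvd_tupOf_iff q).2 (mem_filter.1 hq).2⟩

lemma prod_primeFactors_tupOf {n : ℕ} (hn : Squarefree n) (l : n.primeFactors → V)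
    (f : V → ℕ → ℝ) : ∏ u, ∏ p ∈ (tupOf l u).primeFactors, f u p = ∏ p, f (l p) p := by
  have : ∀ u, ∏ p ∈ (tupOf l u).primeFactors, f u p = ∏ p, if l p = u then f u p else 1 := by
    intro u
    rw [primeFactors_tupOf hn, prod_map, prod_filter]
    rfl
  simp only [this]
  rw [Finset.prod_comm]
  simp

lemma prod_sum_eq_sum_prod {P : Type} [Fintype P] [DecidableEq P] (f : V → P → ℝ) :
    ∏ p, ∑ u, f u p = ∑ l : P → V, ∏ p, f (l p) p := by
  rw [prod_univ_sum, Fintype.piFinset_univ]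

/-- A sum over families with product `n` of a product of local factors is an Euler product. -/
lemma sum_tup_prod {n : ℕ} (hn : Squarefree n) (f : V → ℕ → ℝ) :
    ∑ D ∈ tup V n, ∏ u, primeProd (f u) (D u) = primeProd (fun p => ∑ u, f u p) n := by
  rw [← sum_tupOf hn, primeProd, ← prod_coe_sort n.primeFactors, prod_sum_eq_sum_prod]
  exact sum_congr rfl fun l _ => prod_primeFactors_tupOf hn l f

lemma jac_prod_left {ι : Type*} (s : Finset ι) (f : ι → ℕ) (r : ℕ) :
    jac (∏ i ∈ s, f i) r = ∏ i ∈ s, jac (f i) r := by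
  induction s using Finset.induction_on with
  | empty => simp [jac_one_left]
  | insert a s ha ih => rw [prod_insert ha, prod_insert ha, jac_mul_left, ih]

lemma jac_prod_right {ι : Type*} (s : Finset ι) (f : ι → ℕ) (hf : ∀ i ∈ s, f i ≠ 0) (m : ℕ) :
    jac m (∏ i ∈ s, f i) = ∏ i ∈ s, jac m (f i) := by
  induction s using Finset.induction_on with
  | empty => simp [jac_one_right]
  | insert a s ha ih =>
    rw [prod_insert ha, prod_insert ha, jac_mul_right, ih fun i hi => hf i (mem_insert_of_mem hi)]
    · exact hf a (mem_insert_self a s)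
    · exact prod_ne_zero_iff.2 fun i hi => hf i (mem_insert_of_mem hi)

end tuples

/-- The bimultiplicative form attached to the exponents `phi`. -/
def jacForm {k : ℕ} (D E : Lab k → ℕ) : ℝ := ∏ u, ∏ w, jac (D u) (E w) ^ phi u w

lemma prod_ite_eq_jac {P : Type} [Fintype P] {V : Type} [Fintype V] (x : P → ℕ) (l : P → V) (r : ℕ)
    (u : V) : jac (∏ p, if l p = u then x p else 1) r = ∏ p, if l p = u then jac (x p) r else 1 := by
  rw [jac_prod_left]
  refine prod_congr rfl fun p _ => ?_
  split_ifs
  · rfl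
  · exact jac_one_left r

lemma jacForm_tupOf {k n : ℕ} (l : n.primeFactors → Lab k) :
    jacForm (tupOf l) (tupOf l) =
      ∏ p : n.primeFactors, ∏ q : n.primeFactors, jac (p : ℕ) (q : ℕ) ^ phi (l p) (l q) := by
  have h1 : ∀ u w : Lab k, jac (tupOf l u) (tupOf l w) =
      ∏ p : n.primeFactors, ∏ q : n.primeFactors, if l p = u ∧ l q = w then jac (p : ℕ) (q : ℕ) else 1 := by
    intro u w
    rw [tupOf, prod_ite_eq_jac]
    refine prod_congr rfl fun p _ => ?_
    split_ifs with hp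
    · rw [tupOf, jac_prod_right _ _ fun q _ => by split_ifs; exacts [(prime_coe q).ne_zero, one_ne_zero]]
      refine prod_congr rfl fun q _ => ?_
      split_ifs with h1 h2 h2
      · rfl
      · exact absurd ⟨hp, h1⟩ h2
      · exact absurd h2.2 h1
      · exact jac_one_right _
    · rw [prod_congr rfl fun q _ => if_neg fun h => hp h.1, prod_const_one]
  simp only [jacForm, h1, ← prod_pow]
  have h2 : ∀ u w : Lab k, ∀ p q : n.primeFactors,
      (if l p = u ∧ l q = w then jac (p : ℕ) (q : ℕ) else 1) ^ phi u w =
        if l p = u then (if l q = w then jac (p : ℕ) (q : ℕ) ^ phi u w else 1) else 1 := by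
    intro u w p q
    by_cases a : l p = u <;> by_cases b : l q = w <;> simp [a, b]
  simp only [h2]
  calc _ = ∏ p, ∏ q, ∏ u, ∏ w, (if l p = u then (if l q = w then jac (p : ℕ) (q : ℕ) ^ phi u w else 1)
        else 1) := by
        rw [prod_congr rfl fun u _ => Finset.prod_comm, Finset.prod_comm]
        refine prod_congr rfl fun p _ => ?_
        rw [prod_congr rfl fun u _ => Finset.prod_comm, Finset.prod_comm]
    _ = _ := by
        refine prod_congr rfl fun p _ => prod_congr rfl fun q _ => ?_
        rw [prod_eq_single (l p), prod_eq_single (l q)]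
        · simp
        · intro w _ hw; simp [hw.symm]
        · simp
        · intro u _ hu; simp [hu.symm]
        · simp

/-- The sign twist of `m` that is `1` modulo `4`, for `m` odd. -/
def starInt (m : ℕ) : ℤ := if m % 4 = 1 then m else -m

lemma natAbs_starInt (m : ℕ) : (starInt m).natAbs = m := by
  unfold starInt; split_ifs <;> simp

lemma starInt_emod {m : ℕ} (hm : Odd m) : starInt m % 4 = 1 := by
  rw [Nat.odd_iff] at hm
  unfold starInt; split_ifs <;> omega

lemma starInt_natAbs {e : ℤ} (he : e % 4 = 1) : starInt e.natAbs = e := by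
  unfold starInt; split_ifs <;> omega

lemma jacobiSym_natAbs {e : ℤ} (he : e % 4 = 1) {p : ℕ} (hp : Odd p) :
    (jacobiSym e p : ℝ) = jac p e.natAbs := by
  rw [← starInt_natAbs he]
  generalize hm : e.natAbs = m
  have hm2 : m % 4 = 1 ∨ m % 4 = 3 := by omega
  rw [natAbs_starInt, jac, starInt]
  rcases hm2 with h | h
  · rw [if_pos h, jacobiSym.quadratic_reciprocity_one_mod_four h hp]
  · have hmo : Odd m := Nat.odd_iff.2 (by omega)
    rw [if_neg (by omega), jacobiSym.neg _ hp]
    have hp2 : p % 4 = 1 ∨ p % 4 = 3 := by rw [Nat.odd_iff] at hp; omega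
    rcases hp2 with h' | h'
    · rw [ZMod.χ₄_nat_one_mod_four h', jacobiSym.quadratic_reciprocity_one_mod_four' hmo h', one_mul]
    · rw [ZMod.χ₄_nat_three_mod_four h', jacobiSym.quadratic_reciprocity_three_mod_four h h']
      simp

lemma kron_mul_eq {e f : ℤ} (he : e % 4 = 1) (hf : f % 4 = 1) {p : ℕ} (hp : Odd p) :
    (kron (e * f) p : ℝ) = jac p e.natAbs * jac p f.natAbs := by
  have h2 : p ≠ 2 := by rintro rfl; exact absurd hp (by decide)
  rw [kron, if_neg h2, jacobiSym.mul_left, Int.cast_mul, jacobiSym_natAbs he hp,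
    jacobiSym_natAbs hf hp]

lemma isFundDisc_iff_of_odd {e : ℤ} (he : e % 2 = 1) : IsFundDisc e ↔ e % 4 = 1 ∧ Squarefree e := by
  constructor
  · rintro (h | ⟨m, hm, -⟩)
    · exact h
    · omega
  · exact Or.inl

/-- The product over the primes dividing the entries of a triple. -/
def tripleProd (D : Fin 3 → ℕ) : ℝ :=
  ∏ i, ∏ p ∈ (D i).primeFactors, (1 + ∏ i', if i' ≠ i then jac p (D i') else 1)

lemma sum_tripleTerm {n : ℕ} (hn : Squarefree n) (h4 : n % 4 = 1) :
    ∑ t ∈ fdTriples n, (tripleTerm t : ℝ) =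
      ∑ D ∈ (tup (Fin 3) n).filter fun D => ∀ i, D i ≠ 1, tripleProd D := by
  have hn0 := hn.ne_zero
  have hodd : ∀ e : ℤ, e ∣ n → e % 2 = 1 := by
    rintro e ⟨c, hc⟩
    by_contra h
    have h0 : e % 2 = 0 := by omega
    have : (e * c) % 2 = 0 := by rw [Int.mul_emod, h0]; simp
    omega
  have hoddn : ∀ e : ℕ, e ∣ n → Odd e := fun e he => by
    have := hodd e (Int.natCast_dvd_natCast.2 he)
    rw [Nat.odd_iff]; omega
  have key : ∀ t ∈ fdTriples n, t.1 % 4 = 1 ∧ t.2.1 % 4 = 1 ∧ t.2.2 % 4 = 1 ∧ t.1 ≠ 1 ∧ t.2.1 ≠ 1 ∧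
      t.2.2 ≠ 1 ∧ t.1 * t.2.1 * t.2.2 = n := by
    rintro ⟨x, y, z⟩ ht
    simp only [fdTriples, mem_filter] at ht
    obtain ⟨-, h1, h2, h3, n1, n2, n3, -, -, -, hp⟩ := ht
    simp only at *
    rw [isFundDisc_iff_of_odd (hodd x ⟨y * z, by rw [← hp]; ring⟩)] at h1
    rw [isFundDisc_iff_of_odd (hodd y ⟨x * z, by rw [← hp]; ring⟩)] at h2
    rw [isFundDisc_iff_of_odd (hodd z ⟨x * y, by rw [← hp]; ring⟩)] at h3
    exact ⟨h1.1, h2.1, h3.1, n1, n2, n3, hp⟩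
  refine sum_nbij' (fun t => ![t.1.natAbs, t.2.1.natAbs, t.2.2.natAbs])
    (fun D => (starInt (D 0), starInt (D 1), starInt (D 2))) ?_ ?_ ?_ ?_ ?_
  · intro t ht
    obtain ⟨h1, h2, h3, n1, n2, n3, hp⟩ := key t ht
    rw [mem_filter, mem_tup hn0, Fin.prod_univ_three, Fin.forall_fin_succ, Fin.forall_fin_succ,
      Fin.forall_fin_succ]
    refine ⟨?_, ?_, ?_, ?_, ?_⟩
    · simp only [Matrix.cons_val]
      rw [← Int.natAbs_mul, ← Int.natAbs_mul, hp, Int.natAbs_natCast]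
    · simp; omega
    · simp; omega
    · simp; omega
    · intro i; exact i.elim0
  · intro D hD
    rw [mem_filter, mem_tup hn0] at hD
    obtain ⟨hD, h1⟩ := hD
    have hdv : ∀ i, D i ∣ n := fun i => hD ▸ dvd_prod_of_mem D (mem_univ i)
    have ho : ∀ i, Odd (D i) := fun i => hoddn _ (hdv i)
    have hsq : ∀ i, Squarefree (starInt (D i)) := fun i => by
      rw [← Int.squarefree_natAbs, natAbs_starInt]; exact hn.squarefree_of_dvd (hdv i)
    have hco : ∀ i i', i ≠ i' → IsCoprime (starInt (D i)) (starInt (D i')) := fun i i' h => by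
      rw [Int.isCoprime_iff_gcd_eq_one, Int.gcd, natAbs_starInt, natAbs_starInt]
      exact coprime_of_squarefree_prod (D := D) (by rw [hD]; exact hn) h
    have hne : ∀ i, starInt (D i) ≠ 1 := fun i h => h1 i (by rw [← natAbs_starInt (D i), h]; rfl)
    have hf : ∀ i, IsFundDisc (starInt (D i)) := fun i => Or.inl ⟨starInt_emod (ho i), hsq i⟩
    have hmem : ∀ i, starInt (D i) ∈ Finset.Icc (-((n : ℤ).natAbs : ℤ)) ((n : ℤ).natAbs : ℤ) := by
      intro i
      rw [Finset.mem_Icc, ← abs_le, Int.abs_eq_natAbs, natAbs_starInt, Int.natAbs_natCast]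
      exact_mod_cast Nat.le_of_dvd (Nat.pos_of_ne_zero hn0) (hdv i)
    have hprod : starInt (D 0) * starInt (D 1) * starInt (D 2) = n := by
      have ha : (starInt (D 0) * starInt (D 1) * starInt (D 2)).natAbs = n := by
        rw [Int.natAbs_mul, Int.natAbs_mul, natAbs_starInt, natAbs_starInt, natAbs_starInt, ← hD,
          Fin.prod_univ_three]
      have hm : (starInt (D 0) * starInt (D 1) * starInt (D 2)) % 4 = 1 := by
        rw [Int.mul_emod, Int.mul_emod (starInt (D 0)), starInt_emod (ho 0), starInt_emod (ho 1),
          starInt_emod (ho 2)]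
        rfl
      omega
    rw [fdTriples, mem_filter]
    exact ⟨mem_product.2 ⟨hmem 0, mem_product.2 ⟨hmem 1, hmem 2⟩⟩, hf 0, hf 1, hf 2, hne 0, hne 1,
      hne 2, hco 0 1 (by decide), hco 0 2 (by decide), hco 1 2 (by decide), hprod⟩
  · intro t ht
    obtain ⟨h1, h2, h3, -⟩ := key t ht
    simp [starInt_natAbs h1, starInt_natAbs h2, starInt_natAbs h3]
  · intro D _
    funext i
    fin_cases i <;> simp [natAbs_starInt]
  · intro t ht
    obtain ⟨h1, h2, h3, -, -, -, hp⟩ := key t ht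
    have hpo : ∀ e : ℤ, e ∣ n → ∀ p ∈ e.natAbs.primeFactors, Odd p := fun e he p hpe =>
      hoddn p ((Nat.dvd_of_mem_primeFactors hpe).trans (Int.natCast_dvd_natCast.1
        (by rw [Int.natCast_natAbs]; exact (abs_dvd _ _).2 he)))
    rw [tripleTerm, tripleProd, Fin.prod_univ_three]
    push_cast
    have e1 : ∀ p ∈ t.1.natAbs.primeFactors, (1 + (kron (t.2.1 * t.2.2) p : ℝ)) =
        1 + jac p t.2.1.natAbs * jac p t.2.2.natAbs := fun p hpm => by
      rw [kron_mul_eq h2 h3 (hpo _ ⟨t.2.1 * t.2.2, by rw [← hp]; ring⟩ p hpm)]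
    have e2 : ∀ p ∈ t.2.1.natAbs.primeFactors, (1 + (kron (t.1 * t.2.2) p : ℝ)) =
        1 + jac p t.1.natAbs * jac p t.2.2.natAbs := fun p hpm => by
      rw [kron_mul_eq h1 h3 (hpo _ ⟨t.1 * t.2.2, by rw [← hp]; ring⟩ p hpm)]
    have e3 : ∀ p ∈ t.2.2.natAbs.primeFactors, (1 + (kron (t.1 * t.2.1) p : ℝ)) =
        1 + jac p t.1.natAbs * jac p t.2.1.natAbs := fun p hpm => by
      rw [kron_mul_eq h1 h2 (hpo _ ⟨t.1 * t.2.1, by rw [← hp]; ring⟩ p hpm)]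
    rw [prod_congr rfl e1, prod_congr rfl e2, prod_congr rfl e3]
    simp [Fin.prod_univ_three]
    ring

/-- The expansion of the triple product over labellings of the primes. -/
def labelProd {P : Type} [Fintype P] (x : P → ℕ) (l : P → Fin 3) (s : P → Bool) : ℝ :=
  if ∀ i, ∃ p, l p = i then
    ∏ p, ∏ q, (if s p = true ∧ l q ≠ l p then jac (x p) (x q) else 1) else 0

lemma tupOf_ne_one_iff {V : Type} {n : ℕ} (l : n.primeFactors → V) (u : V) :
    tupOf l u ≠ 1 ↔ ∃ p, l p = u := by
  constructor
  · intro h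
    by_contra hne
    push Not at hne
    exact h (prod_eq_one fun p _ => if_neg (hne p))
  · rintro ⟨p, hp⟩ h
    have := (dvd_tupOf_iff p).2 hp
    rw [h] at this
    exact (prime_coe p).one_lt.ne' (Nat.dvd_one.1 this)

lemma sum_tripleProd {n : ℕ} (hn : Squarefree n) :
    ∑ D ∈ (tup (Fin 3) n).filter fun D => ∀ i, D i ≠ 1, tripleProd D =
      ∑ l : n.primeFactors → Fin 3, ∑ s : n.primeFactors → Bool,
        labelProd (fun p : n.primeFactors => (p : ℕ)) l s := by
  rw [sum_filter, ← sum_tupOf hn fun D => if ∀ i, D i ≠ 1 then tripleProd D else 0]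
  refine sum_congr rfl fun l _ => ?_
  simp only [tupOf_ne_one_iff, labelProd]
  split_ifs with h
  · rw [tripleProd, prod_primeFactors_tupOf hn l
      fun i p => 1 + ∏ i', if i' ≠ i then jac p (tupOf l i') else 1]
    have h1 : ∀ p : n.primeFactors, (∏ i', if i' ≠ l p then jac p (tupOf l i') else 1) =
        ∏ q : n.primeFactors, if l q ≠ l p then jac p q else 1 := by
      intro p
      have h2 : ∀ i', (if i' ≠ l p then jac p (tupOf l i') else 1) =
          ∏ q : n.primeFactors, if l q = i' then (if i' ≠ l p then jac p q else 1) else 1 := by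
        intro i'
        rw [tupOf, jac_prod_right _ _ fun q _ => by
          split_ifs; exacts [(prime_coe q).ne_zero, one_ne_zero]]
        split_ifs
        · refine prod_congr rfl fun q _ => ?_
          split_ifs
          · rfl
          · exact jac_one_right _
        · simp
      simp only [h2]
      rw [Finset.prod_comm]
      simp
    simp only [h1]
    have h3 : ∀ p : n.primeFactors, (1 + ∏ q : n.primeFactors, if l q ≠ l p then jac p q else 1) =
        ∑ s : Bool, ∏ q : n.primeFactors, if s = true ∧ l q ≠ l p then jac p q else 1 := by
      intro p
      rw [Fintype.sum_bool]
      simp [add_comm]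
    simp only [h3]
    exact prod_sum_eq_sum_prod (V := Bool) (P := n.primeFactors) fun s p =>
      ∏ q : n.primeFactors, if s = true ∧ l q ≠ l p then jac p q else 1
  · simp

/-- No factorization attached to the labels `D` has a trivial factor. -/
def goodLab {k : ℕ} (D : Lab k → ℕ) : Prop := ∀ j i, ∃ u : Lab k, (u j).1 = i ∧ D u ≠ 1

lemma pow_sum_labelProd {k : ℕ} {P : Type} [Fintype P] [DecidableEq P] (x : P → ℕ) :
    (∑ l : P → Fin 3, ∑ s : P → Bool, labelProd x l s) ^ k =
      ∑ l : P → Lab k, if ∀ j i, ∃ p, (l p j).1 = i then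
        ∏ p, ∏ q, jac (x p) (x q) ^ phi (l p) (l q) else 0 := by
  rw [← Fintype.sum_prod_type', Fintype.sum_pow]
  let e : (Fin k → (P → Fin 3) × (P → Bool)) ≃ (P → Lab k) :=
    { toFun := fun f p j => ((f j).1 p, (f j).2 p)
      invFun := fun g j => (fun p => (g p j).1, fun p => (g p j).2)
      left_inv := fun f => rfl
      right_inv := fun g => rfl }
  refine Fintype.sum_equiv e _ _ fun f => ?_
  simp only [labelProd, e, Equiv.coe_fn_mk]
  split_ifs with h
  · rw [prod_congr rfl fun j _ => if_pos (h j), Finset.prod_comm]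
    refine prod_congr rfl fun p _ => ?_
    rw [Finset.prod_comm]
    refine prod_congr rfl fun q _ => ?_
    rw [phi, ← prod_pow_eq_pow_sum]
    refine prod_congr rfl fun j _ => ?_
    dsimp only
    split_ifs <;> simp
  · push Not at h
    obtain ⟨j, i, hj⟩ := h
    refine prod_eq_zero (mem_univ j) (if_neg fun h => ?_)
    obtain ⟨p, hp⟩ := h i
    exact hj p hp

/-- Expansion of the powers of `f̃` into a sum over labelled factorizations. -/
lemma pow_ftilde_eq (k : ℕ) {n : ℕ} (hn : Squarefree n) (h4 : n % 4 = 1) :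
    (96 * ftilde n) ^ k = ∑ D ∈ tup (Lab k) n, if goodLab D then jacForm D D else 0 := by
  have h0 : (0 : ℤ) < n := by have := hn.ne_zero; omega
  have h1 : 96 * ftilde n = ∑ t ∈ fdTriples n, (tripleTerm t : ℝ) := by
    rw [ftilde, alphaFD, if_pos h0]; norm_num; ring
  rw [h1, sum_tripleTerm hn h4, sum_tripleProd hn, pow_sum_labelProd,
    ← sum_tupOf hn fun D => if goodLab D then jacForm D D else 0]
  refine sum_congr rfl fun l _ => ?_
  have h2 : goodLab (tupOf l) ↔ ∀ j i, ∃ p, (l p j).1 = i := by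
    simp only [goodLab, tupOf_ne_one_iff]
    refine forall_congr' fun j => forall_congr' fun i => ?_
    constructor
    · rintro ⟨u, hu, p, rfl⟩; exact ⟨p, hu⟩
    · rintro ⟨p, hp⟩; exact ⟨l p, hp, p, rfl⟩
  simp only [h2, jacForm_tupOf]

/-- Squarefree integers `n < X` congruent to `1` modulo `4`. -/
def admSet (X : ℝ) : Finset ℕ := (sqfreeBelow X).filter fun n => n % 4 = 1

lemma mem_admSet {X : ℝ} {n : ℕ} : n ∈ admSet X ↔ (n : ℝ) < X ∧ Squarefree n ∧ n % 4 = 1 := by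
  rw [admSet, mem_filter, mem_sqfreeBelow, and_assoc]

lemma card_primeFactors_prod_le {V : Type} (D : V → ℕ) (s : Finset V) :
    #(∏ v ∈ s, D v).primeFactors ≤ ∑ v ∈ s, #(D v).primeFactors := by
  induction s using Finset.induction_on with
  | empty => simp
  | insert a s ha ih =>
    rw [prod_insert ha, sum_insert ha]
    exact card_primeFactors_mul_le.trans (by omega)

lemma restrict_mul_restrict {V : Type} (Λ : Finset V) (D : V → ℕ) :
    ((fun v => if v ∈ Λ then 1 else D v) * fun v => if v ∈ Λ then D v else 1) = D := by
  funext v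
  rw [Pi.mul_apply]
  split_ifs <;> simp

section admissible
variable {V : Type} [Fintype V]

lemma le_of_prod_eq {D : V → ℕ} {n : ℕ} (hn : n ≠ 0) (h : ∏ u, D u = n) (u : V) : D u ≤ n :=
  Nat.le_of_dvd (Nat.pos_of_ne_zero hn) (h ▸ dvd_prod_of_mem D (mem_univ u))

/-- Families whose product lies in `admSet X`. -/
def admTup (V : Type) [Fintype V] (X : ℝ) : Finset (V → ℕ) :=
  (Fintype.piFinset fun _ => sqfreeBelow X).filter fun D => ∏ u, D u ∈ admSet X

lemma mem_admTup {X : ℝ} {D : V → ℕ} : D ∈ admTup V X ↔ ∏ u, D u ∈ admSet X := by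
  rw [admTup, mem_filter, and_iff_right_iff_imp, mem_admSet, Fintype.mem_piFinset]
  rintro ⟨h1, h2, -⟩ u
  refine mem_sqfreeBelow.2 ⟨lt_of_le_of_lt ?_ h1, squarefree_of_squarefree_prod h2 u⟩
  exact_mod_cast le_of_prod_eq h2.ne_zero rfl u

lemma mem_sqfreeBelow_of_mem_admTup {X : ℝ} {D : V → ℕ} (h : D ∈ admTup V X) (u : V) :
    D u ∈ sqfreeBelow X :=
  Fintype.mem_piFinset.1 (mem_filter.1 h).1 u

lemma sum_admTup (X : ℝ) (w : ℕ → ℝ) (F : (V → ℕ) → ℝ) :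
    ∑ n ∈ admSet X, w n * ∑ D ∈ tup V n, F D = ∑ D ∈ admTup V X, w (∏ u, D u) * F D := by
  rw [← sum_fiberwise_of_maps_to (s := admTup V X) (t := admSet X) (g := fun D => ∏ u, D u)
    fun D hD => mem_admTup.1 hD]
  refine sum_congr rfl fun n hn => ?_
  have hn0 := (mem_admSet.1 hn).2.1.ne_zero
  rw [mul_sum]
  refine sum_congr ?_ ?_
  · ext D
    rw [mem_tup hn0, mem_filter, mem_admTup]
    exact ⟨fun h => ⟨h ▸ hn, h⟩, fun h => h.2⟩
  · intro D hD
    rw [(mem_filter.1 hD).2]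

/-- Families with product `n` supported on `Λ`. -/
def tupOn (Λ : Finset V) (n : ℕ) : Finset (V → ℕ) := (tup V n).filter fun D => ∀ v, v ∉ Λ → D v = 1

lemma mem_tupOn {Λ : Finset V} {n : ℕ} (hn : n ≠ 0) {D : V → ℕ} :
    D ∈ tupOn Λ n ↔ ∏ u, D u = n ∧ ∀ v, v ∉ Λ → D v = 1 := by
  rw [tupOn, mem_filter, mem_tup hn]

lemma tupOn_univ (n : ℕ) : tupOn univ n = tup V n :=
  filter_true_of_mem fun _ _ v hv => absurd (mem_univ v) hv

lemma primeProd_one (h : ℕ → ℝ) : primeProd h 1 = 1 := by simp [primeProd]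

lemma sum_tupOn_prod (Λ : Finset V) {n : ℕ} (hn : Squarefree n) (f : V → ℕ → ℝ) :
    ∑ D ∈ tupOn Λ n, ∏ u ∈ Λ, primeProd (f u) (D u) = primeProd (fun p => ∑ u ∈ Λ, f u p) n := by
  have h := sum_tup_prod (V := V) hn fun u p => if u ∈ Λ then f u p else 0
  simp only [sum_ite_mem, univ_inter] at h
  rw [← h, tupOn, sum_filter]
  refine sum_congr rfl fun D hD => ?_
  rw [mem_tup hn.ne_zero] at hD
  split_ifs with h1
  · rw [← prod_subset (subset_univ Λ)]
    · exact prod_congr rfl fun u hu => by simp [hu]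
    · intro v _ hv
      rw [h1 v hv, primeProd_one]
  · push Not at h1
    obtain ⟨v, hv, hv1⟩ := h1
    refine (prod_eq_zero (mem_univ v) ?_).symm
    obtain ⟨p, hp, hpv⟩ := Nat.exists_prime_and_dvd hv1
    have : D v ≠ 0 := fun h0 => hn.ne_zero (by rw [← hD]; exact prod_eq_zero (mem_univ v) h0)
    exact prod_eq_zero ((Nat.mem_primeFactors_of_ne_zero this).2 ⟨hp, hpv⟩) (if_neg hv)

lemma card_tupOn (Λ : Finset V) {n : ℕ} (hn : Squarefree n) :
    ((tupOn Λ n).card : ℝ) = (Λ.card : ℝ) ^ n.primeFactors.card := by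
  have := sum_tupOn_prod Λ hn fun _ _ => 1
  simpa [primeProd_const, primeProd] using this

/-- Families of squarefree integers below `z` that are `1` on `Λ`. -/
def smallTup (Λ : Finset V) (z : ℝ) : Finset (V → ℕ) :=
  Fintype.piFinset fun v => if v ∈ Λ then {1} else sqfreeBelow z

lemma mem_smallTup {Λ : Finset V} {z : ℝ} {y : V → ℕ} :
    y ∈ smallTup Λ z ↔ (∀ v ∈ Λ, y v = 1) ∧ ∀ v, v ∉ Λ → (y v : ℝ) < z ∧ Squarefree (y v) := by
  rw [smallTup, Fintype.mem_piFinset, ← forall_and]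
  refine forall_congr' fun v => ?_
  by_cases h : v ∈ Λ <;> simp [h, mem_sqfreeBelow]

lemma prod_ite_mul_ite (Λ : Finset V) (D : V → ℕ) :
    (∏ v, if v ∈ Λ then 1 else D v) * ∏ v, (if v ∈ Λ then D v else 1) = ∏ v, D v := by
  rw [← prod_mul_distrib]
  exact prod_congr rfl fun v _ => by split_ifs <;> simp

/-- Admissible families whose entries outside `Λ` are less than `z`. -/
def admSmall (Λ : Finset V) (X z : ℝ) : Finset (V → ℕ) :=
  (admTup V X).filter fun D => ∀ v, v ∉ Λ → (D v : ℝ) < z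

lemma mem_admSmall {Λ : Finset V} {X z : ℝ} {D : V → ℕ} :
    D ∈ admSmall Λ X z ↔ D ∈ admTup V X ∧ ∀ v, v ∉ Λ → (D v : ℝ) < z := by
  rw [admSmall, mem_filter]

lemma sum_admTup_split (Λ : Finset V) (X z : ℝ) (F : (V → ℕ) → ℝ) :
    ∑ D ∈ admSmall Λ X z, F D =
      ∑ y ∈ smallTup Λ z, ∑ n ∈ (sqfreeBelow X).filter (fun n => (∏ v, y v) * n ∈ admSet X),
        ∑ x ∈ tupOn Λ n, F (y * x) := by
  rw [admSmall]
  simp only [sum_sigma']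
  refine sum_nbij' (fun D => ⟨fun v => if v ∈ Λ then 1 else D v, ∏ v, if v ∈ Λ then D v else 1,
    fun v => if v ∈ Λ then D v else 1⟩) (fun t => t.1 * t.2.2) ?_ ?_ ?_ ?_ ?_
  · intro D hD
    rw [mem_filter, mem_admTup] at hD
    obtain ⟨hD, hz⟩ := hD
    have hD' := mem_admSet.1 hD
    have hn : Squarefree (∏ v, if v ∈ Λ then D v else 1) :=
      hD'.2.1.squarefree_of_dvd ⟨_, by rw [mul_comm, prod_ite_mul_ite]⟩
    simp only [mem_sigma, mem_filter]
    refine ⟨mem_smallTup.2 ⟨fun v hv => if_pos hv, fun v hv => ?_⟩, ⟨?_, ?_⟩, ?_⟩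
    · rw [if_neg hv]
      exact ⟨hz v hv, squarefree_of_squarefree_prod hD'.2.1 v⟩
    · refine mem_sqfreeBelow.2 ⟨lt_of_le_of_lt ?_ hD'.1, hn⟩
      exact_mod_cast Nat.le_of_dvd (Nat.pos_of_ne_zero hD'.2.1.ne_zero)
        ⟨_, by rw [mul_comm, prod_ite_mul_ite]⟩
    · rwa [prod_ite_mul_ite]
    · exact (mem_tupOn hn.ne_zero).2 ⟨rfl, fun v hv => if_neg hv⟩
  · rintro ⟨y, n, x⟩ ht
    simp only [mem_sigma, mem_filter] at ht
    obtain ⟨hy, ⟨hn, hyn⟩, hx⟩ := ht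
    rw [mem_tupOn (mem_sqfreeBelow.1 hn).2.ne_zero] at hx
    rw [mem_filter, mem_admTup]
    refine ⟨?_, fun v hv => ?_⟩
    · simp only [Pi.mul_apply, prod_mul_distrib, hx.1]
      exact hyn
    · simp only [Pi.mul_apply, hx.2 v hv, mul_one]
      exact ((mem_smallTup.1 hy).2 v hv).1
  · intro D _
    exact restrict_mul_restrict Λ D
  · rintro ⟨y, n, x⟩ ht
    simp only [mem_sigma, mem_filter] at ht
    obtain ⟨hy, ⟨hn, hyn⟩, hx⟩ := ht
    rw [mem_tupOn (mem_sqfreeBelow.1 hn).2.ne_zero] at hx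
    rw [mem_smallTup] at hy
    have e1 : (fun v => if v ∈ Λ then 1 else (y * x) v) = y := by
      funext v
      split_ifs with h
      · exact (hy.1 v h).symm
      · rw [Pi.mul_apply, hx.2 v h, mul_one]
    have e2 : (fun v => if v ∈ Λ then (y * x) v else 1) = x := by
      funext v
      split_ifs with h
      · rw [Pi.mul_apply, hy.1 v h, one_mul]
      · exact (hx.2 v h).symm
    have e3 : (∏ v, if v ∈ Λ then (y * x) v else 1) = n := by
      rw [← hx.1]; exact prod_congr rfl fun v _ => congrFun e2 v
    simp only [e1, e2, e3]
  · intro D _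
    rw [restrict_mul_restrict Λ D]

lemma pow_card_primeFactors_prod_le {b : ℝ} (hb : 0 ≤ b) (D : V → ℕ) :
    b ^ #(∏ v, D v).primeFactors ≤ ∏ v, max b 1 ^ #(D v).primeFactors := by
  rw [prod_pow_eq_pow_sum]
  refine (pow_le_pow_left₀ hb (le_max_left b 1) _).trans ?_
  exact pow_le_pow_right₀ (le_max_right b 1) (card_primeFactors_prod_le D univ)

/-- Weighted reciprocal sum over families of squarefree integers. -/
lemma sum_pow_div_prod_le [DecidableEq V] {b z : ℝ} (hb : 0 ≤ b) (hz : 1 < z) (t : V → Finset ℕ)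
    (ht : ∀ v, t v = {1} ∨ t v = sqfreeBelow z) :
    ∑ y ∈ Fintype.piFinset t, b ^ #(∏ v, y v).primeFactors / ((∏ v, y v : ℕ) : ℝ) ≤
      (Real.exp 1 * (1 + Real.log z) ^ max b 1) ^ Fintype.card V := by
  have hz0 := Real.log_pos hz
  calc _ ≤ ∑ y ∈ Fintype.piFinset t, ∏ v, (max b 1 ^ #(y v).primeFactors / (y v : ℝ)) := by
        refine sum_le_sum fun y _ => ?_
        rw [prod_div_distrib, Nat.cast_prod]
        exact div_le_div_of_nonneg_right (pow_card_primeFactors_prod_le hb y)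
          (prod_nonneg fun _ _ => Nat.cast_nonneg _)
    _ = ∏ v, ∑ m ∈ t v, max b 1 ^ #m.primeFactors / (m : ℝ) := by
        rw [prod_univ_sum]
    _ ≤ ∏ _v : V, (Real.exp 1 * (1 + Real.log z) ^ max b 1) := by
        refine prod_le_prod (fun v _ => sum_nonneg fun m _ => by positivity) fun v _ => ?_
        rcases ht v with h | h
        · rw [h, sum_singleton]
          simp only [Nat.primeFactors_one, card_empty, pow_zero, Nat.cast_one, div_one]
          have h1 : 1 ≤ Real.exp 1 := Real.one_le_exp zero_le_one
          have h2 : 1 ≤ (1 + Real.log z) ^ max b 1 := Real.one_le_rpow (by linarith) (by positivity)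
          nlinarith
        · rw [h]
          have := log_sum_primeProd_le_rpow (H := max b 1) (h := fun _ => max b 1) (by positivity)
            (fun _ _ => by positivity) (fun _ _ => le_rfl) hz
          simpa only [primeProd_const] using this
    _ = _ := by rw [prod_const, card_univ]

/-- The basic bound: averages of nonnegative multiplicative functions dominated by characters,
summed over small families. -/
lemma sum_smallTup_le (Λ : Finset V) {b β c X z : ℝ} (hb : 0 ≤ b) (hβ : 0 ≤ β) (hc : 0 ≤ c)
    (hX : 1 < X) (hz : 1 < z) (hzX : z ^ Fintype.card V ≤ √X) {Y : Finset (V → ℕ)}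
    (hY : Y ⊆ smallTup Λ z) {Ψ : (V → ℕ) → ℕ →*₀ ℝ} (h1 : ∀ y ∈ Y, ∀ n, |Ψ y n| ≤ 1) {B : ℕ}
    (hB : 1 ≤ B) (hS : ∀ y ∈ Y, ∀ N, |∑ n ∈ range N, Ψ y n| ≤ B) {h : (V → ℕ) → ℕ → ℝ}
    (h0 : ∀ y ∈ Y, ∀ p, p.Prime → 0 ≤ h y p)
    (hh : ∀ y ∈ Y, ∀ p, p.Prime → h y p ≤ c + β * Ψ y p) :
    ∑ y ∈ Y, b ^ #(∏ v, y v).primeFactors *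
        ∑ n ∈ sqfreeBelow (X / (∏ v, y v : ℕ)), primeProd (h y) n ≤
      2 * (((c + β) * Real.log 4 + 1) * Real.exp 1) *
        (X / Real.log X * ((1 + Real.log X) ^ c * (Real.log B + 3) ^ β)) *
        (Real.exp 1 * (1 + Real.log z) ^ max b 1) ^ Fintype.card V := by
  have hL := Real.log_pos hX
  have hB1 : 0 ≤ Real.log B := Real.log_nonneg (by exact_mod_cast hB)
  set A := ((c + β) * Real.log 4 + 1) * Real.exp 1 with hA
  have hl4 : 0 ≤ Real.log 4 := Real.log_nonneg (by norm_num)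
  have hA0 : 0 ≤ A := by positivity
  set G := (1 + Real.log X) ^ c * (Real.log B + 3) ^ β with hG
  have hG0 : 0 ≤ G := by positivity
  have hsX : 1 < √X := by rw [← Real.sqrt_one]; exact Real.sqrt_lt_sqrt zero_le_one hX
  have main : ∀ y ∈ Y, ∑ n ∈ sqfreeBelow (X / (∏ v, y v : ℕ)), primeProd (h y) n ≤
      2 * A * (X / Real.log X * G) * (1 / ((∏ v, y v : ℕ) : ℝ)) := by
    intro y hy
    have hys := mem_smallTup.1 (hY hy)
    have hy1 : ∀ v, (1 : ℝ) ≤ y v ∧ (y v : ℝ) ≤ z := by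
      intro v
      by_cases hv : v ∈ Λ
      · rw [hys.1 v hv]; exact ⟨by norm_num, by simpa using hz.le⟩
      · have := hys.2 v hv
        exact ⟨by exact_mod_cast Nat.one_le_iff_ne_zero.2 this.2.ne_zero, this.1.le⟩
    set R : ℝ := ((∏ v, y v : ℕ) : ℝ) with hR
    have hR1 : 1 ≤ R := by
      have : (∏ v, y v) ≠ 0 := prod_ne_zero_iff.2 fun v _ h => by
        have := (hy1 v).1
        rw [h] at this
        norm_num at this
      rw [hR]
      exact_mod_cast Nat.one_le_iff_ne_zero.2 this
    have hRz : R ≤ √X := by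
      refine le_trans ?_ hzX
      rw [hR, Nat.cast_prod, ← card_univ, ← prod_const]
      exact prod_le_prod (fun v _ => by positivity) fun v _ => (hy1 v).2
    have hR0 : 0 < R := by linarith
    have hXR : √X ≤ X / R := by
      rw [le_div_iff₀ hR0]
      calc √X * R ≤ √X * √X := by gcongr
        _ = X := Real.mul_self_sqrt (by linarith)
    have hx1 : 1 < X / R := hsX.trans_le hXR
    have hlog : Real.log X / 2 ≤ Real.log (X / R) := by
      rw [← Real.log_sqrt (by linarith)]
      exact Real.log_le_log (by linarith) hXR
    have hlog2 : Real.log (X / R) ≤ Real.log X :=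
      Real.log_le_log (by linarith) (div_le_self (by linarith) hR1)
    refine (sum_primeProd_character_le hβ hc (h1 y hy) hB (hS y hy) (h0 y hy) (hh y hy) hx1).trans ?_
    rw [← hA]
    have e1 : X / R / Real.log (X / R) ≤ 2 * (X / Real.log X) * (1 / R) := by
      calc X / R / Real.log (X / R) ≤ X / R / (Real.log X / 2) :=
            div_le_div_of_nonneg_left (by positivity) (by positivity) hlog
        _ = _ := by field_simp
    have e2 : (1 + Real.log (X / R)) ^ c ≤ (1 + Real.log X) ^ c :=
      Real.rpow_le_rpow (by linarith) (by linarith) hc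
    calc A * (X / R / Real.log (X / R) * ((1 + Real.log (X / R)) ^ c * (Real.log B + 3) ^ β))
        ≤ A * (2 * (X / Real.log X) * (1 / R) * ((1 + Real.log X) ^ c * (Real.log B + 3) ^ β)) := by
          have : 0 ≤ X / R / Real.log (X / R) := by
            apply div_nonneg <;> linarith
          have h3 : 0 ≤ (1 + Real.log (X / R)) ^ c * (Real.log B + 3) ^ β := by
            have := Real.log_pos hx1
            positivity
          gcongr
      _ = _ := by rw [hG]; ring
  calc _ ≤ ∑ y ∈ Y, b ^ #(∏ v, y v).primeFactors *
        (2 * A * (X / Real.log X * G) * (1 / ((∏ v, y v : ℕ) : ℝ))) :=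
        sum_le_sum fun y hy => mul_le_mul_of_nonneg_left (main y hy) (by positivity)
    _ = 2 * A * (X / Real.log X * G) *
        ∑ y ∈ Y, b ^ #(∏ v, y v).primeFactors / ((∏ v, y v : ℕ) : ℝ) := by
        rw [mul_sum]
        exact sum_congr rfl fun y _ => by ring
    _ ≤ _ := by
        refine mul_le_mul_of_nonneg_left ?_ (by positivity)
        refine le_trans (sum_le_sum_of_subset_of_nonneg hY fun _ _ _ => by positivity) ?_
        exact sum_pow_div_prod_le hb hz _ fun v => by split_ifs <;> simp

/-- Reduction of sums over admissible families to sums of `primeProd`. -/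
lemma abs_sum_admTup_le (Λ : Finset V) {b X : ℝ} (hb : 0 ≤ b) {F : (V → ℕ) → ℝ}
    {ι : Type} {I : Finset ι} {Y : Finset (V → ℕ)} {h : ι → (V → ℕ) → ℕ → ℝ}
    (h0 : ∀ i ∈ I, ∀ y ∈ Y, ∀ p, p.Prime → 0 ≤ h i y p)
    (hF : ∀ y ∈ Y, ∀ n, (∏ v, y v) * n ∈ admSet X →
      |∑ x ∈ tupOn Λ n, F (y * x)| ≤ ∑ i ∈ I, primeProd (h i y) n) :
    |∑ y ∈ Y, ∑ n ∈ (sqfreeBelow X).filter (fun n => (∏ v, y v) * n ∈ admSet X),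
        ∑ x ∈ tupOn Λ n, b ^ #(∏ v, (y * x) v).primeFactors * F (y * x)| ≤
      ∑ i ∈ I, ∑ y ∈ Y, b ^ #(∏ v, y v).primeFactors *
        ∑ n ∈ sqfreeBelow (X / (∏ v, y v : ℕ)), primeProd (fun p => b * h i y p) n := by
  rw [sum_comm]
  refine (abs_sum_le_sum_abs _ _).trans (sum_le_sum fun y hy => ?_)
  refine (abs_sum_le_sum_abs _ _).trans ?_
  rw [← mul_sum, sum_comm, mul_sum]
  have hnn : ∀ n, 0 ≤ b ^ #(∏ v, y v).primeFactors * ∑ i ∈ I, primeProd (fun p => b * h i y p) n :=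
    fun n => mul_nonneg (by positivity) (sum_nonneg fun i hi =>
      primeProd_nonneg (fun p hp => mul_nonneg hb (h0 i hi y hy p hp)) n)
  refine le_trans (sum_le_sum fun n hn => ?_) (sum_le_sum_of_subset_of_nonneg
    (s := (sqfreeBelow X).filter (fun n => (∏ v, y v) * n ∈ admSet X)) ?_ fun n _ _ => hnn n)
  · rw [mem_filter] at hn
    have hadm := mem_admSet.1 hn.2
    have hn0 := (mem_sqfreeBelow.1 hn.1).2.ne_zero
    have hcop : Nat.Coprime (∏ v, y v) n := Nat.coprime_of_squarefree_mul hadm.2.1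
    have e : ∀ x ∈ tupOn Λ n, b ^ #(∏ v, (y * x) v).primeFactors * F (y * x) =
        b ^ #(∏ v, y v).primeFactors * b ^ #n.primeFactors * F (y * x) := by
      intro x hx
      rw [mem_tupOn hn0] at hx
      simp only [Pi.mul_apply, prod_mul_distrib, hx.1]
      rw [hcop.primeFactors_mul, card_union_of_disjoint hcop.disjoint_primeFactors, pow_add]
    rw [sum_congr rfl e, ← mul_sum, abs_mul, abs_of_nonneg (by positivity)]
    have e2 : ∀ i, primeProd (fun p => b * h i y p) n =
        b ^ #n.primeFactors * primeProd (h i y) n := fun i => by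
      simp [primeProd, prod_mul_distrib]
    simp only [e2]
    rw [← mul_sum, ← mul_assoc]
    exact mul_le_mul_of_nonneg_left (hF y hy n hn.2) (by positivity)
  · intro n hn
    rw [mem_filter] at hn
    have hadm := mem_admSet.1 hn.2
    refine mem_sqfreeBelow.2 ⟨?_, (mem_sqfreeBelow.1 hn.1).2⟩
    have hp : 0 < ((∏ v, y v : ℕ) : ℝ) := by
      have : (∏ v, y v) ≠ 0 := left_ne_zero_of_mul hadm.2.1.ne_zero
      positivity
    rw [lt_div_iff₀ hp, mul_comm]
    exact_mod_cast hadm.1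

end admissible

section jacForm
variable {k : ℕ}

lemma jacForm_mul_left (D E F : Lab k → ℕ) : jacForm (D * E) F = jacForm D F * jacForm E F := by
  simp only [jacForm, ← prod_mul_distrib, ← mul_pow]
  exact prod_congr rfl fun u _ => prod_congr rfl fun w _ => by rw [Pi.mul_apply, jac_mul_left]

lemma jacForm_mul_right (D : Lab k → ℕ) {E F : Lab k → ℕ} (hE : ∀ w, E w ≠ 0) (hF : ∀ w, F w ≠ 0) :
    jacForm D (E * F) = jacForm D E * jacForm D F := by
  simp only [jacForm, ← prod_mul_distrib, ← mul_pow]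
  exact prod_congr rfl fun u _ => prod_congr rfl fun w _ => by
    rw [Pi.mul_apply, jac_mul_right _ (hE w) (hF w)]

lemma abs_jacForm_le_one (D E : Lab k → ℕ) : |jacForm D E| ≤ 1 := by
  simp only [jacForm, abs_prod, abs_pow]
  exact prod_le_one (fun _ _ => prod_nonneg fun _ _ => by positivity) fun u _ =>
    prod_le_one (fun _ _ => by positivity) fun w _ => pow_le_one₀ (abs_nonneg _) (abs_jac_le_one _ _)

lemma jacForm_single_left (u : Lab k) (m : ℕ) (F : Lab k → ℕ) :
    jacForm (Pi.mulSingle u m) F = ∏ w, jac m (F w) ^ phi u w := by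
  rw [jacForm, prod_eq_single u]
  · rw [Pi.mulSingle_eq_same]
  · intro w _ hw
    simp [Pi.mulSingle_eq_of_ne hw, jac_one_left]
  · simp

lemma jacForm_single_right (D : Lab k → ℕ) (u : Lab k) (m : ℕ) :
    jacForm D (Pi.mulSingle u m) = ∏ w, jac (D w) m ^ phi w u := by
  rw [jacForm]
  refine prod_congr rfl fun w _ => ?_
  rw [prod_eq_single u]
  · rw [Pi.mulSingle_eq_same]
  · intro v _ hv
    simp [Pi.mulSingle_eq_of_ne hv, jac_one_right]
  · simp

lemma jacForm_single_single (u w : Lab k) (m n : ℕ) :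
    jacForm (Pi.mulSingle u m) (Pi.mulSingle w n) = jac m n ^ phi u w := by
  rw [jacForm_single_left, prod_eq_single w]
  · rw [Pi.mulSingle_eq_same]
  · intro v _ hv
    simp [Pi.mulSingle_eq_of_ne hv, jac_one_right]
  · simp

lemma mulSingle_ne_zero (u : Lab k) {m : ℕ} (hm : m ≠ 0) (w : Lab k) :
    (Pi.mulSingle u m : Lab k → ℕ) w ≠ 0 := by
  rw [Pi.mulSingle_apply]; split_ifs
  · exact hm
  · exact one_ne_zero

/-- Interaction of an entry `m` at `u` with the family `ρ`. -/
def jacWeight (ρ : Lab k → ℕ) (u : Lab k) (m : ℕ) : ℝ :=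
  jacForm ρ (Pi.mulSingle u m) * jacForm (Pi.mulSingle u m) ρ

lemma abs_jacWeight_le_one (ρ : Lab k → ℕ) (u : Lab k) (m : ℕ) : |jacWeight ρ u m| ≤ 1 := by
  rw [jacWeight, abs_mul]
  exact mul_le_one₀ (abs_jacForm_le_one _ _) (abs_nonneg _) (abs_jacForm_le_one _ _)

/-- The family obtained from `ρ` by inserting `m` at `u` and `n` at `v`. -/
def insertTwo (ρ : Lab k → ℕ) (u v : Lab k) (m n : ℕ) : Lab k → ℕ :=
  ρ * Pi.mulSingle u m * Pi.mulSingle v n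

lemma jacForm_insertTwo {ρ : Lab k → ℕ} (hρ : ∀ w, ρ w ≠ 0) (u v : Lab k) {m n : ℕ} (hm : m ≠ 0)
    (hn : n ≠ 0) : jacForm (insertTwo ρ u v m n) (insertTwo ρ u v m n) =
      jacForm ρ ρ * (jacWeight ρ u m * jacWeight ρ v n) * (jac m n ^ phi u v * jac n m ^ phi v u) := by
  have h1 := mulSingle_ne_zero u hm
  have h2 := mulSingle_ne_zero v hn
  have h3 : ∀ w, (ρ * Pi.mulSingle u m : Lab k → ℕ) w ≠ 0 := fun w => mul_ne_zero (hρ w) (h1 w)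
  rw [insertTwo, jacForm_mul_left, jacForm_mul_left, jacForm_mul_right _ h3 h2,
    jacForm_mul_right _ h3 h2, jacForm_mul_right _ h3 h2, jacForm_mul_right _ hρ h1,
    jacForm_mul_right _ hρ h1, jacForm_mul_right _ hρ h1, jacForm_single_single,
    jacForm_single_single, jacForm_single_single, jacForm_single_single, phi_self, phi_self,
    jacWeight, jacWeight]
  ring

lemma insertTwo_left {ρ : Lab k → ℕ} {u v : Lab k} (huv : u ≠ v) (hu : ρ u = 1) (m n : ℕ) :
    insertTwo ρ u v m n u = m := by
  simp [insertTwo, hu, Pi.mulSingle_eq_of_ne huv]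

lemma insertTwo_right {ρ : Lab k → ℕ} {u v : Lab k} (huv : u ≠ v) (hv : ρ v = 1) (m n : ℕ) :
    insertTwo ρ u v m n v = n := by
  simp [insertTwo, hv, Pi.mulSingle_eq_of_ne huv.symm]

lemma insertTwo_of_ne {ρ : Lab k → ℕ} {u v w : Lab k} (hu : w ≠ u) (hv : w ≠ v) (m n : ℕ) :
    insertTwo ρ u v m n w = ρ w := by
  simp [insertTwo, Pi.mulSingle_eq_of_ne hu, Pi.mulSingle_eq_of_ne hv]

lemma prod_insertTwo (ρ : Lab k → ℕ) (u v : Lab k) (m n : ℕ) :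
    ∏ w, insertTwo ρ u v m n w = (∏ w, ρ w) * m * n := by
  simp only [insertTwo, Pi.mul_apply, prod_mul_distrib, prod_pi_mulSingle']
  simp

lemma goodLab_insertTwo {ρ : Lab k → ℕ} {u v : Lab k} (huv : u ≠ v) (hu : ρ u = 1) (hv : ρ v = 1)
    {m n m' n' : ℕ} (hm : m ≠ 1) (hn : n ≠ 1) (hm' : m' ≠ 1) (hn' : n' ≠ 1) :
    goodLab (insertTwo ρ u v m n) ↔ goodLab (insertTwo ρ u v m' n') := by
  refine forall_congr' fun j => forall_congr' fun i => exists_congr fun w =>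
    and_congr_right fun _ => ?_
  by_cases h1 : w = u
  · subst h1; simp [insertTwo_left huv hu, hm, hm']
  by_cases h2 : w = v
  · subst h2; simp [insertTwo_right huv hv, hn, hn']
  rw [insertTwo_of_ne h1 h2, insertTwo_of_ne h1 h2]

/-- Families that are `1` at `u` and `v`. -/
def restTup (S : Finset ℕ) (u v : Lab k) : Finset (Lab k → ℕ) :=
  Fintype.piFinset fun w => if w = u ∨ w = v then {1} else S

lemma sum_insertTwo {u v : Lab k} (huv : u ≠ v) (S : Finset ℕ) (G : (Lab k → ℕ) → ℝ) :
    ∑ D ∈ Fintype.piFinset (fun _ => S), G D =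
      ∑ ρ ∈ restTup S u v, ∑ m ∈ S, ∑ n ∈ S, G (insertTwo ρ u v m n) := by
  simp only [sum_sigma']
  have hins : ∀ D : Lab k → ℕ, insertTwo (fun w => if w = u ∨ w = v then 1 else D w) u v (D u) (D v) =
      D := by
    intro D
    funext w
    by_cases h1 : w = u
    · subst h1; exact insertTwo_left huv (by simp) _ _
    by_cases h2 : w = v
    · subst h2; exact insertTwo_right huv (by simp) _ _
    rw [insertTwo_of_ne h1 h2, if_neg (by simp [h1, h2])]
  refine sum_nbij' (fun D => ⟨fun w => if w = u ∨ w = v then 1 else D w, D u, D v⟩)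
    (fun t => insertTwo t.1 u v t.2.1 t.2.2) ?_ ?_ ?_ ?_ ?_
  · intro D hD
    rw [Fintype.mem_piFinset] at hD
    simp only [mem_sigma, restTup, Fintype.mem_piFinset]
    exact ⟨fun w => by split_ifs; exacts [mem_singleton_self 1, hD w], hD u, hD v⟩
  · rintro ⟨ρ, m, n⟩ ht
    simp only [mem_sigma, restTup, Fintype.mem_piFinset] at ht
    obtain ⟨hρ, hm, hn⟩ := ht
    have hu : ρ u = 1 := by simpa using hρ u
    have hv : ρ v = 1 := by simpa using hρ v
    rw [Fintype.mem_piFinset]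
    intro w
    by_cases h1 : w = u
    · subst h1; rwa [insertTwo_left huv hu]
    by_cases h2 : w = v
    · subst h2; rwa [insertTwo_right huv hv]
    rw [insertTwo_of_ne h1 h2]
    simpa [h1, h2] using hρ w
  · intro D _
    exact hins D
  · rintro ⟨ρ, m, n⟩ ht
    simp only [mem_sigma, restTup, Fintype.mem_piFinset] at ht
    obtain ⟨hρ, hm, hn⟩ := ht
    have hu : ρ u = 1 := by simpa using hρ u
    have hv : ρ v = 1 := by simpa using hρ v
    have e : (fun w => if w = u ∨ w = v then 1 else insertTwo ρ u v m n w) = ρ := by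
      funext w
      split_ifs with h
      · rcases h with rfl | rfl
        · exact hu.symm
        · exact hv.symm
      · push Not at h
        exact insertTwo_of_ne h.1 h.2 _ _
    simp only [e, insertTwo_left huv hu, insertTwo_right huv hv]
  · intro D _
    rw [hins D]

end jacForm

lemma abs_bilinear_jac_le {A B : Finset ℕ} {W c : ℕ} {κ θ z T R X : ℝ} {α β : ℕ → ℝ}
    (hA : ∀ m ∈ A, Squarefree m ∧ Odd m ∧ #m.primeFactors ≤ W ∧ z ≤ m ∧ (m : ℝ) ≤ T)
    (hAc : ∀ m ∈ A, m % 4 = c)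
    (hB : ∀ n ∈ B, Squarefree n ∧ Odd n ∧ #n.primeFactors ≤ W ∧ z ≤ n ∧ R * n * T ≤ X)
    (hα : ∀ m ∈ A, |α m| ≤ κ) (hβ : ∀ n ∈ B, |β n| ≤ κ) (hκ : 0 ≤ κ) (hz : 1 ≤ z) (hθ : 0 ≤ θ)
    (hR : 0 < R) (hX : 0 ≤ X) (hsmall : 12 * κ ^ 16 * 2 ^ (32 * W) ≤ θ ^ 8 * z) :
    |∑ m ∈ A, ∑ n ∈ B, α m * β n * jac n m| ≤ θ * (X / R) := by
  have hRHS : 0 ≤ θ * (X / R) := by positivity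
  rcases A.eq_empty_or_nonempty with rfl | ⟨m₀, hm₀⟩
  · simpa using hRHS
  rcases B.eq_empty_or_nonempty with rfl | ⟨n₀, hn₀⟩
  · simpa using hRHS
  obtain ⟨-, -, -, hzm, hmT⟩ := hA m₀ hm₀
  obtain ⟨-, -, -, hzn, hnT⟩ := hB n₀ hn₀
  have hT : 0 < T := by linarith
  have hle : ∀ n : ℕ, R * n * T ≤ X → n ≤ ⌊X / (R * T)⌋₊ := fun n hn =>
    Nat.le_floor (by rw [le_div_iff₀ (by positivity)]; linarith)
  have hM : m₀ ≤ ⌊T⌋₊ := Nat.le_floor hmT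
  have hN := hle n₀ hnT
  have hzM : z ≤ ⌊T⌋₊ := hzm.trans (by exact_mod_cast hM)
  have hzN : z ≤ ⌊X / (R * T)⌋₊ := hzn.trans (by exact_mod_cast hN)
  have h1M : 1 ≤ ⌊T⌋₊ := by exact_mod_cast hz.trans hzM
  have h1N : 1 ≤ ⌊X / (R * T)⌋₊ := by exact_mod_cast hz.trans hzN
  have key := bilinear_jac (A := A) (B := B) (M := ⌊T⌋₊) (N := ⌊X / (R * T)⌋₊) (W := W) (c := c)
    (κ := κ) (Z := z) (α := α) (β := β)
    (fun m hm => ⟨(hA m hm).1, (hA m hm).2.1, (hA m hm).2.2.1, Nat.le_floor (hA m hm).2.2.2.2⟩) hAc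
    (fun n hn => ⟨(hB n hn).1, (hB n hn).2.1, (hB n hn).2.2.1, hle n (hB n hn).2.2.2.2⟩)
    h1M h1N hα hβ hκ hzM hzN
  set S := ∑ m ∈ A, ∑ n ∈ B, α m * β n * jac n m
  have hMN : (⌊T⌋₊ : ℝ) * ⌊X / (R * T)⌋₊ ≤ X / R := by
    calc (⌊T⌋₊ : ℝ) * ⌊X / (R * T)⌋₊ ≤ T * (X / (R * T)) :=
          mul_le_mul (Nat.floor_le hT.le) (Nat.floor_le (by positivity)) (by positivity) hT.le
      _ = X / R := by field_simp
  have h8 : |S| ^ 8 ≤ (θ * (X / R)) ^ 8 := by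
    have e : |S| ^ 8 = S ^ 8 := (by decide : Even 8).pow_abs S
    rw [e]
    refine le_of_mul_le_mul_right (key.trans ?_) (by linarith : 0 < z)
    calc 12 * κ ^ 16 * 2 ^ (32 * W) * ((⌊T⌋₊ : ℝ) * ⌊X / (R * T)⌋₊) ^ 8
        ≤ θ ^ 8 * z * (X / R) ^ 8 := by gcongr
      _ = _ := by ring
  exact le_of_pow_le_pow_left₀ (by norm_num) hRHS h8

/-- Index of the multiplicative interval `[e^{δj}, e^{δ(j+1)})` containing `m`. -/
def logIdx (δ : ℝ) (m : ℕ) : ℕ := ⌊Real.log m / δ⌋₊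

lemma lt_exp_logIdx {δ : ℝ} (hδ : 0 < δ) {m : ℕ} (hm : m ≠ 0) :
    (m : ℝ) < Real.exp (δ * (logIdx δ m + 1)) := by
  have hm' : 0 < (m : ℝ) := by positivity
  rw [← Real.log_lt_iff_lt_exp hm', ← div_lt_iff₀' hδ]
  exact Nat.lt_floor_add_one _

lemma exp_logIdx_le {δ : ℝ} (hδ : 0 < δ) {m : ℕ} (hm : m ≠ 0) :
    Real.exp (δ * (logIdx δ m + 1)) ≤ m * Real.exp δ := by
  have hm' : 0 < (m : ℝ) := by positivity
  have h1 : (logIdx δ m : ℝ) ≤ Real.log m / δ :=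
    Nat.floor_le (div_nonneg (Real.log_natCast_nonneg m) hδ.le)
  rw [le_div_iff₀ hδ] at h1
  rw [mul_add, mul_one, Real.exp_add]
  refine mul_le_mul_of_nonneg_right ?_ (Real.exp_pos δ).le
  rw [← Real.le_log_iff_exp_le hm']
  linarith

/-- The labels carrying entries that are at least `z`. -/
def bigSet {V : Type} [Fintype V] (z : ℝ) (D : V → ℕ) : Finset V := univ.filter fun v => z ≤ D v

/-- The labelled factorizations discarded before estimating the bilinear sums. -/
def discarded {k : ℕ} (X δ : ℝ) (W : ℕ) (u v : Lab k) (D : Lab k → ℕ) : Prop :=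
  W < #(D u).primeFactors ∨ W < #(D v).primeFactors ∨
    X ≤ (∏ w, if w = u then 1 else (D w : ℝ)) * Real.exp (δ * (logIdx δ (D u) + 1))

lemma jac_pow_mul_jac_pow {m n a c : ℕ} (hm : m ≠ 0) (ha : Even a) (hc : Odd c) :
    jac m n ^ a * jac n m ^ c = jac n m := by
  rcases jac_trichotomy n m with h | h | h
  · rw [h, zero_pow hc.pos.ne', mul_zero]
  all_goals
    have hcop : Nat.Coprime n m := by
      by_contra hne
      rw [jac_eq_zero_of_not_coprime hm hne] at h
      norm_num at h
    obtain ⟨r, rfl⟩ := ha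
    rw [pow_add, ← mul_pow, jac_sq_eq_one hcop.symm, one_pow, one_mul, h]
  · rw [one_pow]
  · rw [hc.neg_one_pow]

lemma abs_sum_sum_filter_le {S : Finset ℕ} {I : Finset (ℕ × ℕ)} {g : ℕ → ℕ × ℕ}
    (P : ℕ → Prop) [DecidablePred P] (hg : ∀ m ∈ S, P m → g m ∈ I) (f : ℕ → ℝ) {Bd : ℝ}
    (hB : ∀ i ∈ I, |∑ m ∈ S.filter (fun m => P m ∧ g m = i), f m| ≤ Bd) :
    |∑ m ∈ S, if P m then f m else 0| ≤ #I * Bd := by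
  rw [← sum_filter, ← sum_fiberwise_of_maps_to (t := I) (g := g) fun m hm =>
    hg m (mem_filter.1 hm).1 (mem_filter.1 hm).2]
  refine (abs_sum_le_sum_abs _ _).trans ?_
  rw [← nsmul_eq_mul]
  refine sum_le_card_nsmul _ _ _ fun i hi => ?_
  rw [filter_filter]
  exact hB i hi

section
variable {k : ℕ}

/-- The weighted summand. -/
def summand (b : ℝ) (D : Lab k → ℕ) : ℝ :=
  b ^ #(∏ v, D v).primeFactors * if goodLab D then jacForm D D else 0

lemma abs_summand_le {b : ℝ} (hb : 0 ≤ b) (D : Lab k → ℕ) :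
    |summand b D| ≤ b ^ #(∏ v, D v).primeFactors := by
  rw [summand, abs_mul, abs_of_nonneg (by positivity)]
  refine mul_le_of_le_one_right (by positivity) ?_
  split_ifs
  · exact abs_jacForm_le_one _ _
  · simp

lemma summand_insertTwo {b : ℝ} {ρ : Lab k → ℕ} {u v : Lab k} (huv : u ≠ v) (hρ : ∀ w, ρ w ≠ 0)
    (hu : ρ u = 1) (hv : ρ v = 1) (h1 : Even (phi u v)) (h2 : Odd (phi v u)) {m n : ℕ}
    (hm0 : m ≠ 0) (hn0 : n ≠ 0) (hm1 : m ≠ 1) (hn1 : n ≠ 1)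
    (hmR : Nat.Coprime (∏ w, ρ w) m) (hnR : Nat.Coprime (∏ w, ρ w) n) :
    summand b (insertTwo ρ u v m n) =
      b ^ #(∏ w, ρ w).primeFactors * (if goodLab (insertTwo ρ u v 2 2) then jacForm ρ ρ else 0) *
        ((b ^ #m.primeFactors * jacWeight ρ u m) * (b ^ #n.primeFactors * jacWeight ρ v n) *
          jac n m) := by
  rw [summand, jacForm_insertTwo hρ u v hm0 hn0, jac_pow_mul_jac_pow hm0 h1 h2, prod_insertTwo]
  simp only [goodLab_insertTwo huv hu hv hm1 hn1 (by norm_num : (2 : ℕ) ≠ 1) (by norm_num : (2 : ℕ) ≠ 1)]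
  by_cases hc : Nat.Coprime n m
  · have hc' : Nat.Coprime ((∏ w, ρ w) * m) n := Nat.Coprime.mul_left hnR hc.symm
    rw [hc'.primeFactors_mul, card_union_of_disjoint hc'.disjoint_primeFactors,
      hmR.primeFactors_mul, card_union_of_disjoint hmR.disjoint_primeFactors, pow_add, pow_add]
    split_ifs <;> ring
  · rw [jac_eq_zero_of_not_coprime hm0 hc]
    simp

/-- Bound for the bilinear part of the sum attached to the pair `u, v`, for fixed other entries. -/
lemma abs_sum_insertTwo_le {b X z δ θ : ℝ} (hb : 0 ≤ b) (hX : 1 < X) (hz : 1 < z) (hδ : 0 < δ)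
    (hθ : 0 ≤ θ) {W : ℕ} (hsmall : 12 * (max b 1 ^ W) ^ 16 * 2 ^ (32 * W) ≤ θ ^ 8 * z)
    {u v : Lab k} {Λ : Finset (Lab k)} (hu : u ∈ Λ) (hv : v ∈ Λ) (h1 : Even (phi u v))
    (h2 : Odd (phi v u)) {ρ : Lab k → ℕ} (hρ : ρ ∈ restTup (sqfreeBelow X) u v) :
    |∑ m ∈ sqfreeBelow X, ∑ n ∈ sqfreeBelow X,
      if insertTwo ρ u v m n ∈ admTup (Lab k) X ∧ bigSet z (insertTwo ρ u v m n) = Λ ∧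
        ¬ discarded X δ W u v (insertTwo ρ u v m n) then summand b (insertTwo ρ u v m n) else 0| ≤
    2 * (⌊Real.log X / δ⌋₊ + 1) * θ * X * (b ^ #(∏ w, ρ w).primeFactors / ((∏ w, ρ w : ℕ) : ℝ)) := by
  have huv : u ≠ v := by
    rintro rfl
    rw [phi_self] at h2
    exact absurd h2 (by decide)
  rw [restTup, Fintype.mem_piFinset] at hρ
  have hρu : ρ u = 1 := by simpa using hρ u
  have hρv : ρ v = 1 := by simpa using hρ v
  have hρ0 : ∀ w, ρ w ≠ 0 := by
    intro w
    have := hρ w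
    split_ifs at this with h
    · rw [mem_singleton.1 this]; exact one_ne_zero
    · exact (mem_sqfreeBelow.1 this).2.ne_zero
  set R := ∏ w, ρ w with hR
  have hR0 : R ≠ 0 := prod_ne_zero_iff.2 fun w _ => hρ0 w
  have hR0' : (0 : ℝ) < R := by positivity
  set S := sqfreeBelow X with hS
  have hRHS : 0 ≤ 2 * (⌊Real.log X / δ⌋₊ + 1) * θ * X * (b ^ #R.primeFactors / (R : ℝ)) := by
    positivity
  by_cases hok : Squarefree R ∧ ∀ w, w ≠ u → w ≠ v → (z ≤ ρ w ↔ w ∈ Λ)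
  swap
  · rw [sum_eq_zero fun m hm => sum_eq_zero fun n hn => if_neg ?_]
    · simpa using hRHS
    · rintro ⟨hadm, hbig, -⟩
      refine hok ⟨?_, fun w hwu hwv => ?_⟩
      · rw [mem_admTup, prod_insertTwo] at hadm
        exact (mem_admSet.1 hadm).2.1.squarefree_of_dvd ((Dvd.intro _ rfl).mul_right _)
      · rw [← hbig, bigSet, mem_filter, insertTwo_of_ne hwu hwv]
        simp
  obtain ⟨hRsq, hΛ⟩ := hok
  set K0 := b ^ #R.primeFactors * (if goodLab (insertTwo ρ u v 2 2) then jacForm ρ ρ else 0) with hK0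
  set P : ℕ → Prop := fun m => z ≤ m ∧ Odd m ∧ Nat.Coprime R m ∧ #m.primeFactors ≤ W with hP
  set α : ℕ → ℝ := fun m => b ^ #m.primeFactors * jacWeight ρ u m with hα
  set β : ℕ → ℝ := fun n => b ^ #n.primeFactors * jacWeight ρ v n with hβ
  set Q : ℕ → ℕ → Prop := fun m n => P n ∧ R * n * Real.exp (δ * (logIdx δ m + 1)) < X ∧
    R * (m % 4) * n % 4 = 1 with hQ
  have hκ : ∀ (w : Lab k) (m : ℕ), P m → |b ^ #m.primeFactors * jacWeight ρ w m| ≤ max b 1 ^ W := by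
    intro w m hm
    rw [abs_mul, abs_of_nonneg (by positivity)]
    calc _ ≤ b ^ #m.primeFactors * 1 :=
          mul_le_mul_of_nonneg_left (abs_jacWeight_le_one _ _ _) (by positivity)
      _ ≤ max b 1 ^ #m.primeFactors := by
          rw [mul_one]; exact pow_le_pow_left₀ hb (le_max_left _ _) _
      _ ≤ _ := pow_le_pow_right₀ (le_max_right _ _) hm.2.2.2
  have hne1 : ∀ m : ℕ, z ≤ m → m ≠ 1 := by
    rintro m hm rfl
    norm_num at hm
    linarith
  have term : ∀ m ∈ S, ∀ n ∈ S, (if insertTwo ρ u v m n ∈ admTup (Lab k) X ∧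
      bigSet z (insertTwo ρ u v m n) = Λ ∧ ¬ discarded X δ W u v (insertTwo ρ u v m n) then
        summand b (insertTwo ρ u v m n) else 0) =
      K0 * if P m then (if Q m n then α m * β n * jac n m else 0) else 0 := by
    intro m hm n hn
    have hmS := mem_sqfreeBelow.1 hm
    have hnS := mem_sqfreeBelow.1 hn
    have hm0 := hmS.2.ne_zero
    have hn0 := hnS.2.ne_zero
    have hdis : discarded X δ W u v (insertTwo ρ u v m n) ↔ W < #m.primeFactors ∨
        W < #n.primeFactors ∨ X ≤ R * n * Real.exp (δ * (logIdx δ m + 1)) := by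
      have : (∏ w, if w = u then 1 else (insertTwo ρ u v m n w : ℝ)) = R * n := by
        have e := prod_insertTwo ρ u v 1 n
        rw [mul_one] at e
        rw [hR, ← Nat.cast_mul, ← e, Nat.cast_prod]
        refine prod_congr rfl fun w _ => ?_
        split_ifs with h
        · subst h; rw [insertTwo_left huv hρu, Nat.cast_one]
        · by_cases h' : w = v
          · subst h'; rw [insertTwo_right huv hρv, insertTwo_right huv hρv]
          · rw [insertTwo_of_ne h h', insertTwo_of_ne h h']
      rw [discarded, this, insertTwo_left huv hρu, insertTwo_right huv hρv]
    have hbig : bigSet z (insertTwo ρ u v m n) = Λ ↔ z ≤ m ∧ z ≤ n := by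
      rw [Finset.ext_iff]
      simp only [bigSet, mem_filter, mem_univ, true_and]
      constructor
      · intro h
        have hu' := (h u).2 hu
        have hv' := (h v).2 hv
        rw [insertTwo_left huv hρu] at hu'
        rw [insertTwo_right huv hρv] at hv'
        exact ⟨hu', hv'⟩
      · rintro ⟨h3, h4⟩ w
        by_cases h : w = u
        · subst h; rw [insertTwo_left huv hρu]; simp [h3, hu]
        by_cases h' : w = v
        · subst h'; rw [insertTwo_right huv hρv]; simp [h4, hv]
        rw [insertTwo_of_ne h h']
        exact hΛ w h h'
    have hcond : (insertTwo ρ u v m n ∈ admTup (Lab k) X ∧ bigSet z (insertTwo ρ u v m n) = Λ ∧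
        ¬ discarded X δ W u v (insertTwo ρ u v m n)) ↔
        (((R * m * n : ℕ) : ℝ) < X ∧ Squarefree (R * m * n) ∧ R * m * n % 4 = 1) ∧
        (z ≤ m ∧ z ≤ n) ∧ ¬ (W < #m.primeFactors ∨ W < #n.primeFactors ∨
          X ≤ R * n * Real.exp (δ * (logIdx δ m + 1))) := by
      rw [hdis, hbig, mem_admTup, prod_insertTwo, ← hR, mem_admSet]
    have hmod : R * (m % 4) * n % 4 = R * m * n % 4 :=
      ((Nat.mod_modEq m 4).mul_left R).mul_right n
    by_cases hc : Nat.Coprime n m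
    swap
    · rw [if_neg, jac_eq_zero_of_not_coprime hm0 hc]
      · simp
      · intro h
        obtain ⟨⟨-, hsq, -⟩, -⟩ := hcond.1 h
        have : m * n ∣ R * m * n := ⟨R, by ring⟩
        exact hc (Nat.coprime_of_squarefree_mul (hsq.squarefree_of_dvd this)).symm
    have hiff : ((((R * m * n : ℕ) : ℝ) < X ∧ Squarefree (R * m * n) ∧ R * m * n % 4 = 1) ∧
        (z ≤ m ∧ z ≤ n) ∧ ¬ (W < #m.primeFactors ∨ W < #n.primeFactors ∨
          X ≤ R * n * Real.exp (δ * (logIdx δ m + 1)))) ↔ P m ∧ Q m n := by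
      simp only [hP, hQ, hmod, not_or, not_lt, not_le]
      constructor
      · rintro ⟨⟨hlt, hsq, hmd⟩, ⟨hzm, hzn⟩, hWm, hWn, hX'⟩
        have hodd : Odd (R * m * n) := Nat.odd_iff.2 (by omega)
        rw [Nat.odd_mul, Nat.odd_mul] at hodd
        have c1 : Nat.Coprime (R * m) n := Nat.coprime_of_squarefree_mul hsq
        have c2 : Nat.Coprime R m := Nat.coprime_of_squarefree_mul
          (hsq.squarefree_of_dvd (Dvd.intro _ rfl))
        exact ⟨⟨hzm, hodd.1.2, c2, hWm⟩, ⟨hzn, hodd.2, c1.coprime_mul_right, hWn⟩, hX', hmd⟩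
      · rintro ⟨⟨hzm, hom, c2, hWm⟩, ⟨hzn, hon, c1, hWn⟩, hX', hmd⟩
        refine ⟨⟨lt_of_le_of_lt ?_ hX', ?_, hmd⟩, ⟨hzm, hzn⟩, hWm, hWn, hX'⟩
        · push_cast
          calc (R : ℝ) * m * n = R * n * m := by ring
            _ ≤ _ := mul_le_mul_of_nonneg_left (lt_exp_logIdx hδ hm0).le (by positivity)
        · exact (Nat.squarefree_mul (Nat.Coprime.mul_left c1 hc.symm)).2
            ⟨(Nat.squarefree_mul c2).2 ⟨hRsq, hmS.2⟩, hnS.2⟩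
    rw [if_congr (hcond.trans hiff) rfl rfl]
    by_cases hPm : P m
    · by_cases hQm : Q m n
      · rw [if_pos ⟨hPm, hQm⟩, if_pos hPm, if_pos hQm,
          summand_insertTwo huv hρ0 hρu hρv h1 h2 hm0 hn0 (hne1 m hPm.1) (hne1 n hQm.1.1)
            hPm.2.2.1 hQm.1.2.2.1]
      · rw [if_neg fun h => hQm h.2, if_pos hPm, if_neg hQm, mul_zero]
    · rw [if_neg fun h => hPm h.1, if_neg hPm, mul_zero]
  rw [sum_congr rfl fun m hm => sum_congr rfl fun n hn => term m hm n hn]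
  simp only [← mul_sum]
  rw [abs_mul]
  have hK0le : |K0| ≤ b ^ #R.primeFactors := by
    rw [hK0, abs_mul, abs_of_nonneg (by positivity)]
    refine mul_le_of_le_one_right (by positivity) ?_
    split_ifs
    · exact abs_jacForm_le_one _ _
    · simp
  set I : Finset (ℕ × ℕ) := {1, 3} ×ˢ range (⌊Real.log X / δ⌋₊ + 1) with hI
  have hcardI : (#I : ℝ) = 2 * (⌊Real.log X / δ⌋₊ + 1) := by
    rw [hI, card_product, card_range, card_pair (by norm_num)]; push_cast; ring
  have hmain : |∑ m ∈ S, ∑ n ∈ S, if P m then (if Q m n then α m * β n * jac n m else 0) else 0| ≤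
      #I * (θ * (X / R)) := by
    have e : ∀ m, (∑ n ∈ S, if P m then (if Q m n then α m * β n * jac n m else 0) else 0) =
        if P m then ∑ n ∈ S, (if Q m n then α m * β n * jac n m else 0) else 0 := by
      intro m; split_ifs <;> simp
    simp only [e]
    refine abs_sum_sum_filter_le (g := fun m => (m % 4, logIdx δ m)) P ?_ _ ?_
    · intro m hm hPm
      have hm4 : m % 4 = 1 ∨ m % 4 = 3 := by
        have := Nat.odd_iff.1 hPm.2.1; omega
      have hmX := mem_sqfreeBelow.1 hm
      have hm0 := hmX.2.ne_zero
      rw [hI, mem_product]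
      refine ⟨by simpa using hm4, mem_range.2 (Nat.lt_succ_of_le (Nat.floor_le_floor ?_))⟩
      exact div_le_div_of_nonneg_right (Real.log_le_log (by positivity) hmX.1.le) hδ.le
    · rintro ⟨c, j⟩ -
      set B := S.filter fun n => P n ∧ R * n * Real.exp (δ * (j + 1)) < X ∧ R * c * n % 4 = 1
      have e2 : ∀ m ∈ S.filter (fun m => P m ∧ (m % 4, logIdx δ m) = (c, j)),
          (∑ n ∈ S, if Q m n then α m * β n * jac n m else 0) =
            ∑ n ∈ B, α m * β n * jac n m := by
        intro m hm
        rw [mem_filter, Prod.mk.injEq] at hm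
        rw [← sum_filter]
        refine sum_congr (filter_congr fun n _ => ?_) fun _ _ => rfl
        simp only [hQ, hm.2.2.1, hm.2.2.2]
      rw [sum_congr rfl e2]
      refine abs_bilinear_jac_le (W := W) (c := c) (T := Real.exp (δ * (j + 1))) (κ := max b 1 ^ W)
        (z := z) ?_ ?_ ?_ ?_ ?_ (by positivity) hz.le hθ hR0' (by linarith) hsmall
      · intro m hm
        rw [mem_filter, Prod.mk.injEq] at hm
        obtain ⟨hmS, hPm, -, hj⟩ := hm
        have hsq := (mem_sqfreeBelow.1 hmS).2
        exact ⟨hsq, hPm.2.1, hPm.2.2.2, hPm.1, by rw [← hj]; exact (lt_exp_logIdx hδ hsq.ne_zero).le⟩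
      · intro m hm
        rw [mem_filter, Prod.mk.injEq] at hm
        exact hm.2.2.1
      · intro n hn
        rw [mem_filter] at hn
        obtain ⟨hnS, hPn, hlt, -⟩ := hn
        exact ⟨(mem_sqfreeBelow.1 hnS).2, hPn.2.1, hPn.2.2.2, hPn.1, hlt.le⟩
      · intro m hm
        exact hκ u m (mem_filter.1 hm).2.1
      · intro n hn
        exact hκ v n (mem_filter.1 hn).2.1
  calc _ ≤ b ^ #R.primeFactors * (#I * (θ * (X / R))) :=
        mul_le_mul hK0le hmain (abs_nonneg _) (by positivity)
    _ = _ := by rw [hcardI]; field_simp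

end

section
variable {k : ℕ}

lemma abs_sum_bigSet_le {b X z δ θ : ℝ} (hb : 0 ≤ b) (hX : 1 < X) (hz : 1 < z) (hδ : 0 < δ)
    (hθ : 0 ≤ θ) {W : ℕ} (hsmall : 12 * (max b 1 ^ W) ^ 16 * 2 ^ (32 * W) ≤ θ ^ 8 * z)
    {u v : Lab k} {Λ : Finset (Lab k)} (hu : u ∈ Λ) (hv : v ∈ Λ) (h1 : Even (phi u v))
    (h2 : Odd (phi v u)) :
    |∑ D ∈ (admTup (Lab k) X).filter (fun D => bigSet z D = Λ), summand b D| ≤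
      2 * (⌊Real.log X / δ⌋₊ + 1) * θ * X *
        (Real.exp 1 * (1 + Real.log X) ^ max b 1) ^ Fintype.card (Lab k) +
      ∑ D ∈ (admTup (Lab k) X).filter (discarded X δ W u v), b ^ #(∏ w, D w).primeFactors := by
  have huv : u ≠ v := by
    rintro rfl
    rw [phi_self] at h2
    exact absurd h2 (by decide)
  rw [← sum_filter_add_sum_filter_not _ (fun D => ¬ discarded X δ W u v D), filter_filter,
    filter_filter]
  refine (abs_add_le _ _).trans (add_le_add ?_ ?_)
  · have e : ∑ D ∈ (admTup (Lab k) X).filter (fun D => bigSet z D = Λ ∧ ¬ discarded X δ W u v D),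
        summand b D = ∑ D ∈ Fintype.piFinset (fun _ => sqfreeBelow X),
          if D ∈ admTup (Lab k) X ∧ bigSet z D = Λ ∧ ¬ discarded X δ W u v D
            then summand b D else 0 := by
      rw [← sum_filter]
      refine sum_congr (Finset.ext fun D => ?_) fun _ _ => rfl
      rw [mem_filter, mem_filter]
      refine ⟨fun h => ⟨Fintype.mem_piFinset.2 fun w => ?_, h⟩, fun h => h.2⟩
      exact mem_sqfreeBelow_of_mem_admTup h.1 w
    rw [e, sum_insertTwo huv]
    refine (abs_sum_le_sum_abs _ _).trans ((sum_le_sum fun ρ hρ =>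
      abs_sum_insertTwo_le hb hX hz hδ hθ hsmall hu hv h1 h2 hρ).trans ?_)
    rw [← mul_sum]
    refine mul_le_mul_of_nonneg_left ?_ (by positivity)
    refine sum_pow_div_prod_le hb hX _ fun w => ?_
    split_ifs <;> simp
  · refine (abs_sum_le_sum_abs _ _).trans ((sum_le_sum fun D _ => abs_summand_le hb D).trans ?_)
    refine sum_le_sum_of_subset_of_nonneg (fun D hD => ?_) fun _ _ _ => by positivity
    rw [mem_filter] at hD ⊢
    exact ⟨hD.1, not_not.1 hD.2.2⟩

lemma sum_admTup_filter_le {b X : ℝ} (hb : 0 ≤ b) {s : (Lab k → ℕ) → Prop} {p : ℕ → Prop} [DecidablePred p]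
    (hs : ∀ D ∈ admTup (Lab k) X, s D → p (∏ w, D w)) :
    ∑ D ∈ (admTup (Lab k) X).filter s, b ^ #(∏ w, D w).primeFactors ≤
      ∑ n ∈ (admSet X).filter p, (b * Fintype.card (Lab k)) ^ #n.primeFactors := by
  have e : ∑ n ∈ (admSet X).filter p, (b * Fintype.card (Lab k)) ^ #n.primeFactors =
      ∑ D ∈ admTup (Lab k) X, (if p (∏ w, D w) then b ^ #(∏ w, D w).primeFactors else 0) * 1 := by
    rw [← sum_admTup X (fun n => if p n then b ^ #n.primeFactors else 0) fun _ => 1, sum_filter]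
    refine sum_congr rfl fun n hn => ?_
    have := card_tupOn (V := Lab k) univ (mem_admSet.1 hn).2.1
    rw [tupOn_univ] at this
    rw [sum_const, nsmul_eq_mul, mul_one, this, card_univ]
    split_ifs
    · rw [mul_pow]
    · simp
  rw [e, sum_filter]
  refine sum_le_sum fun D hD => ?_
  rw [mul_one]
  by_cases h : s D
  · rw [if_pos h, if_pos (hs D hD h)]
  · rw [if_neg h]
    split_ifs
    · positivity
    · rfl

lemma discarded_imp {X δ : ℝ} (hδ : 0 < δ) {W : ℕ} {u v : Lab k} {D : Lab k → ℕ}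
    (hD : ∏ w, D w ≠ 0) (h : discarded X δ W u v D) :
    W < #(∏ w, D w).primeFactors ∨ X ≤ (∏ w, D w : ℕ) * Real.exp δ := by
  have hle : ∀ w, #(D w).primeFactors ≤ #(∏ w, D w).primeFactors := fun w =>
    card_le_card (Nat.primeFactors_mono (dvd_prod_of_mem D (mem_univ w)) hD)
  rcases h with h | h | h
  · exact Or.inl (h.trans_le (hle u))
  · exact Or.inl (h.trans_le (hle v))
  · right
    have hu : D u ≠ 0 := fun h0 => hD (prod_eq_zero (mem_univ u) h0)
    have e : ((∏ w, D w : ℕ) : ℝ) = (∏ w, if w = u then 1 else (D w : ℝ)) * D u := by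
      have e2 : ∀ w, (D w : ℝ) = (if w = u then 1 else (D w : ℝ)) * if w = u then (D w : ℝ) else 1 := by
        intro w; split_ifs <;> simp
      rw [Nat.cast_prod, prod_congr rfl fun w _ => e2 w, prod_mul_distrib, prod_ite_eq' univ u,
        if_pos (mem_univ u)]
    rw [e, mul_assoc]
    exact h.trans (mul_le_mul_of_nonneg_left (exp_logIdx_le hδ hu)
      (prod_nonneg fun w _ => by split_ifs <;> positivity))

lemma sum_discarded_le {b X δ H : ℝ} (hb : 0 ≤ b) (hX : 1 < X) (hδ : 0 < δ) {W : ℕ}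
    (hH : b * Fintype.card (Lab k) ≤ H) (hH1 : 1 ≤ H) (u v : Lab k) :
    ∑ D ∈ (admTup (Lab k) X).filter (discarded X δ W u v), b ^ #(∏ w, D w).primeFactors ≤
      Real.exp (-W) * ((Real.exp 1 * H * Real.log 4 + 1) * Real.exp 1 *
        (X / Real.log X * (1 + Real.log X) ^ (Real.exp 1 * H))) + H ^ W * (X * δ + 1) := by
  refine (sum_admTup_filter_le hb (p := fun n => W < #n.primeFactors ∨ X ≤ n * Real.exp δ)
    fun D hD h => discarded_imp hδ (mem_admSet.1 (mem_admTup.1 hD)).2.1.ne_zero h).trans ?_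
  have hH0 : 0 ≤ H := by linarith
  have hbV : 0 ≤ b * Fintype.card (Lab k) := by positivity
  set T := (admSet X).filter fun n : ℕ => W < #n.primeFactors ∨ X ≤ n * Real.exp δ
  rw [← sum_filter_add_sum_filter_not T fun n => W < #n.primeFactors]
  refine add_le_add ?_ ?_
  · have h1 : ∑ n ∈ T.filter (fun n => W < #n.primeFactors),
        (b * Fintype.card (Lab k)) ^ #n.primeFactors ≤
        ∑ n ∈ sqfreeBelow X, Real.exp (-W) * primeProd (fun _ => Real.exp 1 * H) n := by
      refine (sum_le_sum fun n hn => ?_).trans (sum_le_sum_of_subset_of_nonneg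
        (fun n hn => (mem_filter.1 (mem_filter.1 (mem_filter.1 hn).1).1).1) fun n _ _ => ?_)
      · have hW : W ≤ #n.primeFactors := (mem_filter.1 hn).2.le
        rw [primeProd_const, mul_pow (Real.exp 1), ← mul_assoc, ← Real.exp_nat_mul, ← Real.exp_add]
        calc _ ≤ H ^ #n.primeFactors := pow_le_pow_left₀ hbV hH _
          _ ≤ _ := le_mul_of_one_le_left (by positivity) (Real.one_le_exp (by
            have : (W : ℝ) ≤ #n.primeFactors := by exact_mod_cast hW
            linarith))
      · rw [primeProd_const]; positivity
    refine h1.trans ?_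
    rw [← mul_sum]
    exact mul_le_mul_of_nonneg_left (sum_primeProd_le_rpow (by positivity)
      (fun _ _ => by positivity) (fun _ _ => le_rfl) hX) (Real.exp_pos _).le
  · set U := T.filter fun n => ¬ W < #n.primeFactors
    have hU : ∀ n ∈ U, X ≤ n * Real.exp δ ∧ (n : ℝ) < X ∧ #n.primeFactors ≤ W := by
      intro n hn
      obtain ⟨h1, h2⟩ := mem_filter.1 hn
      obtain ⟨h3, h4⟩ := mem_filter.1 h1
      exact ⟨h4.resolve_left h2, (mem_admSet.1 h3).1, not_lt.1 h2⟩
    have hsub : U ⊆ Ico ⌈X * Real.exp (-δ)⌉₊ ⌈X⌉₊ := by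
      intro n hn
      obtain ⟨h1, h2, -⟩ := hU n hn
      rw [mem_Ico]
      refine ⟨Nat.ceil_le.2 ?_, Nat.lt_ceil.2 h2⟩
      rw [Real.exp_neg, ← div_eq_mul_inv]
      exact (div_le_iff₀ (Real.exp_pos δ)).2 h1
    have hcard : (#U : ℝ) ≤ X * δ + 1 := by
      have h1 : (#U : ℝ) ≤ (⌈X⌉₊ - ⌈X * Real.exp (-δ)⌉₊ : ℕ) := by
        exact_mod_cast (card_le_card hsub).trans_eq (Nat.card_Ico _ _)
      have h2 : X * Real.exp (-δ) ≤ X := mul_le_of_le_one_right (by linarith)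
        (Real.exp_le_one_iff.2 (by linarith))
      rw [Nat.cast_sub (Nat.ceil_le_ceil h2)] at h1
      have h3 := Nat.ceil_lt_add_one (by linarith : 0 ≤ X)
      have h4 := Nat.le_ceil (X * Real.exp (-δ))
      have h5 : 1 - δ ≤ Real.exp (-δ) := by have := Real.add_one_le_exp (-δ); linarith
      have h6 : X * (1 - δ) ≤ X * Real.exp (-δ) := mul_le_mul_of_nonneg_left h5 (by linarith)
      linarith
    calc _ ≤ ∑ n ∈ U, H ^ W := sum_le_sum fun n hn =>
          (pow_le_pow_left₀ hbV hH _).trans (pow_le_pow_right₀ hH1 (hU n hn).2.2)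
      _ = #U * H ^ W := by rw [sum_const, nsmul_eq_mul]
      _ ≤ (X * δ + 1) * H ^ W := mul_le_mul_of_nonneg_right hcard (by positivity)
      _ = _ := mul_comm _ _

end

lemma pow_ceil_mul_log_le {G B L : ℝ} (hG : 1 ≤ G) (hB : 0 ≤ B) (hL : 1 ≤ L) :
    G ^ ⌈B * Real.log L⌉₊ ≤ G * L ^ (B * Real.log G) := by
  have hG0 : 0 < G := by linarith
  have hL0 : 0 < L := by linarith
  have h1 := (Nat.ceil_lt_add_one (mul_nonneg hB (Real.log_nonneg hL))).le
  calc G ^ ⌈B * Real.log L⌉₊ = G ^ (⌈B * Real.log L⌉₊ : ℝ) := (Real.rpow_natCast _ _).symm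
    _ ≤ G ^ (B * Real.log L + 1) := Real.rpow_le_rpow_of_exponent_le hG h1
    _ = _ := by
      rw [Real.rpow_add_one hG0.ne', mul_comm, Real.rpow_def_of_pos hG0, Real.rpow_def_of_pos hL0]
      ring_nf

lemma eventually_log_rpow_le (s : ℝ) : ∀ᶠ X : ℝ in atTop, Real.log X ^ s ≤ X := by
  have h := (isLittleO_log_rpow_rpow_atTop s (zero_lt_one' ℝ)).bound zero_lt_one
  filter_upwards [h, eventually_ge_atTop 1] with X h hX
  rw [Real.rpow_one, one_mul, Real.norm_of_nonneg (show 0 ≤ X by linarith), Real.norm_eq_abs] at h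
  exact (le_abs_self _).trans h

lemma eventually_le_log (c : ℝ) : ∀ᶠ X : ℝ in atTop, c ≤ Real.log X :=
  Real.tendsto_log_atTop.eventually_ge_atTop c

section
variable {k : ℕ}

lemma eventually_abs_sum_linked_le {b : ℝ} (hb : 0 ≤ b) : ∃ A > (0 : ℝ), ∃ C ≥ (0 : ℝ),
    ∀ᶠ X : ℝ in atTop, ∀ Λ : Finset (Lab k), (∃ u ∈ Λ, ∃ v ∈ Λ, Odd (linkNum u v)) →
      |∑ D ∈ (admTup (Lab k) X).filter (fun D => bigSet (Real.log X ^ A) D = Λ), summand b D| ≤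
        C * (X / Real.log X) := by
  set n := Fintype.card (Lab k)
  set H := max (b * n) 1
  set M := max b 1
  set G := M ^ 16 * 2 ^ 32 with hGdef
  set B2 := Real.exp 1 * H
  set B' := B2 * Real.log H + 1 with hB'
  set B3 := B' + 2 + M * n with hB3
  set A := 8 * B3 + B2 * Real.log G + 1 with hA
  have hH1 : 1 ≤ H := le_max_right _ _
  have hM1 : 1 ≤ M := le_max_right _ _
  have hM16 : 1 ≤ M ^ 16 := one_le_pow₀ hM1
  have hG1 : 1 ≤ G := by rw [hGdef]; nlinarith
  have hB2 : 0 ≤ B2 := by positivity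
  have hlH : 0 ≤ Real.log H := Real.log_nonneg hH1
  have hlG : 0 ≤ Real.log G := Real.log_nonneg hG1
  have hB'1 : 1 ≤ B' := by rw [hB']; nlinarith [mul_nonneg hB2 hlH]
  have hB30 : 0 < B3 := by positivity
  have hA0 : 0 < A := by positivity
  refine ⟨A, hA0, 4 * (Real.exp 1 * 2 ^ M) ^ n +
    ((Real.exp 1 * H * Real.log 4 + 1) * Real.exp 1 * 2 ^ B2 + 2 * H), by positivity, ?_⟩
  filter_upwards [eventually_gt_atTop 1, eventually_le_log (max 2 (12 * G)),
    eventually_log_rpow_le (B2 * Real.log H + 1)] with X hX hL hXL Λ hΛ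
  set L := Real.log X
  have hL2 : 2 ≤ L := (le_max_left _ _).trans hL
  have hLG : 12 * G ≤ L := (le_max_right _ _).trans hL
  have hL0 : 0 < L := by linarith
  have hL1 : 1 ≤ L := by linarith
  have hX0 : 0 < X := by linarith
  set W := ⌈B2 * Real.log L⌉₊ with hW
  have hpow : ∀ s : ℝ, 0 ≤ s → (1 + L) ^ s ≤ 2 ^ s * L ^ s := fun s hs => by
    rw [← Real.mul_rpow (by norm_num) hL0.le]
    exact Real.rpow_le_rpow (by linarith) (by linarith) hs
  have hz : 1 < L ^ A := Real.one_lt_rpow (by linarith) hA0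
  have hsmall : 12 * (M ^ W) ^ 16 * 2 ^ (32 * W) ≤ (L ^ (-B3)) ^ 8 * L ^ A := by
    have e1 : 12 * (M ^ W) ^ 16 * 2 ^ (32 * W) = 12 * G ^ W := by
      rw [hGdef, mul_pow, ← pow_mul, ← pow_mul, ← pow_mul, mul_comm W 16, mul_assoc]
    have e2 : (L ^ (-B3)) ^ 8 * L ^ A = L ^ (B2 * Real.log G) * L := by
      rw [← Real.rpow_natCast, ← Real.rpow_mul hL0.le, ← Real.rpow_add hL0,
        ← Real.rpow_add_one hL0.ne']
      congr 1
      push_cast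
      rw [hA]; ring
    rw [e1, e2]
    calc 12 * G ^ W ≤ 12 * (G * L ^ (B2 * Real.log G)) :=
          mul_le_mul_of_nonneg_left (pow_ceil_mul_log_le hG1 hB2 hL1) (by norm_num)
      _ = (12 * G) * L ^ (B2 * Real.log G) := by ring
      _ ≤ L * L ^ (B2 * Real.log G) := mul_le_mul_of_nonneg_right hLG (by positivity)
      _ = _ := mul_comm _ _
  have hδ : 0 < L ^ (-B') := by positivity
  have key : ∀ u ∈ Λ, ∀ v ∈ Λ, Even (phi u v) → Odd (phi v u) →
      |∑ D ∈ (admTup (Lab k) X).filter (fun D => bigSet (L ^ A) D = Λ), summand b D| ≤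
        (4 * (Real.exp 1 * 2 ^ M) ^ n +
    ((Real.exp 1 * H * Real.log 4 + 1) * Real.exp 1 * 2 ^ B2 + 2 * H)) * (X / L) := by
    intro u hu v hv h1 h2
    refine (abs_sum_bigSet_le (δ := L ^ (-B')) (θ := L ^ (-B3)) (W := W) hb hX hz hδ (by positivity)
      hsmall hu hv h1 h2).trans ?_
    rw [add_mul]
    refine add_le_add ?_ ?_
    · have f1 : (⌊L / L ^ (-B')⌋₊ : ℝ) + 1 ≤ 2 * L ^ (B' + 1) := by
        have e : L / L ^ (-B') = L ^ (B' + 1) := by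
          rw [Real.rpow_add_one hL0.ne', Real.rpow_neg hL0.le, div_inv_eq_mul, mul_comm]
        have h3 := Nat.floor_le (by positivity : 0 ≤ L / L ^ (-B'))
        rw [e] at h3 ⊢
        have h4 : 1 ≤ L ^ (B' + 1) := Real.one_le_rpow hL1 (by linarith)
        linarith
      have f2 : (Real.exp 1 * (1 + L) ^ M) ^ n ≤ (Real.exp 1 * 2 ^ M) ^ n * L ^ (M * n) := by
        rw [Real.rpow_mul hL0.le, Real.rpow_natCast, ← mul_pow, mul_assoc]
        exact pow_le_pow_left₀ (by positivity) (mul_le_mul_of_nonneg_left (hpow M (by linarith))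
          (by positivity)) _
      calc 2 * ((⌊L / L ^ (-B')⌋₊ : ℝ) + 1) * L ^ (-B3) * X * (Real.exp 1 * (1 + L) ^ M) ^ n
          ≤ 2 * (2 * L ^ (B' + 1)) * L ^ (-B3) * X *
            ((Real.exp 1 * 2 ^ M) ^ n * L ^ (M * n)) := by gcongr
        _ = 4 * (Real.exp 1 * 2 ^ M) ^ n * X * (L ^ (B' + 1) * L ^ (-B3) * L ^ (M * n)) := by ring
        _ = 4 * (Real.exp 1 * 2 ^ M) ^ n * X * L ^ (-1 : ℝ) := by
          rw [← Real.rpow_add hL0, ← Real.rpow_add hL0]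
          congr 2
          rw [hB3]; ring
        _ = _ := by rw [Real.rpow_neg_one]; ring
    · refine (sum_discarded_le hb hX hδ (le_max_left _ _) hH1 u v).trans ?_
      rw [add_mul _ (2 * H) (X / L)]
      refine add_le_add ?_ ?_
      · have f1 : Real.exp (-W) ≤ L ^ (-B2) := by
          rw [Real.rpow_def_of_pos hL0, Real.exp_le_exp]
          have := Nat.le_ceil (B2 * Real.log L)
          rw [← hW] at this
          linarith
        have hl4 : 0 ≤ Real.log 4 := Real.log_nonneg (by norm_num)
        calc _ ≤ L ^ (-B2) * ((Real.exp 1 * H * Real.log 4 + 1) * Real.exp 1 *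
              (X / L * (2 ^ B2 * L ^ B2))) := by
              gcongr
              exact hpow B2 hB2
          _ = (Real.exp 1 * H * Real.log 4 + 1) * Real.exp 1 * 2 ^ B2 * (X / L) *
              (L ^ (-B2) * L ^ B2) := by ring
          _ = _ := by rw [← Real.rpow_add hL0, neg_add_cancel, Real.rpow_zero, mul_one]
      · have f1 := pow_ceil_mul_log_le hH1 hB2 hL1
        rw [← hW] at f1
        have f2 : L ^ (B2 * Real.log H) ≤ X / L := by
          rw [le_div_iff₀ hL0, ← Real.rpow_add_one hL0.ne']
          exact hXL
        calc H ^ W * (X * L ^ (-B') + 1) ≤ H * L ^ (B2 * Real.log H) * (X * L ^ (-B') + 1) := by gcongr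
          _ = H * (X * (L ^ (B2 * Real.log H) * L ^ (-B')) + L ^ (B2 * Real.log H)) := by ring
          _ = H * (X / L + L ^ (B2 * Real.log H)) := by
            have e : B2 * Real.log H + -B' = -1 := by rw [hB']; ring
            rw [← Real.rpow_add hL0, e, Real.rpow_neg_one, div_eq_mul_inv]
          _ ≤ H * (X / L + X / L) := by gcongr
          _ = _ := by ring
  obtain ⟨u, hu, v, hv, hlink⟩ := hΛ
  rw [← phi_add_phi_parity] at hlink
  rcases Nat.even_or_odd (phi u v) with h | h
  · exact key u hu v hv h (by rw [add_comm] at hlink; exact (Nat.odd_add.1 hlink).2 h)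
  · exact key v hv u hu ((Nat.odd_add.1 hlink).1 h) h

end

/-- The size of the error terms. -/
def errTerm (k : ℕ) (b X z : ℝ) : ℝ :=
  X / Real.log X * (1 + Real.log X) ^ ((3 ^ k - 1) * b) *
    (1 + Real.log z) ^ (b + max b 1 * Fintype.card (Lab k))

lemma errTerm_nonneg (k : ℕ) {b X z : ℝ} (hX : 1 < X) (hz : 1 < z) : 0 ≤ errTerm k b X z := by
  have := Real.log_pos hX
  have := Real.log_pos hz
  rw [errTerm]; positivity

lemma one_le_three_pow_sub_one {k : ℕ} (hk : 1 ≤ k) : (1 : ℝ) ≤ 3 ^ k - 1 := by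
  have : (3 : ℝ) ^ 1 ≤ 3 ^ k := pow_le_pow_right₀ (by norm_num) hk
  linarith

/-- Error terms coming from families whose entries outside `Λ` are small. -/
lemma exists_abs_sum_smallTup_le {k : ℕ} (hk : 1 ≤ k) {b : ℝ} (hb : 0 ≤ b) : ∃ C ≥ (0 : ℝ),
    ∀ X z : ℝ, 1 < X → 1 < z → z ^ Fintype.card (Lab k) ≤ √X →
    ∀ (Λ : Finset (Lab k)) (Y : Finset (Lab k → ℕ)), Y ⊆ smallTup Λ z →
    ∀ (F : (Lab k → ℕ) → ℝ) (β : ℝ), 0 ≤ β → β ≤ 1 →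
    ∀ (Ψ : ℕ → (Lab k → ℕ) → ℕ →*₀ ℝ), (∀ i, ∀ y ∈ Y, ∀ n, |Ψ i y n| ≤ 1) →
    ∀ B : ℕ, 1 ≤ B → (B : ℝ) ≤ 8 * z ^ (2 * Fintype.card (Lab k)) →
    (∀ i, ∀ y ∈ Y, ∀ N, |∑ n ∈ range N, Ψ i y n| ≤ B) →
    (∀ y ∈ Y, ∀ n, (∏ v, y v) * n ∈ admSet X → |∑ x ∈ tupOn Λ n, F (y * x)| ≤
      ∑ i ∈ range 2, primeProd (fun p => 3 ^ k - 1 + β * Ψ i y p) n) →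
    |∑ y ∈ Y, ∑ n ∈ (sqfreeBelow X).filter (fun n => (∏ v, y v) * n ∈ admSet X),
        ∑ x ∈ tupOn Λ n, b ^ #(∏ v, (y * x) v).primeFactors * F (y * x)| ≤ C * errTerm k b X z := by
  set n := Fintype.card (Lab k)
  have hK := one_le_three_pow_sub_one hk
  have hl4 : 0 ≤ Real.log 4 := Real.log_nonneg (by norm_num)
  refine ⟨2 * (2 * ((3 ^ k * b * Real.log 4 + 1) * Real.exp 1) * (2 * n + 6) ^ b * Real.exp 1 ^ n),
    by positivity, ?_⟩
  intro X z hX hz hzX Λ Y hY F β hβ0 hβ1 Ψ h1 B hB hB8 hS hF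
  have hlX := Real.log_pos hX
  have hlz := Real.log_pos hz
  have hmul : ∀ i, ∀ y ∈ Y, ∀ p, -β ≤ β * Ψ i y p := fun i y hy p => by
    have := (abs_le.1 (h1 i y hy p)).1
    nlinarith
  have h0 : ∀ i, ∀ y ∈ Y, ∀ p, 0 ≤ 3 ^ k - 1 + β * Ψ i y p := fun i y hy p => by
    linarith [hmul i y hy p]
  refine (abs_sum_admTup_le Λ hb (fun i _ y hy p _ => h0 i y hy p) hF).trans ?_
  have hlog : Real.log B + 3 ≤ (2 * n + 6) * (1 + Real.log z) := by
    have hl8 : Real.log 8 ≤ 3 := by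
      rw [show (8 : ℝ) = 2 ^ 3 by norm_num, Real.log_pow]
      have := Real.log_two_lt_d9
      push_cast; linarith
    have : Real.log B ≤ Real.log (8 * z ^ (2 * n)) := Real.log_le_log (by positivity) hB8
    rw [Real.log_mul (by norm_num) (by positivity), Real.log_pow] at this
    push_cast at this
    nlinarith [Nat.cast_nonneg (α := ℝ) n]
  have hlB : 0 ≤ Real.log B := Real.log_nonneg (by exact_mod_cast hB)
  have main : ∀ i, ∑ y ∈ Y, b ^ #(∏ v, y v).primeFactors *
      ∑ m ∈ sqfreeBelow (X / (∏ v, y v : ℕ)), primeProd (fun p => b * (3 ^ k - 1 + β * Ψ i y p)) m ≤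
      2 * ((3 ^ k * b * Real.log 4 + 1) * Real.exp 1) * (2 * n + 6) ^ b * Real.exp 1 ^ n *
        errTerm k b X z := by
    intro i
    refine (sum_smallTup_le Λ hb (mul_nonneg hb hβ0) (mul_nonneg (by linarith : 0 ≤ (3 : ℝ) ^ k - 1) hb)
      hX hz hzX hY (h1 i) hB (hS i) (h := fun y p => b * (3 ^ k - 1 + β * Ψ i y p))
      (fun y hy p _ => mul_nonneg hb (h0 i y hy p)) fun y hy p _ => le_of_eq (by ring)).trans ?_
    have e1 : (Real.log B + 3) ^ (b * β) ≤ (2 * n + 6) ^ b * (1 + Real.log z) ^ b := by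
      rw [← Real.mul_rpow (by positivity) (by positivity)]
      refine (Real.rpow_le_rpow_of_exponent_le (by linarith) ?_).trans
        (Real.rpow_le_rpow (by positivity) hlog hb)
      nlinarith
    have e2 : (3 ^ k - 1) * b + b * β ≤ 3 ^ k * b := by nlinarith
    have e3 : (Real.exp 1 * (1 + Real.log z) ^ max b 1) ^ n =
        Real.exp 1 ^ n * (1 + Real.log z) ^ (max b 1 * n) := by
      rw [mul_pow, Real.rpow_mul (by positivity), Real.rpow_natCast]
    have e4 : 0 ≤ (3 ^ k - 1) * b := mul_nonneg (by linarith) hb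
    rw [e3, errTerm, Real.rpow_add (by positivity)]
    calc _ ≤ 2 * ((3 ^ k * b * Real.log 4 + 1) * Real.exp 1) *
          (X / Real.log X * ((1 + Real.log X) ^ ((3 ^ k - 1) * b) *
            ((2 * n + 6) ^ b * (1 + Real.log z) ^ b))) *
          (Real.exp 1 ^ n * (1 + Real.log z) ^ (max b 1 * n)) := by gcongr
      _ = _ := by ring
  refine (sum_le_sum fun i _ => main i).trans (le_of_eq ?_)
  rw [sum_const, card_range]
  ring

lemma exists_sum_trivial_le {k : ℕ} (hk : 1 ≤ k) {b : ℝ} (hb : 0 ≤ b) : ∃ C ≥ (0 : ℝ),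
    ∀ X z : ℝ, 1 < X → 1 < z → z ^ Fintype.card (Lab k) ≤ √X →
    ∀ Λ : Finset (Lab k), #Λ < 3 ^ k →
      ∑ D ∈ admSmall Λ X z, b ^ #(∏ v, D v).primeFactors ≤ C * errTerm k b X z := by
  obtain ⟨C, hC, h⟩ := exists_abs_sum_smallTup_le hk hb
  refine ⟨C, hC, fun X z hX hz hzX Λ hΛ => ?_⟩
  have hz1 : (1 : ℝ) ≤ z ^ (2 * Fintype.card (Lab k)) := one_le_pow₀ hz.le
  have := h X z hX hz hzX Λ _ subset_rfl (fun _ => 1) 0 le_rfl zero_le_one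
    (fun _ _ => charHom 1 1) (fun _ _ _ _ => abs_charHom_le_one _ _ _) 4 (by norm_num)
    (by push_cast; linarith) (fun _ _ _ N => abs_sum_chi4_le N) ?_
  · refine le_trans (le_of_eq ?_) ((le_abs_self _).trans this)
    rw [sum_admTup_split]
    simp only [mul_one]
  · intro y _ n hn
    have hsq : Squarefree n := (mem_admSet.1 hn).2.1.squarefree_of_dvd (Dvd.intro_left _ rfl)
    have hle : (#Λ : ℝ) ≤ 3 ^ k - 1 := by
      have : ((#Λ + 1 : ℕ) : ℝ) ≤ (3 ^ k : ℕ) := by exact_mod_cast hΛ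
      push_cast at this
      linarith
    simp only [sum_const, nsmul_eq_mul, mul_one, card_tupOn Λ hsq, zero_mul, add_zero,
      primeProd_const, card_range]
    rw [abs_of_nonneg (by positivity)]
    have h1 := pow_le_pow_left₀ (Nat.cast_nonneg _) hle #n.primeFactors
    have h2 : 0 ≤ ((3 : ℝ) ^ k - 1) ^ #n.primeFactors := by
      have := one_le_three_pow_sub_one hk
      positivity
    push_cast
    linarith

/-- On the divisors of `N`, `f` is a bounded constant times `g` times a power of `χ₄`. -/
def IsTwist (N : ℕ) (g f : ℕ → ℝ) : Prop :=
  ∃ κ : ℝ, |κ| ≤ 1 ∧ ∃ c : ℕ, ∀ m, m ∣ N → f m = κ * (g m * chi4 m ^ c)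

namespace IsTwist
variable {N : ℕ} {f g f' g' : ℕ → ℝ}

lemma mul (h : IsTwist N g f) (h' : IsTwist N g' f') :
    IsTwist N (fun m => g m * g' m) (fun m => f m * f' m) := by
  obtain ⟨κ, hκ, c, hc⟩ := h
  obtain ⟨κ', hκ', c', hc'⟩ := h'
  refine ⟨κ * κ', ?_, c + c', fun m hm => ?_⟩
  · rw [abs_mul]; exact mul_le_one₀ hκ (abs_nonneg _) hκ'
  · beta_reduce; rw [hc m hm, hc' m hm, pow_add]; ring

lemma one : IsTwist N (fun _ => 1) (fun _ => 1) := ⟨1, by simp, 0, fun m _ => by simp⟩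

lemma pow (h : IsTwist N g f) (a : ℕ) : IsTwist N (fun m => g m ^ a) (fun m => f m ^ a) := by
  induction a with
  | zero => simpa using one
  | succ a ih => simpa only [pow_succ] using ih.mul h

lemma prod {ι : Type*} (s : Finset ι) {g f : ι → ℕ → ℝ} (h : ∀ i ∈ s, IsTwist N (g i) (f i)) :
    IsTwist N (fun m => ∏ i ∈ s, g i m) (fun m => ∏ i ∈ s, f i m) := by
  induction s using Finset.induction_on with
  | empty => simpa using one
  | insert i s hi ih =>
    simp only [prod_insert hi]
    exact (h i (mem_insert_self i s)).mul (ih fun j hj => h j (mem_insert_of_mem hj))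

lemma const {κ : ℝ} (hκ : |κ| ≤ 1) : IsTwist N (fun _ => 1) (fun _ => κ) :=
  ⟨κ, hκ, 0, fun m _ => by simp⟩

lemma jac_left (r : ℕ) : IsTwist N (fun m => jac m r) (fun m => jac m r) :=
  ⟨1, by simp, 0, fun m _ => by simp⟩

lemma jac_right (hN : Odd N) {r : ℕ} (hr : Odd r) :
    IsTwist N (fun m => jac m r) (fun m => jac r m) := by
  refine ⟨1, by simp, if r % 4 = 3 then 1 else 0, fun m hm => ?_⟩
  have hm2 := hN.of_dvd_nat hm
  beta_reduce
  rw [jac_reciprocity hm2 hr]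
  have := Nat.odd_iff.1 hm2
  by_cases h : r % 4 = 3
  · rcases (by omega : m % 4 = 1 ∨ m % 4 = 3) with h1 | h1
    · simp [h, h1, chi4_of_mod.1 h1]
    · simp [h, h1, chi4_of_mod.2.1 h1]
  · simp [h]

lemma jac_left_div (hN : N ≠ 0) {r : ℕ} (hNr : Nat.Coprime N r) :
    IsTwist N (fun m => jac m r) (fun m => jac (N / m) r) := by
  refine ⟨jac N r, abs_jac_le_one _ _, 0, fun m hm => ?_⟩
  obtain ⟨q, rfl⟩ := hm
  have hm0 : 0 < m := Nat.pos_of_ne_zero fun h => hN (by simp [h])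
  beta_reduce
  rw [Nat.mul_div_cancel_left _ hm0, jac_mul_left]
  have := jac_sq_eq_one (Nat.Coprime.coprime_mul_right hNr)
  linear_combination -jac q r * this

lemma jac_right_div (hN : Odd N) {r : ℕ} (hr : Odd r) (hNr : Nat.Coprime N r) :
    IsTwist N (fun m => jac m r) (fun m => jac r (N / m)) := by
  have h : IsTwist N (fun m => jac m r) (fun m => jac r N * jac r m) := by
    simpa using (const (N := N) (abs_jac_le_one r N)).mul (jac_right hN hr)
  obtain ⟨κ, hκ, c, hc⟩ := h
  refine ⟨κ, hκ, c, fun m hm => ?_⟩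
  rw [← hc m hm]
  beta_reduce
  obtain ⟨q, rfl⟩ := hm
  have h0 := hN.pos.ne'
  have hm0 : m ≠ 0 := fun h => h0 (by simp [h])
  have hq0 : q ≠ 0 := fun h => h0 (by simp [h])
  rw [Nat.mul_div_cancel_left _ (Nat.pos_of_ne_zero hm0), jac_mul_right _ hm0 hq0]
  have := jac_sq_eq_one (Nat.Coprime.coprime_mul_right hNr).symm
  linear_combination -jac r q * this

lemma cross (hN : Odd N) (hsq : Squarefree N) {a b : ℕ} (hab : Even (a + b)) :
    IsTwist N (fun _ => 1) (fun m => jac m (N / m) ^ a * jac (N / m) m ^ b) := by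
  refine ⟨1, by simp, if Odd a ∧ N % 4 = 1 then 1 else 0, fun m hm => ?_⟩
  obtain ⟨q, rfl⟩ := hm
  have h0 := hN.pos.ne'
  have hm0 : m ≠ 0 := fun h => h0 (by simp [h])
  beta_reduce
  rw [Nat.mul_div_cancel_left _ (Nat.pos_of_ne_zero hm0)]
  have hc := Nat.coprime_of_squarefree_mul hsq
  have e1 := jac_sq_eq_one hc
  have e2 := jac_sq_eq_one hc.symm
  obtain ⟨hmo, hqo⟩ := Nat.odd_mul.1 hN
  rw [Nat.even_add] at hab
  by_cases ha : Odd a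
  · have hb : Odd b := by rw [← Nat.not_even_iff_odd, ← hab]; exact Nat.not_even_iff_odd.2 ha
    obtain ⟨a, rfl⟩ := ha
    obtain ⟨b, rfl⟩ := hb
    have e3 := jac_reciprocity hmo hqo
    rw [pow_succ, pow_mul, pow_two, e1, one_pow, one_mul, pow_succ, pow_mul, pow_two, e2, one_pow,
      one_mul, e3]
    have e4 : jac m q * ((if m % 4 = 3 ∧ q % 4 = 3 then -1 else 1) * jac m q) =
        if m % 4 = 3 ∧ q % 4 = 3 then -1 else 1 := by rw [mul_left_comm, e1, mul_one]
    rw [e4]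
    have h1 := Nat.odd_iff.1 hmo
    have h2 := Nat.odd_iff.1 hqo
    have h3 : m * q % 4 = (m % 4) * (q % 4) % 4 := Nat.mul_mod _ _ _
    rcases (by omega : m % 4 = 1 ∨ m % 4 = 3) with h4 | h4 <;>
      rcases (by omega : q % 4 = 1 ∨ q % 4 = 3) with h5 | h5 <;>
      simp [h3, h4, h5, chi4_of_mod.1, chi4_of_mod.2.1]
  · have ha' := Nat.not_odd_iff_even.1 ha
    obtain ⟨b, rfl⟩ := even_iff_two_dvd.1 (hab.1 ha')
    rw [if_neg fun h => ha h.1]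
    obtain ⟨a, rfl⟩ := even_iff_two_dvd.1 ha'
    simp [pow_mul, pow_two, e1, e2]

end IsTwist

section
variable {k : ℕ}

/-- The parity governing the interaction of an entry at `w` with two moving entries. -/
def pairParity (u v w : Lab k) : ℕ := phi w u + phi u w + (phi w v + phi v w)

/-- The modulus of the character governing the interaction with two moving entries. -/
def pairModulus (u v : Lab k) (y : Lab k → ℕ) : ℕ := ∏ w, if Odd (pairParity u v w) then y w else 1

lemma jac_prod_pow_eq {ρ : Lab k → ℕ} (hρ : ∀ w, ρ w ≠ 0) (e : Lab k → ℕ) {m : ℕ}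
    (hm : ∀ w, Nat.Coprime m (ρ w)) :
    ∏ w, jac m (ρ w) ^ e w = jac m (∏ w, if Odd (e w) then ρ w else 1) := by
  rw [jac_prod_right _ _ fun w _ => by split_ifs; exacts [hρ w, one_ne_zero]]
  refine prod_congr rfl fun w _ => ?_
  have h2 := jac_sq_eq_one (hm w)
  split_ifs with h
  · obtain ⟨a, ha⟩ := h
    rw [ha, pow_succ, pow_mul, pow_two, h2, one_pow, one_mul]
  · obtain ⟨a, ha⟩ := even_iff_two_dvd.1 (Nat.not_odd_iff_even.1 h)
    rw [ha, pow_mul, pow_two, h2, one_pow, jac_one_right]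

lemma exists_jacForm_insertTwo_eq {ρ : Lab k → ℕ} (u v : Lab k) {N : ℕ}
    (hsq : Squarefree ((∏ w, ρ w) * N)) (hodd : Odd ((∏ w, ρ w) * N))
    (he : Even (phi u v + phi v u)) : ∃ κ : ℝ, |κ| ≤ 1 ∧ ∃ c < 2, ∀ m, m ∣ N →
      jacForm (insertTwo ρ u v m (N / m)) (insertTwo ρ u v m (N / m)) =
        κ * charHom (pairModulus u v ρ) c m := by
  obtain ⟨hρo, hNo⟩ := Nat.odd_mul.1 hodd
  have hρw : ∀ w, ρ w ∣ ∏ w, ρ w := fun w => dvd_prod_of_mem ρ (mem_univ w)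
  have hρ2 : ∀ w, Odd (ρ w) := fun w => hρo.of_dvd_nat (hρw w)
  have hρ0 : ∀ w, ρ w ≠ 0 := fun w => (hρ2 w).pos.ne'
  have hN0 := hNo.pos.ne'
  have hcop : ∀ w, Nat.Coprime N (ρ w) := fun w =>
    (Nat.Coprime.coprime_dvd_left (hρw w) (Nat.coprime_of_squarefree_mul hsq)).symm
  have hNsq : Squarefree N := hsq.squarefree_of_dvd (Dvd.intro_left _ rfl)
  have key : IsTwist N (fun m => ∏ w, jac m (ρ w) ^ pairParity u v w)
      (fun m => jacForm ρ ρ * (jacWeight ρ u m * jacWeight ρ v (N / m)) *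
        (jac m (N / m) ^ phi u v * jac (N / m) m ^ phi v u)) := by
    have t1 : IsTwist N (fun m => (∏ w, jac m (ρ w) ^ phi w u) * ∏ w, jac m (ρ w) ^ phi u w)
        (fun m => jacWeight ρ u m) := by
      simp only [jacWeight, jacForm_single_left, jacForm_single_right]
      exact (IsTwist.prod _ fun w _ => (IsTwist.jac_right hNo (hρ2 w)).pow _).mul
        (IsTwist.prod _ fun w _ => (IsTwist.jac_left _).pow _)
    have t2 : IsTwist N (fun m => (∏ w, jac m (ρ w) ^ phi w v) * ∏ w, jac m (ρ w) ^ phi v w)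
        (fun m => jacWeight ρ v (N / m)) := by
      simp only [jacWeight, jacForm_single_left, jacForm_single_right]
      exact (IsTwist.prod _ fun w _ => (IsTwist.jac_right_div hNo (hρ2 w) (hcop w)).pow _).mul
        (IsTwist.prod _ fun w _ => (IsTwist.jac_left_div hN0 (hcop w)).pow _)
    have t := ((IsTwist.const (N := N) (abs_jacForm_le_one ρ ρ)).mul (t1.mul t2)).mul
      (IsTwist.cross hNo hNsq he)
    convert t using 2 with m
    simp only [pairParity, pow_add, prod_mul_distrib]
    ring
  obtain ⟨κ, hκ, c, hc⟩ := key
  beta_reduce at hc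
  refine ⟨κ, hκ, c % 2, Nat.mod_lt _ two_pos, fun m hm => ?_⟩
  have hm0 : m ≠ 0 := ne_zero_of_dvd_ne_zero hN0 hm
  have hq0 : N / m ≠ 0 := (Nat.div_pos (Nat.le_of_dvd hNo.pos hm) (Nat.pos_of_ne_zero hm0)).ne'
  rw [jacForm_insertTwo hρ0 u v hm0 hq0, hc m hm, charHom_apply hm0, pairModulus,
    jac_prod_pow_eq hρ0 _ fun w => Nat.Coprime.coprime_dvd_left hm (hcop w)]
  congr 2
  have h4 : chi4 m ^ 2 = 1 := by
    have := Nat.odd_iff.1 (hNo.of_dvd_nat hm)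
    rcases (by omega : m % 4 = 1 ∨ m % 4 = 3) with h | h
    · rw [chi4_of_mod.1 h, one_pow]
    · rw [chi4_of_mod.2.1 h]; norm_num
  conv_lhs => rw [← Nat.div_add_mod c 2, pow_add, pow_mul, h4, one_pow, one_mul]

/-- Summing over families supported on `Λ` by first fixing the entries away from two labels. -/
lemma sum_tupOn_insertTwo {Λ : Finset (Lab k)} {u v : Lab k} (huv : u ≠ v) (hu : u ∈ Λ) (hv : v ∈ Λ)
    {n : ℕ} (hn : n ≠ 0) (G : (Lab k → ℕ) → ℝ) : ∑ x ∈ tupOn Λ n, G x =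
      ∑ N ∈ n.divisors, ∑ ρ ∈ tupOn ((Λ.erase u).erase v) (n / N), ∑ m ∈ N.divisors,
        G (insertTwo ρ u v m (N / m)) := by
  have hsig : ∀ N ∈ n.divisors, ∑ ρ ∈ tupOn ((Λ.erase u).erase v) (n / N), ∑ m ∈ N.divisors,
      G (insertTwo ρ u v m (N / m)) = ∑ q ∈ tupOn ((Λ.erase u).erase v) (n / N) ×ˢ N.divisors,
        G (insertTwo q.1 u v q.2 (N / q.2)) := fun N _ => by rw [sum_product]
  rw [sum_congr rfl hsig, sum_sigma']
  have hdiv : ∀ {N : ℕ}, N ∈ n.divisors → N ≠ 0 ∧ n / N ≠ 0 := fun {N} hN => by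
    have h := Nat.mem_divisors.1 hN
    have hN0 := ne_zero_of_dvd_ne_zero hn h.1
    exact ⟨hN0, (Nat.div_pos (Nat.le_of_dvd (Nat.pos_of_ne_zero hn) h.1) (Nat.pos_of_ne_zero hN0)).ne'⟩
  have hone : ∀ {N : ℕ}, N ∈ n.divisors → ∀ ρ ∈ tupOn ((Λ.erase u).erase v) (n / N), ρ u = 1 ∧ ρ v = 1 :=
    fun {N} hN ρ hρ => by
      have := ((mem_tupOn (hdiv hN).2).1 hρ).2
      exact ⟨this u (by simp), this v (by simp)⟩
  symm
  refine sum_bij' (fun q _ => insertTwo q.2.1 u v q.2.2 (q.1 / q.2.2))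
    (fun x _ => ⟨x u * x v, (fun w => if w = u ∨ w = v then 1 else x w, x u)⟩) ?_ ?_ ?_ ?_ ?_
  · rintro ⟨N, ρ, m⟩ hq
    simp only [mem_sigma, mem_product] at hq
    obtain ⟨hN, hρ, hm⟩ := hq
    have h1 := (mem_tupOn (hdiv hN).2).1 hρ
    rw [mem_tupOn hn]
    refine ⟨?_, fun w hw => ?_⟩
    · rw [prod_insertTwo, h1.1, mul_assoc, Nat.mul_div_cancel' (Nat.mem_divisors.1 hm).1,
        Nat.div_mul_cancel (Nat.mem_divisors.1 hN).1]
    · rw [insertTwo_of_ne (by rintro rfl; exact hw hu) (by rintro rfl; exact hw hv)]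
      exact h1.2 w (by simp [hw])
  · intro x hx
    obtain ⟨h1, h2⟩ := (mem_tupOn hn).1 hx
    have hdvd : x u * x v ∣ n := h1 ▸ mul_dvd_prod_of_ne huv
    have hN : x u * x v ∈ n.divisors := Nat.mem_divisors.2 ⟨hdvd, hn⟩
    simp only [mem_sigma, mem_product]
    refine ⟨hN, ?_, Nat.mem_divisors.2 ⟨Dvd.intro _ rfl, (hdiv hN).1⟩⟩
    rw [mem_tupOn (hdiv hN).2]
    refine ⟨?_, fun w hw => ?_⟩
    · rw [eq_comm, Nat.div_eq_iff_eq_mul_left (Nat.pos_of_ne_zero (hdiv hN).1) hdvd, ← h1,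
        ← mul_prod_erase univ x (mem_univ u), ← mul_prod_erase (univ.erase u) x
          (mem_erase.2 ⟨huv.symm, mem_univ v⟩), ← mul_prod_erase univ _ (mem_univ u),
        ← mul_prod_erase (univ.erase u) _ (mem_erase.2 ⟨huv.symm, mem_univ v⟩)]
      have : ∏ w ∈ (univ.erase u).erase v, (if w = u ∨ w = v then 1 else x w) =
          ∏ w ∈ (univ.erase u).erase v, x w := prod_congr rfl fun w hw => by
        simp only [mem_erase] at hw
        rw [if_neg (by tauto)]
      rw [this]
      simp
      ring
    · by_cases h : w = u ∨ w = v
      · simp [h]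
      · rw [if_neg h]
        refine h2 w fun hw' => hw ?_
        simp only [mem_erase]; tauto
  · rintro ⟨N, ρ, m⟩ hq
    simp only [mem_sigma, mem_product] at hq
    obtain ⟨hN, hρ, hm⟩ := hq
    obtain ⟨h1, h2⟩ := hone hN ρ hρ
    simp only [insertTwo_left huv h1, insertTwo_right huv h2,
      Nat.mul_div_cancel' (Nat.mem_divisors.1 hm).1]
    congr 2
    funext w
    split_ifs with h
    · rcases h with rfl | rfl
      exacts [h1.symm, h2.symm]
    · push Not at h
      rw [insertTwo_of_ne h.1 h.2]
  · intro x hx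
    obtain ⟨h1, h2⟩ := (mem_tupOn hn).1 hx
    have hu0 : x u ≠ 0 := fun h => hn (by rw [← h1]; exact prod_eq_zero (mem_univ u) h)
    simp only [Nat.mul_div_cancel_left _ (Nat.pos_of_ne_zero hu0)]
    funext w
    by_cases hwu : w = u
    · subst hwu; rw [insertTwo_left huv (by simp)]
    · by_cases hwv : w = v
      · subst hwv; rw [insertTwo_right huv (by simp)]
      · rw [insertTwo_of_ne hwu hwv, if_neg (by tauto)]
  · intro q _; rfl

lemma sum_tupOn_apply {V : Type} [Fintype V] {Λ : Finset V} {u : V} (hu : u ∈ Λ) {n : ℕ} (hn : Squarefree n)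
    (Ψ : ℕ →*₀ ℝ) : ∑ x ∈ tupOn Λ n, Ψ (x u) = primeProd (fun p => (#Λ - 1 : ℝ) + Ψ p) n := by
  have h := sum_tupOn_prod Λ hn fun w p => if w = u then Ψ p else 1
  have e : ∀ x ∈ tupOn Λ n, ∏ w ∈ Λ, primeProd (fun p => if w = u then Ψ p else 1) (x w) = Ψ (x u) := by
    intro x hx
    obtain ⟨h1, -⟩ := (mem_tupOn hn.ne_zero).1 hx
    rw [prod_eq_single_of_mem u hu fun w _ hw => by simp [hw, primeProd]]
    simp only [if_true, primeProd]
    rw [← map_prod, Nat.prod_primeFactors_of_squarefree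
      (squarefree_of_squarefree_prod (h1.symm ▸ hn) u)]
  rw [← sum_congr rfl e, h]
  refine congrArg (primeProd · n) (funext fun p => ?_)
  rw [← add_sum_erase _ _ hu, if_pos rfl, sum_congr rfl (g := fun _ => (1 : ℝ))
    (fun w hw => if_neg (mem_erase.1 hw).1)]
  rw [sum_const, card_erase_of_mem hu, nsmul_eq_mul, mul_one,
    Nat.cast_sub (card_pos.2 ⟨u, hu⟩)]
  push_cast; ring

lemma sum_divisors_eq_primeProd {N : ℕ} (hN : Squarefree N) (Ψ : ℕ →*₀ ℝ) :
    ∑ m ∈ N.divisors, Ψ m = primeProd (fun p => 1 + Ψ p) N := by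
  let f : ArithmeticFunction ℝ := ⟨Ψ, map_zero Ψ⟩
  have hf : f.IsMultiplicative := ⟨map_one Ψ, fun {m n} _ => map_mul Ψ m n⟩
  exact (hf.prodPrimeFactors_one_add_of_squarefree hN).symm

lemma even_pairParity_iff (u v w : Lab k) :
    Even (pairParity u v w) ↔ (Even (linkNum w u) ↔ Even (linkNum w v)) := by
  rw [pairParity, Nat.even_add, ← Nat.not_odd_iff_even, phi_add_phi_parity, Nat.not_odd_iff_even,
    ← Nat.not_odd_iff_even (n := phi w v + phi v w), phi_add_phi_parity, Nat.not_odd_iff_even]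

/-- Outside a maximal unlinked set every label is detected by a pair from the set. -/
lemma exists_pairParity_odd {σ : Fin k → Bool} {w : Lab k} (hw : w ∉ maxUnlinked σ) :
    ∃ u ∈ maxUnlinked σ, ∃ v ∈ maxUnlinked σ, u ≠ v ∧ Odd (pairParity u v w) := by
  rw [mem_maxUnlinked] at hw
  push Not at hw
  obtain ⟨j0, hj0⟩ := hw
  have h3 : ∀ i : Fin 3, i + 1 ≠ i := by decide
  refine ⟨fun j => ((w j).1, σ j), mem_maxUnlinked.2 fun j => rfl,
    fun j => (if j = j0 then (w j).1 + 1 else (w j).1, σ j), mem_maxUnlinked.2 fun j => rfl, ?_, ?_⟩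
  · intro h
    have := congrArg Prod.fst (congrFun h j0)
    simp at this
  · rw [← Nat.not_even_iff_odd, even_pairParity_iff]
    have e1 : linkNum w (fun j => ((w j).1, σ j)) = 0 := by simp [linkNum]
    have e2 : linkNum w (fun j => (if j = j0 then (w j).1 + 1 else (w j).1, σ j)) = 1 := by
      rw [linkNum, sum_eq_single j0]
      · rw [if_pos]
        exact ⟨by simp, hj0⟩
      · intro j _ hj
        simp [hj]
      · simp
    rw [e1, e2]; simp

lemma even_pairParity_of_mem {σ : Fin k → Bool} {u v w : Lab k} (hu : u ∈ maxUnlinked σ)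
    (hv : v ∈ maxUnlinked σ) (hw : w ∈ maxUnlinked σ) : Even (pairParity u v w) := by
  rw [even_pairParity_iff, linkNum_eq_zero hw hu, linkNum_eq_zero hw hv]

lemma sum_divisors_charHom_nonneg {N : ℕ} (hN : Squarefree N) (Q c : ℕ) :
    0 ≤ ∑ m ∈ N.divisors, charHom Q c m := by
  rw [sum_divisors_eq_primeProd hN]
  exact primeProd_nonneg (fun p _ => by linarith [(abs_le.1 (abs_charHom_le_one Q c p)).1]) N

lemma abs_sum_tupOn_maxUnlinked_le {σ : Fin k → Bool} {u v : Lab k} (hu : u ∈ maxUnlinked σ)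
    (hv : v ∈ maxUnlinked σ) (huv : u ≠ v) {y : Lab k → ℕ} {n : ℕ}
    (hsq : Squarefree ((∏ w, y w) * n)) (hodd : Odd ((∏ w, y w) * n)) :
    |∑ x ∈ tupOn (maxUnlinked σ) n, jacForm (y * x) (y * x)| ≤
      ∑ c ∈ range 2, primeProd (fun p => 3 ^ k - 1 + charHom (pairModulus u v y) c p) n := by
  have hn : Squarefree n := hsq.squarefree_of_dvd (Dvd.intro_left _ rfl)
  set Q := pairModulus u v y
  have hrhs : ∀ c, primeProd (fun p => 3 ^ k - 1 + charHom Q c p) n =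
      ∑ N ∈ n.divisors, ∑ ρ ∈ tupOn (((maxUnlinked σ).erase u).erase v) (n / N),
        ∑ m ∈ N.divisors, charHom Q c m := by
    intro c
    have h := sum_tupOn_apply hu hn (charHom Q c)
    rw [card_maxUnlinked] at h
    push_cast at h
    rw [← h, sum_tupOn_insertTwo huv hu hv hn.ne_zero]
    refine sum_congr rfl fun N hN => sum_congr rfl fun ρ hρ => sum_congr rfl fun m _ => ?_
    have hd := Nat.mem_divisors.1 hN
    have h0 : n / N ≠ 0 :=
      (Nat.div_pos (Nat.le_of_dvd (Nat.pos_of_ne_zero hd.2) hd.1)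
        (Nat.pos_of_ne_zero (ne_zero_of_dvd_ne_zero hd.2 hd.1))).ne'
    rw [insertTwo_left huv (((mem_tupOn h0).1 hρ).2 u (by simp))]
  rw [sum_congr rfl fun c _ => hrhs c, Finset.sum_comm, sum_tupOn_insertTwo huv hu hv hn.ne_zero]
  refine (abs_sum_le_sum_abs _ _).trans (sum_le_sum fun N hN => ?_)
  rw [Finset.sum_comm (s := range 2)]
  refine (abs_sum_le_sum_abs _ _).trans (sum_le_sum fun ρ hρ => ?_)
  have hd := Nat.mem_divisors.1 hN
  have h0 : n / N ≠ 0 :=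
    (Nat.div_pos (Nat.le_of_dvd (Nat.pos_of_ne_zero hd.2) hd.1)
      (Nat.pos_of_ne_zero (ne_zero_of_dvd_ne_zero hd.2 hd.1))).ne'
  obtain ⟨hρ1, hρ2⟩ := (mem_tupOn h0).1 hρ
  have hprod : (∏ w, (y * ρ) w) * N = (∏ w, y w) * n := by
    simp only [Pi.mul_apply, prod_mul_distrib]
    rw [hρ1, mul_assoc, Nat.div_mul_cancel hd.1]
  have hQ : pairModulus u v (y * ρ) = Q := by
    refine prod_congr rfl fun w _ => ?_
    by_cases hw : w ∈ maxUnlinked σ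
    · rw [if_neg, if_neg] <;> exact Nat.not_odd_iff_even.2 (even_pairParity_of_mem hu hv hw)
    · rw [Pi.mul_apply, hρ2 w (by simp [hw]), mul_one]
  have hph : Even (phi u v + phi v u) := by
    have := even_pairParity_of_mem hu hv hu
    simpa [pairParity, phi_self] using this
  obtain ⟨κ, hκ, c, hc, h⟩ := exists_jacForm_insertTwo_eq (ρ := y * ρ) u v (N := N)
    (hprod ▸ hsq) (hprod ▸ hodd) hph
  have hNsq : Squarefree N := hn.squarefree_of_dvd hd.1
  have e : ∑ m ∈ N.divisors, jacForm (y * insertTwo ρ u v m (N / m)) (y * insertTwo ρ u v m (N / m)) =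
      κ * ∑ m ∈ N.divisors, charHom Q c m := by
    rw [mul_sum]
    refine sum_congr rfl fun m hm => ?_
    rw [← hQ, ← h m (Nat.mem_divisors.1 hm).1]
    simp only [insertTwo, mul_assoc]
  rw [e, abs_mul, abs_of_nonneg (sum_divisors_charHom_nonneg hNsq Q c)]
  refine (mul_le_of_le_one_left (sum_divisors_charHom_nonneg hNsq Q c) hκ).trans ?_
  exact single_le_sum (f := fun c => ∑ m ∈ N.divisors, charHom Q c m)
    (fun c _ => sum_divisors_charHom_nonneg hNsq Q c) (mem_range.2 hc)

lemma pairModulus_dvd (u v : Lab k) (y : Lab k → ℕ) : pairModulus u v y ∣ ∏ w, y w :=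
  prod_dvd_prod_of_dvd _ _ fun w _ => by split_ifs <;> simp

/-- A common bound for the moduli of the characters attached to families of integers below `z`. -/
def moduliBound (k : ℕ) (z : ℝ) : ℕ := 4 * ⌈z ^ Fintype.card (Lab k)⌉₊

lemma one_le_moduliBound {z : ℝ} (hz : 1 < z) : 1 ≤ moduliBound k z := by
  have : 0 < ⌈z ^ Fintype.card (Lab k)⌉₊ := Nat.ceil_pos.2 (by positivity)
  rw [moduliBound]; omega

lemma moduliBound_le {z : ℝ} (hz : 1 < z) :
    (moduliBound k z : ℝ) ≤ 8 * z ^ (2 * Fintype.card (Lab k)) := by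
  set n := Fintype.card (Lab k)
  have h1 : 1 ≤ z ^ n := one_le_pow₀ hz.le
  have h2 := (Nat.ceil_lt_add_one (zero_le_one.trans h1)).le
  rw [moduliBound, two_mul, pow_add]
  push_cast
  nlinarith

lemma four_mul_le_moduliBound {Λ : Finset (Lab k)} {y : Lab k → ℕ} {z : ℝ} (hz : 1 < z)
    (hy : y ∈ smallTup Λ z) {Q : ℕ} (hQ : Q ≤ ∏ w, y w) : 4 * Q ≤ moduliBound k z := by
  rw [moduliBound]
  refine Nat.mul_le_mul_left 4 (hQ.trans ?_)
  have h : ((∏ w, y w : ℕ) : ℝ) ≤ z ^ Fintype.card (Lab k) := by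
    push_cast
    rw [← card_univ, ← prod_const]
    refine prod_le_prod (fun _ _ => Nat.cast_nonneg _) fun w _ => ?_
    rw [mem_smallTup] at hy
    by_cases hw : w ∈ Λ
    · rw [hy.1 w hw]; simpa using hz.le
    · exact (hy.2 w hw).1.le
  exact_mod_cast h.trans (Nat.le_ceil _)

lemma exists_pair_of_ne_one {σ : Fin k → Bool} {y : Lab k → ℕ} (hy : ∀ w ∈ maxUnlinked σ, y w = 1)
    (hy1 : y ≠ 1) : ∃ u ∈ maxUnlinked σ, ∃ v ∈ maxUnlinked σ, u ≠ v ∧ ∃ w, y w ≠ 1 ∧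
      y w ∣ pairModulus u v y := by
  obtain ⟨w, hw⟩ := Function.ne_iff.1 hy1
  have hwU : w ∉ maxUnlinked σ := fun h => hw (hy w h)
  obtain ⟨u, hu, v, hv, huv, ho⟩ := exists_pairParity_odd hwU
  refine ⟨u, hu, v, hv, huv, w, hw, ?_⟩
  have := dvd_prod_of_mem (fun w => if Odd (pairParity u v w) then y w else 1) (mem_univ w)
  rw [pairModulus]
  simpa only [if_pos ho] using this

lemma abs_sum_charHom_pairModulus_le {Λ : Finset (Lab k)} {y : Lab k → ℕ} {z : ℝ} (hz : 1 < z)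
    (hy : y ∈ smallTup Λ z) (hsq : Squarefree (∏ w, y w)) (hodd : Odd (∏ w, y w)) {u v w : Lab k}
    (hw : y w ≠ 1) (hwQ : y w ∣ pairModulus u v y) (c N : ℕ) :
    |∑ n ∈ range N, charHom (pairModulus u v y) c n| ≤ moduliBound k z := by
  obtain ⟨p, hp, hpw⟩ := Nat.exists_prime_and_dvd hw
  have hQ := pairModulus_dvd u v y
  refine (abs_sum_charHom_le (hodd.of_dvd_nat hQ) hp (hpw.trans hwQ) (fun h => ?_) N).trans ?_
  · exact hp.one_lt.ne' (Nat.isUnit_iff.1 (hsq p (h.trans hQ)))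
  · exact_mod_cast four_mul_le_moduliBound hz hy (Nat.le_of_dvd hodd.pos hQ)

/-- The families supported mainly on a maximal unlinked set but not entirely contained in it
contribute to the error term only. -/
lemma exists_abs_sum_ne_one_le (hk : 1 ≤ k) {b : ℝ} (hb : 0 ≤ b) : ∃ C ≥ (0 : ℝ),
    ∀ X z : ℝ, 1 < X → 1 < z → z ^ Fintype.card (Lab k) ≤ √X → ∀ σ : Fin k → Bool,
    |∑ y ∈ (smallTup (maxUnlinked σ) z).filter (· ≠ 1),
      ∑ n ∈ (sqfreeBelow X).filter (fun n => (∏ v, y v) * n ∈ admSet X),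
        ∑ x ∈ tupOn (maxUnlinked σ) n,
          b ^ #(∏ v, (y * x) v).primeFactors * jacForm (y * x) (y * x)| ≤ C * errTerm k b X z := by
  obtain ⟨C, hC, h⟩ := exists_abs_sum_smallTup_le hk hb
  refine ⟨C, hC, fun X z hX hz hzX σ => ?_⟩
  set U := maxUnlinked σ with hU
  have hadm : ∀ {y : Lab k → ℕ} {n : ℕ}, (∏ v, y v) * n ∈ admSet X →
      Squarefree ((∏ v, y v) * n) ∧ Odd ((∏ v, y v) * n) := fun {y n} hyn => by
    have := mem_admSet.1 hyn
    exact ⟨this.2.1, Nat.odd_iff.2 (by omega)⟩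
  set Y := (smallTup U z).filter fun y => y ≠ 1 ∧ Squarefree (∏ v, y v) ∧ Odd (∏ v, y v) with hY
  have hYsub : Y ⊆ (smallTup U z).filter (· ≠ 1) := fun y hy => by
    simp only [hY, mem_filter] at hy ⊢
    exact ⟨hy.1, hy.2.1⟩
  rw [← sum_subset hYsub fun y hy hy' => ?_]
  swap
  · refine sum_eq_zero fun n hn => ?_
    have hyn := hadm (mem_filter.1 hn).2
    simp only [hY, mem_filter] at hy hy'
    exact absurd ⟨hy.1, hy.2, hyn.1.squarefree_of_dvd (Dvd.intro _ rfl), (Nat.odd_mul.1 hyn.2).1⟩ hy'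
  have hYmem : ∀ y ∈ Y, y ∈ smallTup U z ∧ (∀ w ∈ U, y w = 1) ∧ y ≠ 1 ∧
      Squarefree (∏ v, y v) ∧ Odd (∏ v, y v) := fun y hy => by
    simp only [hY, mem_filter] at hy
    exact ⟨hy.1, (mem_smallTup.1 hy.1).1, hy.2⟩
  have hpair : ∀ y : Lab k → ℕ, ∃ q : Lab k × Lab k, y ∈ Y → q.1 ∈ U ∧ q.2 ∈ U ∧ q.1 ≠ q.2 ∧
      ∃ w, y w ≠ 1 ∧ y w ∣ pairModulus q.1 q.2 y := fun y => by
    by_cases hy : y ∈ Y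
    · obtain ⟨u, hu, v, hv, huv, hw⟩ := exists_pair_of_ne_one (hYmem y hy).2.1 (hYmem y hy).2.2.1
      exact ⟨(u, v), fun _ => ⟨hu, hv, huv, hw⟩⟩
    · exact ⟨default, fun h => absurd h hy⟩
  choose q hq using hpair
  refine h X z hX hz hzX U Y (fun y hy => (hYmem y hy).1) (fun D => jacForm D D) 1 zero_le_one le_rfl
    (fun c y => charHom (pairModulus (q y).1 (q y).2 y) c) (fun c y _ n => abs_charHom_le_one _ _ _)
    (moduliBound k z) (one_le_moduliBound hz) (moduliBound_le hz) (fun c y hy N => ?_)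
    fun y hy n hyn => ?_
  · obtain ⟨-, -, -, w, hw, hwQ⟩ := hq y hy
    obtain ⟨h1, -, -, h2, h3⟩ := hYmem y hy
    exact abs_sum_charHom_pairModulus_le hz h1 h2 h3 hw hwQ c N
  · obtain ⟨h1, h2, h3, -⟩ := hq y hy
    simpa only [one_mul] using abs_sum_tupOn_maxUnlinked_le h1 h2 h3
      (hadm hyn).1 (hadm hyn).2

/-- The product of the entries whose `j`-th coordinate is `i`. -/
def section3 (x : Lab k → ℕ) (j : Fin k) (i : Fin 3) : ℕ := ∏ u, if (u j).1 = i then x u else 1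

lemma prod_section3 (x : Lab k → ℕ) (j : Fin k) : ∏ i, section3 x j i = ∏ u, x u := by
  simp only [section3]
  rw [Finset.prod_comm]
  exact prod_congr rfl fun u _ => by rw [prod_ite_eq]; simp

lemma prod_jac_section3 (x : Lab k → ℕ) (hx0 : ∀ w, x w ≠ 0) (j : Fin k) :
    ∏ i, ∏ i', (if i' ≠ i then jac (section3 x j i) (section3 x j i') else 1) =
      ∏ u, ∏ w, if (w j).1 ≠ (u j).1 then jac (x u) (x w) else 1 := by
  have e : ∀ i i', (if i' ≠ i then jac (section3 x j i) (section3 x j i') else 1) =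
      ∏ u, ∏ w, if (u j).1 = i then (if (w j).1 = i' then
        (if (w j).1 ≠ (u j).1 then jac (x u) (x w) else 1) else 1) else 1 := by
    intro i i'
    rw [section3, section3, jac_prod_left]
    by_cases h : i' ≠ i
    · rw [if_pos h]
      refine prod_congr rfl fun u _ => ?_
      rw [jac_prod_right _ _ fun w _ => by split_ifs; exacts [hx0 w, one_ne_zero]]
      refine prod_congr rfl fun w _ => ?_
      by_cases hu : (u j).1 = i
      · by_cases hw : (w j).1 = i'
        · rw [if_pos hu, if_pos hw, if_pos hu, if_pos hw, if_pos (by rw [hu, hw]; exact h)]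
        · rw [if_pos hu, if_neg hw, if_pos hu, if_neg hw, jac_one_right]
      · rw [if_neg hu, if_neg hu, jac_one_left]
    · rw [if_neg h]
      push Not at h
      symm
      refine prod_eq_one fun u _ => prod_eq_one fun w _ => ?_
      by_cases hu : (u j).1 = i
      · by_cases hw : (w j).1 = i'
        · rw [if_pos hu, if_pos hw, if_neg (by rw [hu, hw, h]; simp)]
        · rw [if_pos hu, if_neg hw]
      · rw [if_neg hu]
  simp only [e]
  have e2 : ∀ i, ∏ i', ∏ u : Lab k, ∏ w : Lab k, (if (u j).1 = i then (if (w j).1 = i' then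
        (if (w j).1 ≠ (u j).1 then jac (x u) (x w) else 1) else 1) else 1) =
      ∏ u : Lab k, ∏ w : Lab k, (if (u j).1 = i then
        (if (w j).1 ≠ (u j).1 then jac (x u) (x w) else 1) else 1) := by
    intro i
    rw [Finset.prod_comm]
    refine prod_congr rfl fun u _ => ?_
    rw [Finset.prod_comm]
    refine prod_congr rfl fun w _ => ?_
    by_cases hu : (u j).1 = i
    · simp only [if_pos hu]; rw [prod_ite_eq, if_pos (mem_univ _)]
    · simp only [if_neg hu, prod_const_one]
  simp only [e2]
  rw [Finset.prod_comm]
  refine prod_congr rfl fun u _ => ?_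
  rw [Finset.prod_comm]
  refine prod_congr rfl fun w _ => ?_
  rw [prod_ite_eq, if_pos (mem_univ _)]

lemma jacForm_eq_prod_section3 {σ : Fin k → Bool} {x : Lab k → ℕ} (hx : ∀ w, w ∉ maxUnlinked σ → x w = 1)
    (hx0 : ∀ w, x w ≠ 0) : jacForm x x = ∏ j, if σ j then
      ∏ i, ∏ i', (if i' ≠ i then jac (section3 x j i) (section3 x j i') else 1) else 1 := by
  have e : jacForm x x = ∏ j, ∏ u, ∏ w,
      if (u j).2 = true ∧ (w j).1 ≠ (u j).1 then jac (x u) (x w) else 1 := by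
    rw [Finset.prod_comm]
    refine prod_congr rfl fun u _ => ?_
    rw [Finset.prod_comm]
    refine prod_congr rfl fun w _ => ?_
    rw [phi, ← prod_pow_eq_pow_sum]
    exact prod_congr rfl fun j _ => by split_ifs <;> simp
  rw [e]
  refine prod_congr rfl fun j _ => ?_
  rw [prod_jac_section3 x hx0]
  have hu2 : ∀ u, u ∈ maxUnlinked σ → (u j).2 = σ j := fun u hu => mem_maxUnlinked.1 hu j
  by_cases hj : σ j = true
  · rw [if_pos hj]
    refine prod_congr rfl fun u _ => prod_congr rfl fun w _ => ?_
    by_cases hu : u ∈ maxUnlinked σ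
    · simp [hu2 u hu, hj]
    · simp [hx u hu, jac_one_left]
  · rw [if_neg hj]
    refine prod_eq_one fun u _ => prod_eq_one fun w _ => ?_
    by_cases hu : u ∈ maxUnlinked σ
    · simp [hu2 u hu, hj]
    · simp [hx u hu, jac_one_left]

lemma prod_jac_three {d : Fin 3 → ℕ} (hsq : Squarefree (∏ i, d i)) (h4 : (∏ i, d i) % 4 = 1) :
    ∏ i, ∏ i', (if i' ≠ i then jac (d i) (d i') else 1) = (∑ i, chi4 (d i)) / 2 - 1 / 2 := by
  have hodd : ∀ i, Odd (d i) := fun i =>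
    (Nat.odd_iff.2 (by omega : (∏ i, d i) % 2 = 1)).of_dvd_nat (dvd_prod_of_mem d (mem_univ i))
  have hrec : ∀ i i', i ≠ i' → jac (d i) (d i') * jac (d i') (d i) =
      if d i % 4 = 3 ∧ d i' % 4 = 3 then -1 else 1 := by
    intro i i' h
    rw [jac_reciprocity (hodd i) (hodd i'), mul_left_comm,
      jac_sq_eq_one (coprime_of_squarefree_prod hsq h), mul_one]
  have h01 := hrec 0 1 (by decide)
  have h02 := hrec 0 2 (by decide)
  have h12 := hrec 1 2 (by decide)
  simp only [Fin.prod_univ_three, Fin.sum_univ_three] at h4 ⊢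
  have e : ∀ a b c d e f : ℝ, (a * b) * (c * d) * (e * f) = (a * c) * (b * e) * (d * f) := by
    intros; ring
  simp only [ne_eq, not_true_eq_false, if_false, Fin.reduceEq, not_false_eq_true, if_true,
    one_mul, mul_one, zero_ne_one, one_ne_zero]
  rw [e, h01, h02, h12]
  have h3 := Nat.mul_mod (d 0 * d 1) (d 2) 4
  rw [Nat.mul_mod (d 0)] at h3
  rcases (by have := Nat.odd_iff.1 (hodd 0); omega : d 0 % 4 = 1 ∨ d 0 % 4 = 3) with a | a <;>
  rcases (by have := Nat.odd_iff.1 (hodd 1); omega : d 1 % 4 = 1 ∨ d 1 % 4 = 3) with b | b <;>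
  rcases (by have := Nat.odd_iff.1 (hodd 2); omega : d 2 % 4 = 1 ∨ d 2 % 4 = 3) with c | c <;>
  simp [a, b, c, chi4_of_mod.1, chi4_of_mod.2.1, h4] at h3 ⊢ <;> norm_num

/-- The constant term in the expansion of `jacForm` on a maximal unlinked set. -/
def unlinkedCoef (σ : Fin k → Bool) : ℝ := ∏ j, if σ j then -1 / 2 else 1

/-- The coefficients of the expansion of `jacForm` on a maximal unlinked set. -/
def expandCoef (σ : Fin k → Bool) (e : Fin k → Option (Fin 3)) : ℝ :=
  ∏ j, if σ j then (if e j = none then -1 / 2 else 1 / 2) else (if e j = none then 1 else 0)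

/-- The number of coordinates of `u` selected by `e`. -/
def hitCount (e : Fin k → Option (Fin 3)) (u : Lab k) : ℕ := ∑ j, if e j = some (u j).1 then 1 else 0

lemma abs_expandCoef_le_one (σ : Fin k → Bool) (e : Fin k → Option (Fin 3)) : |expandCoef σ e| ≤ 1 := by
  rw [expandCoef, abs_prod]
  refine prod_le_one (fun _ _ => abs_nonneg _) fun j _ => ?_
  split_ifs <;> norm_num [abs_div]

lemma chi4_prod {ι : Type*} (s : Finset ι) (f : ι → ℕ) : chi4 (∏ i ∈ s, f i) = ∏ i ∈ s, chi4 (f i) := by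
  induction s using Finset.induction_on with
  | empty => simp [chi4_one]
  | insert i s hi ih => rw [prod_insert hi, prod_insert hi, chi4_mul, ih]

lemma chi4_section3 (x : Lab k → ℕ) (j : Fin k) (i : Fin 3) :
    chi4 (section3 x j i) = ∏ u, if (u j).1 = i then chi4 (x u) else 1 := by
  rw [section3, chi4_prod]
  exact prod_congr rfl fun u _ => by split_ifs <;> simp [chi4_one]

lemma jacForm_expand {σ : Fin k → Bool} {x : Lab k → ℕ} (hx : ∀ w, w ∉ maxUnlinked σ → x w = 1)
    (hsq : Squarefree (∏ w, x w)) (h4 : (∏ w, x w) % 4 = 1) :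
    jacForm x x = ∑ e : Fin k → Option (Fin 3), expandCoef σ e * ∏ u, chi4 (x u) ^ hitCount e u := by
  have hx0 : ∀ w, x w ≠ 0 := fun w => (squarefree_of_squarefree_prod hsq w).ne_zero
  have e1 : ∀ j, (if σ j then
      ∏ i, ∏ i', (if i' ≠ i then jac (section3 x j i) (section3 x j i') else 1) else 1) =
      ∑ o : Option (Fin 3), (if σ j then (if o = none then -1 / 2 else 1 / 2)
        else (if o = none then 1 else 0)) * ∏ u, if o = some (u j).1 then chi4 (x u) else 1 := by
    intro j
    rw [Fintype.sum_option]
    by_cases hj : σ j = true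
    · simp only [if_pos hj]
      rw [prod_jac_three (by rw [prod_section3]; exact hsq) (by rw [prod_section3]; exact h4)]
      simp only [chi4_section3, reduceCtorEq, if_false, Option.some.injEq, if_true, prod_const_one,
        mul_one]
      rw [← mul_sum]
      simp only [eq_comm]
      ring
    · simp [hj]
  rw [jacForm_eq_prod_section3 hx hx0, prod_congr rfl fun j _ => e1 j, prod_univ_sum,
    Fintype.piFinset_univ]
  refine sum_congr rfl fun e _ => ?_
  rw [prod_mul_distrib, expandCoef, Finset.prod_comm]
  congr 1
  refine prod_congr rfl fun u _ => ?_
  rw [hitCount, ← prod_pow_eq_pow_sum]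
  exact prod_congr rfl fun j _ => by split_ifs <;> simp

lemma primeProd_chi4_pow {m : ℕ} (hm : Squarefree m) (a : ℕ) :
    primeProd (fun p => chi4 p ^ a) m = chi4 m ^ a := by
  rw [primeProd, prod_pow, ← chi4_prod, Nat.prod_primeFactors_of_squarefree hm]

/-- A nontrivial selection of coordinates produces cancellation at primes `p ≡ 3 (mod 4)`. -/
lemma abs_sum_chi4_pow_le {σ : Fin k → Bool} {e : Fin k → Option (Fin 3)} (he : e ≠ fun _ => none)
    {p : ℕ} (hp : Odd p) :
    |∑ u ∈ maxUnlinked σ, chi4 p ^ hitCount e u| ≤ 3 ^ k - 1 + chi4 p := by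
  have hle : ∀ s : Finset (Lab k), |∑ u ∈ s, chi4 p ^ hitCount e u| ≤ #s := fun s => by
    refine (abs_sum_le_sum_abs _ _).trans ?_
    rw [← nsmul_one, ← sum_const]
    exact sum_le_sum fun u _ => by
      rw [abs_pow]; exact pow_le_one₀ (abs_nonneg _) (abs_chi4_le_one p)
  have hcard : (#(maxUnlinked σ) : ℝ) = 3 ^ k := by rw [card_maxUnlinked]; push_cast; rfl
  rcases (by have := Nat.odd_iff.1 hp; omega : p % 4 = 1 ∨ p % 4 = 3) with h | h
  · have := hle (maxUnlinked σ)
    rw [chi4_of_mod.1 h] at this ⊢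
    linarith
  · obtain ⟨j0, hj0⟩ := Function.ne_iff.1 he
    obtain ⟨i, hi⟩ := Option.ne_none_iff_exists'.1 hj0
    set u : Lab k := fun j => (i, σ j) with hu
    set v : Lab k := fun j => (if j = j0 then i + 1 else i, σ j) with hv
    have huU : u ∈ maxUnlinked σ := mem_maxUnlinked.2 fun j => rfl
    have hvU : v ∈ maxUnlinked σ := mem_maxUnlinked.2 fun j => rfl
    have huv : v ≠ u := fun h => by
      have := congrArg Prod.fst (congrFun h j0)
      simp [hu, hv] at this
    have hhit : hitCount e u = hitCount e v + 1 := by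
      rw [hitCount, hitCount, ← add_sum_erase _ _ (mem_univ j0), ← add_sum_erase univ (fun j =>
        if e j = some (v j).1 then 1 else 0) (mem_univ j0)]
      have e1 : ∑ j ∈ univ.erase j0, (if e j = some (u j).1 then 1 else 0) =
          ∑ j ∈ univ.erase j0, (if e j = some (v j).1 then 1 else 0) :=
        sum_congr rfl fun j hj => by simp [hu, hv, (mem_erase.1 hj).1]
      rw [e1]
      simp [hu, hv, hi, add_comm]
    have hvU' : v ∈ (maxUnlinked σ).erase u := mem_erase.2 ⟨huv, hvU⟩
    rw [← add_sum_erase _ _ huU, ← add_sum_erase _ _ hvU', hhit, chi4_of_mod.2.1 h]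
    have e2 : ∀ a : ℕ, ∀ S : ℝ, (-1 : ℝ) ^ (a + 1) + ((-1) ^ a + S) = S := fun a S => by ring
    rw [e2]
    have := hle (((maxUnlinked σ).erase u).erase v)
    rw [chi4_of_mod.2.1 h, card_erase_of_mem hvU', card_erase_of_mem huU] at this
    have h2 : 1 < #(maxUnlinked σ) := one_lt_card.2 ⟨v, hvU, u, huU, huv⟩
    rw [Nat.sub_sub, Nat.cast_sub h2, hcard] at this
    push_cast at this
    linarith

lemma abs_sum_tupOn_sub_le (hk : 1 ≤ k) {σ : Fin k → Bool} {n : ℕ} (hsq : Squarefree n) (h4 : n % 4 = 1) :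
    |∑ x ∈ tupOn (maxUnlinked σ) n, (jacForm x x - unlinkedCoef σ)| ≤
      4 ^ k * primeProd (fun p => 3 ^ k - 1 + chi4 p) n := by
  set U := maxUnlinked σ
  have hnone : ∀ x : Lab k → ℕ, expandCoef σ (fun _ => none) *
      ∏ u, chi4 (x u) ^ hitCount (fun _ => none) u = unlinkedCoef σ := fun x => by
    simp [expandCoef, unlinkedCoef, hitCount]
  have h1 : ∑ x ∈ tupOn U n, (jacForm x x - unlinkedCoef σ) =
      ∑ e ∈ univ.erase (fun _ : Fin k => (none : Option (Fin 3))), expandCoef σ e *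
        primeProd (fun p => ∑ u ∈ U, chi4 p ^ hitCount e u) n := by
    have : ∀ x ∈ tupOn U n, jacForm x x - unlinkedCoef σ =
        ∑ e ∈ univ.erase (fun _ : Fin k => (none : Option (Fin 3))), expandCoef σ e *
          ∏ u ∈ U, primeProd (fun p => chi4 p ^ hitCount e u) (x u) := by
      intro x hx
      obtain ⟨h2, h3⟩ := (mem_tupOn hsq.ne_zero).1 hx
      have hsq' : Squarefree (∏ w, x w) := h2.symm ▸ hsq
      rw [jacForm_expand h3 hsq' (by rw [h2]; exact h4),
        ← add_sum_erase univ _ (mem_univ fun _ : Fin k => (none : Option (Fin 3))), hnone x,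
        add_sub_cancel_left]
      refine sum_congr rfl fun e _ => ?_
      rw [← prod_subset (subset_univ U) fun w _ hw => by rw [h3 w hw, chi4_one, one_pow]]
      congr 1
      exact prod_congr rfl fun u _ =>
        (primeProd_chi4_pow (squarefree_of_squarefree_prod hsq' u) _).symm
    rw [sum_congr rfl this, Finset.sum_comm]
    refine sum_congr rfl fun e _ => ?_
    rw [← mul_sum, sum_tupOn_prod U hsq]
  rw [h1]
  have hbound : ∀ e ∈ univ.erase (fun _ : Fin k => (none : Option (Fin 3))),
      |expandCoef σ e * primeProd (fun p => ∑ u ∈ U, chi4 p ^ hitCount e u) n| ≤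
        primeProd (fun p => 3 ^ k - 1 + chi4 p) n := by
    intro e he
    rw [abs_mul]
    refine (mul_le_of_le_one_left (abs_nonneg _) (abs_expandCoef_le_one σ e)).trans ?_
    rw [primeProd, abs_prod]
    refine prod_le_prod (fun _ _ => abs_nonneg _) fun p hp => ?_
    refine abs_sum_chi4_pow_le (mem_erase.1 he).1 ?_
    have hn : Odd n := Nat.odd_iff.2 (by omega)
    exact hn.of_dvd_nat (Nat.dvd_of_mem_primeFactors hp)
  refine (abs_sum_le_sum_abs _ _).trans ((sum_le_sum hbound).trans ?_)
  have hP : 0 ≤ primeProd (fun p => (3 : ℝ) ^ k - 1 + chi4 p) n :=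
    primeProd_nonneg (fun p _ => by
      linarith [(abs_le.1 (abs_chi4_le_one p)).1, one_le_three_pow_sub_one hk]) n
  rw [sum_const, nsmul_eq_mul]
  refine mul_le_mul_of_nonneg_right ?_ hP
  calc (#(univ.erase (fun _ : Fin k => (none : Option (Fin 3)))) : ℝ) ≤
      #(univ : Finset (Fin k → Option (Fin 3))) := by exact_mod_cast card_le_card (erase_subset _ _)
    _ = 4 ^ k := by simp

/-- The families contained in a maximal unlinked set yield the main term. -/
lemma exists_abs_sum_maxUnlinked_sub_le (hk : 1 ≤ k) {b : ℝ} (hb : 0 ≤ b) : ∃ C ≥ (0 : ℝ),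
    ∀ X z : ℝ, 1 < X → 1 < z → z ^ Fintype.card (Lab k) ≤ √X → ∀ σ : Fin k → Bool,
    |∑ n ∈ admSet X, ∑ x ∈ tupOn (maxUnlinked σ) n, b ^ #(∏ v, x v).primeFactors * jacForm x x -
      unlinkedCoef σ * ∑ n ∈ admSet X, (3 ^ k * b) ^ #n.primeFactors| ≤ C * errTerm k b X z := by
  obtain ⟨C, hC, h⟩ := exists_abs_sum_smallTup_le hk hb
  refine ⟨4 ^ k * C, by positivity, fun X z hX hz hzX σ => ?_⟩
  set U := maxUnlinked σ
  have hadm : ∀ {n : ℕ}, (∏ v : Lab k, (1 : Lab k → ℕ) v) * n ∈ admSet X → Squarefree n ∧ n % 4 = 1 :=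
    fun {n} hn => by simpa using (mem_admSet.1 hn).2
  have hone : ∀ (n : ℕ), charHom 1 1 n ≤ 1 ∧ -1 ≤ charHom 1 1 n := fun n =>
    ⟨(abs_le.1 (abs_charHom_le_one 1 1 n)).2, (abs_le.1 (abs_charHom_le_one 1 1 n)).1⟩
  have key := h X z hX hz hzX U {1} (by
      rw [singleton_subset_iff, mem_smallTup]
      exact ⟨fun _ _ => rfl, fun _ _ => ⟨by simpa using hz, squarefree_one⟩⟩)
    (fun D => (4 ^ k)⁻¹ * (jacForm D D - unlinkedCoef σ)) 1 zero_le_one le_rfl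
    (fun _ _ => charHom 1 1) (fun _ _ _ n => abs_charHom_le_one _ _ _) 4 (by norm_num)
    (by have : 1 ≤ z ^ (2 * Fintype.card (Lab k)) := one_le_pow₀ hz.le
        push_cast; linarith) (fun _ _ _ N => abs_sum_chi4_le N) (fun y hy n hn => ?_)
  · rw [sum_singleton] at key
    have e1 : (sqfreeBelow X).filter (fun n => (∏ v : Lab k, (1 : Lab k → ℕ) v) * n ∈ admSet X) =
        admSet X := by
      ext n
      simp only [mem_filter, Pi.one_apply, prod_const_one, one_mul, admSet]
      tauto
    rw [e1] at key
    have e2 : ∑ n ∈ admSet X, ∑ x ∈ tupOn U n, b ^ #(∏ v, x v).primeFactors * jacForm x x -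
        unlinkedCoef σ * ∑ n ∈ admSet X, (3 ^ k * b) ^ #n.primeFactors = 4 ^ k *
        ∑ n ∈ admSet X, ∑ x ∈ tupOn U n, b ^ #(∏ v, (1 * x) v).primeFactors *
          ((4 ^ k)⁻¹ * (jacForm (1 * x) (1 * x) - unlinkedCoef σ)) := by
      rw [mul_sum, mul_sum, ← sum_sub_distrib]
      refine sum_congr rfl fun n hn => ?_
      have hsq : Squarefree n := (mem_admSet.1 hn).2.1
      have hcard : (3 ^ k * b) ^ #n.primeFactors = ∑ x ∈ tupOn U n, b ^ #(∏ v, x v).primeFactors := by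
        rw [sum_congr rfl (g := fun _ => b ^ #n.primeFactors) fun x hx => by
          rw [((mem_tupOn hsq.ne_zero).1 hx).1], sum_const, nsmul_eq_mul, card_tupOn U hsq,
          card_maxUnlinked]
        push_cast
        rw [mul_pow]
      rw [hcard, mul_sum, mul_sum, ← sum_sub_distrib]
      refine sum_congr rfl fun x _ => ?_
      rw [one_mul]
      have : (4 : ℝ) ^ k ≠ 0 := by positivity
      field_simp
    rw [e2, abs_mul, abs_of_pos (by positivity : (0 : ℝ) < 4 ^ k), mul_assoc]
    exact mul_le_mul_of_nonneg_left key (by positivity)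
  · rw [mem_singleton] at hy
    subst hy
    obtain ⟨hsq, h4⟩ := hadm hn
    simp only [one_mul, sum_const, card_range]
    rw [← mul_sum, abs_mul, abs_of_pos (by positivity : (0 : ℝ) < (4 ^ k)⁻¹)]
    have hP : 0 ≤ primeProd (fun p => (3 : ℝ) ^ k - 1 + charHom 1 1 p) n :=
      primeProd_nonneg (fun p _ => by linarith [hone p, one_le_three_pow_sub_one hk]) n
    have e3 : primeProd (fun p => (3 : ℝ) ^ k - 1 + charHom 1 1 p) n =
        primeProd (fun p => 3 ^ k - 1 + chi4 p) n :=
      prod_congr rfl fun p hp => by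
        beta_reduce
        rw [charHom_apply (Nat.prime_of_mem_primeFactors hp).ne_zero, jac_one_right, one_mul, pow_one]
    have := abs_sum_tupOn_sub_le hk (σ := σ) hsq h4
    rw [← e3] at this
    rw [inv_mul_le_iff₀ (by positivity), nsmul_eq_mul]
    push_cast
    nlinarith [mul_nonneg (by positivity : (0 : ℝ) ≤ 4 ^ k) hP]

lemma exists_abs_sum_admSmall_sub_le (hk : 1 ≤ k) {b : ℝ} (hb : 0 ≤ b) : ∃ C ≥ (0 : ℝ),
    ∀ X z : ℝ, 1 < X → 1 < z → z ^ Fintype.card (Lab k) ≤ √X → ∀ σ : Fin k → Bool,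
    |∑ D ∈ admSmall (maxUnlinked σ) X z, b ^ #(∏ v, D v).primeFactors * jacForm D D -
      unlinkedCoef σ * ∑ n ∈ admSet X, (3 ^ k * b) ^ #n.primeFactors| ≤ C * errTerm k b X z := by
  obtain ⟨C₁, hC₁, h₁⟩ := exists_abs_sum_ne_one_le hk hb
  obtain ⟨C₂, hC₂, h₂⟩ := exists_abs_sum_maxUnlinked_sub_le hk hb
  refine ⟨C₁ + C₂, by positivity, fun X z hX hz hzX σ => ?_⟩
  have hadm : (sqfreeBelow X).filter (fun n => (∏ v : Lab k, (1 : Lab k → ℕ) v) * n ∈ admSet X) =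
      admSet X := by
    ext n
    simp only [mem_filter, Pi.one_apply, prod_const_one, one_mul, admSet]
    tauto
  have hone : (smallTup (maxUnlinked σ) z).filter (fun y => ¬ y ≠ 1) = {1} := by
    ext y
    simp only [mem_filter, not_not, mem_singleton, and_iff_right_iff_imp]
    rintro rfl
    rw [mem_smallTup]
    exact ⟨fun _ _ => rfl, fun _ _ => ⟨by simpa using hz, squarefree_one⟩⟩
  rw [sum_admTup_split, ← sum_filter_add_sum_filter_not _ (· ≠ 1), hone, sum_singleton, hadm,
    add_sub_assoc, add_mul]
  simp only [one_mul]
  exact (abs_add_le _ _).trans (add_le_add (h₁ X z hX hz hzX σ) (h₂ X z hX hz hzX σ))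

lemma filter_bigSet_subset_admSmall (Λ : Finset (Lab k)) (X z : ℝ) :
    (admTup (Lab k) X).filter (fun D => bigSet z D = Λ) ⊆ admSmall Λ X z := fun D hD => by
  obtain ⟨hDX, rfl⟩ := mem_filter.1 hD
  exact mem_admSmall.2 ⟨hDX, fun v hv => by simpa [bigSet] using hv⟩

lemma goodLab_of_bigSet_eq {σ : Fin k → Bool} {z : ℝ} (hz : 1 < z) {D : Lab k → ℕ}
    (hD : bigSet z D = maxUnlinked σ) : goodLab D := fun j i => by
  refine ⟨fun j' => (i, σ j'), rfl, fun h => ?_⟩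
  have hmem : (fun j' => (i, σ j') : Lab k) ∈ bigSet z D := hD ▸ mem_maxUnlinked.2 fun _ => rfl
  rw [bigSet, mem_filter, h] at hmem
  push_cast at hmem
  linarith [hmem.2]

lemma sum_biUnion_le_sum {ι β : Type} [DecidableEq β] (s : Finset ι) (t : ι → Finset β) {f : β → ℝ}
    (hf : ∀ i, 0 ≤ f i) : ∑ x ∈ s.biUnion t, f x ≤ ∑ i ∈ s, ∑ x ∈ t i, f x := by
  induction s using Finset.induction_on with
  | empty => simp
  | insert a s ha ih =>
    rw [biUnion_insert, sum_insert ha]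
    have := sum_union_inter (s₁ := t a) (s₂ := s.biUnion t) (f := f)
    have := sum_nonneg fun x (_ : x ∈ t a ∩ s.biUnion t) => hf x
    linarith

/-- The contribution of a maximal unlinked set. -/
lemma exists_abs_sum_bigSet_sub_le (hk : 1 ≤ k) {b : ℝ} (hb : 0 ≤ b) : ∃ C ≥ (0 : ℝ),
    ∀ X z : ℝ, 1 < X → 1 < z → z ^ Fintype.card (Lab k) ≤ √X → ∀ σ : Fin k → Bool,
    |∑ D ∈ (admTup (Lab k) X).filter (fun D => bigSet z D = maxUnlinked σ), summand b D -
      unlinkedCoef σ * ∑ n ∈ admSet X, (3 ^ k * b) ^ #n.primeFactors| ≤ C * errTerm k b X z := by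
  obtain ⟨C₁, hC₁, h₁⟩ := exists_sum_trivial_le hk hb
  obtain ⟨C₂, hC₂, h₂⟩ := exists_abs_sum_admSmall_sub_le hk hb
  refine ⟨3 ^ k * C₁ + C₂, by positivity, fun X z hX hz hzX σ => ?_⟩
  set U := maxUnlinked σ with hU
  set T := (admTup (Lab k) X).filter (fun D => bigSet z D = U) with hT
  have hsub : T ⊆ admSmall U X z := filter_bigSet_subset_admSmall U X z
  have hgood : ∑ D ∈ T, summand b D = ∑ D ∈ T, b ^ #(∏ v, D v).primeFactors * jacForm D D :=
    sum_congr rfl fun D hD => by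
      rw [summand, if_pos (goodLab_of_bigSet_eq hz (mem_filter.1 hD).2)]
  have hrest : |∑ D ∈ admSmall U X z \ T, b ^ #(∏ v, D v).primeFactors * jacForm D D| ≤
      3 ^ k * C₁ * errTerm k b X z := by
    have hcover : admSmall U X z \ T ⊆ U.biUnion fun u => admSmall (U.erase u) X z := fun D hD => by
      obtain ⟨hD, hDT⟩ := mem_sdiff.1 hD
      obtain ⟨hD, hsm⟩ := mem_admSmall.1 hD
      have hne : bigSet z D ≠ U := fun h => hDT (mem_filter.2 ⟨hD, h⟩)
      have hle : bigSet z D ⊆ U := fun v hv => by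
        by_contra hvU
        exact absurd (mem_filter.1 hv).2 (not_le.2 (hsm v hvU))
      obtain ⟨u, huU, hu⟩ := exists_of_ssubset (hle.ssubset_of_ne hne)
      refine mem_biUnion.2 ⟨u, huU, mem_admSmall.2 ⟨hD, fun v hv => ?_⟩⟩
      by_cases hvu : v = u
      · subst hvu
        simpa [bigSet] using hu
      · exact hsm v fun hvU => hv (mem_erase.2 ⟨hvu, hvU⟩)
    calc _ ≤ ∑ D ∈ admSmall U X z \ T, b ^ #(∏ v, D v).primeFactors := by
          refine (abs_sum_le_sum_abs _ _).trans (sum_le_sum fun D _ => ?_)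
          rw [abs_mul, abs_of_nonneg (by positivity)]
          exact mul_le_of_le_one_right (by positivity) (abs_jacForm_le_one _ _)
      _ ≤ ∑ D ∈ U.biUnion fun u => admSmall (U.erase u) X z, b ^ #(∏ v, D v).primeFactors :=
          sum_le_sum_of_subset_of_nonneg hcover fun _ _ _ => by positivity
      _ ≤ ∑ u ∈ U, ∑ D ∈ admSmall (U.erase u) X z, b ^ #(∏ v, D v).primeFactors :=
          sum_biUnion_le_sum _ _ fun _ => by positivity
      _ ≤ ∑ _u ∈ U, C₁ * errTerm k b X z := sum_le_sum fun u hu => h₁ X z hX hz hzX _ (by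
          rw [card_erase_of_mem hu, hU, card_maxUnlinked]
          exact Nat.sub_lt (by positivity) one_pos)
      _ = _ := by
          rw [sum_const, hU, card_maxUnlinked, nsmul_eq_mul]
          push_cast
          ring
  have hadd := sum_sdiff (f := fun D => b ^ #(∏ v, D v).primeFactors * jacForm D D) hsub
  have := h₂ X z hX hz hzX σ
  rw [← hadd] at this
  rw [hgood]
  rw [abs_le] at *
  constructor <;> nlinarith

lemma sum_unlinkedCoef (k : ℕ) : ∑ σ : Fin k → Bool, unlinkedCoef σ = (1 / 2) ^ k := by
  have := Finset.prod_univ_sum (fun _ : Fin k => (univ : Finset Bool))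
    fun _ s => if s then (-1 / 2 : ℝ) else 1
  rw [Fintype.piFinset_univ] at this
  simp only [unlinkedCoef, ← this, Fintype.sum_bool, prod_const, Finset.card_univ, Fintype.card_fin]
  norm_num

lemma maxUnlinked_injective : Function.Injective (maxUnlinked (k := k)) := by
  intro σ τ h
  have : (fun j => ((0 : Fin 3), σ j) : Lab k) ∈ maxUnlinked τ := h ▸ mem_maxUnlinked.2 fun _ => rfl
  exact funext fun j => mem_maxUnlinked.1 this j

/-- The sum over all factorizations, up to the error terms. -/
lemma exists_eventually_abs_sum_admTup_sub_le (hk : 1 ≤ k) {b : ℝ} (hb : 0 ≤ b) :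
    ∃ A > (0 : ℝ), ∃ C ≥ (0 : ℝ), ∀ᶠ X : ℝ in atTop,
    |∑ D ∈ admTup (Lab k) X, summand b D -
      (1 / 2) ^ k * ∑ n ∈ admSet X, (3 ^ k * b) ^ #n.primeFactors| ≤
      C * (errTerm k b X (Real.log X ^ A) + X / Real.log X) := by
  obtain ⟨A, hA, C₀, hC₀, h₀⟩ := eventually_abs_sum_linked_le (k := k) hb
  obtain ⟨C₁, hC₁, h₁⟩ := exists_sum_trivial_le hk hb
  obtain ⟨C₂, hC₂, h₂⟩ := exists_abs_sum_bigSet_sub_le hk hb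
  refine ⟨A, hA, Fintype.card (Finset (Lab k)) * (C₀ + C₁ + C₂), by positivity, ?_⟩
  filter_upwards [h₀, eventually_gt_atTop 1, eventually_le_log 2,
    eventually_log_rpow_le (2 * A * Fintype.card (Lab k))] with X h₀ hX hL hLX
  set z := Real.log X ^ A with hz
  set M := ∑ n ∈ admSet X, (3 ^ k * b) ^ #n.primeFactors with hM
  have hL0 : 0 < Real.log X := by linarith
  have hz1 : 1 < z := Real.one_lt_rpow (by linarith) hA
  have hzX : z ^ Fintype.card (Lab k) ≤ √X := by
    refine Real.le_sqrt_of_sq_le ?_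
    rw [hz, ← Real.rpow_mul_natCast hL0.le, ← Real.rpow_mul_natCast hL0.le]
    convert hLX using 2
    push_cast
    ring
  have hE := errTerm_nonneg k (b := b) hX hz1
  have hXL : 0 ≤ X / Real.log X := by positivity
  have hmain : (1 / 2) ^ k * M = ∑ Λ : Finset (Lab k), ∑ σ : Fin k → Bool,
      if maxUnlinked σ = Λ then unlinkedCoef σ * M else 0 := by
    rw [Finset.sum_comm, ← sum_unlinkedCoef, sum_mul]
    simp
  rw [← sum_fiberwise (admTup (Lab k) X) (bigSet z), hmain, ← sum_sub_distrib]
  refine (abs_sum_le_sum_abs _ _).trans ?_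
  rw [mul_assoc, ← nsmul_eq_mul, ← Finset.card_univ, ← sum_const]
  refine sum_le_sum fun Λ _ => ?_
  by_cases hσ : ∃ σ : Fin k → Bool, maxUnlinked σ = Λ
  · obtain ⟨σ, rfl⟩ := hσ
    have : ∑ τ : Fin k → Bool, (if maxUnlinked τ = maxUnlinked σ then unlinkedCoef τ * M else 0) =
        unlinkedCoef σ * M := by
      simp [maxUnlinked_injective.eq_iff]
    rw [this]
    refine (h₂ X z hX hz1 hzX σ).trans ?_
    nlinarith [mul_nonneg hC₀ hE, mul_nonneg hC₁ hE, mul_nonneg (by positivity : 0 ≤ C₀ + C₁ + C₂) hXL]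
  · rw [sum_eq_zero (s := univ (α := Fin k → Bool)) fun σ _ => if_neg fun h => hσ ⟨σ, h⟩, sub_zero]
    by_cases hl : ∃ u ∈ Λ, ∃ v ∈ Λ, Odd (linkNum u v)
    · refine (h₀ Λ hl).trans ?_
      nlinarith [mul_nonneg hC₁ hXL, mul_nonneg hC₂ hXL, mul_nonneg (by positivity : 0 ≤ C₀ + C₁ + C₂) hE]
    · have hcl := unlinked_classification k Λ fun u hu v hv => Nat.not_odd_iff_even.1 fun h =>
        hl ⟨u, hu, v, hv, h⟩
      have hlt : #Λ < 3 ^ k := lt_of_le_of_ne hcl.1 fun h => by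
        obtain ⟨σ, h⟩ := hcl.2 h
        exact hσ ⟨σ, h.symm⟩
      calc _ ≤ ∑ D ∈ (admTup (Lab k) X).filter (fun D => bigSet z D = Λ),
            b ^ #(∏ v, D v).primeFactors :=
            (abs_sum_le_sum_abs _ _).trans (sum_le_sum fun D _ => abs_summand_le hb D)
        _ ≤ ∑ D ∈ admSmall Λ X z, b ^ #(∏ v, D v).primeFactors :=
            sum_le_sum_of_subset_of_nonneg (filter_bigSet_subset_admSmall Λ X z)
              fun _ _ _ => by positivity
        _ ≤ C₁ * errTerm k b X z := h₁ X z hX hz1 hzX Λ hlt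
        _ ≤ _ := by
            nlinarith [mul_nonneg hC₀ hE, mul_nonneg hC₂ hE,
              mul_nonneg (by positivity : 0 ≤ C₀ + C₁ + C₂) hXL]

lemma exists_errTerm_add_le (hk : 1 ≤ k) {b A ε : ℝ} (hb : 0 ≤ b) (hA : 0 < A) (hε : 0 < ε) :
    ∃ C ≥ (0 : ℝ), ∀ X : ℝ, 1 < X → 1 ≤ Real.log X →
      errTerm k b X (Real.log X ^ A) + X / Real.log X ≤
        C * (X * Real.log X ^ ((3 ^ k - 1) * b - 1 + ε)) := by
  set K := (3 ^ k - 1) * b with hKdef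
  set E := b + max b 1 * Fintype.card (Lab k) with hE
  have hK : 0 ≤ K := mul_nonneg (by linarith [one_le_three_pow_sub_one hk]) hb
  have hE0 : 0 < E := by
    have : 0 < Fintype.card (Lab k) := Fintype.card_pos
    have : (0 : ℝ) < max b 1 := lt_max_of_lt_right one_pos
    positivity
  set δ := ε / E with hδ
  have hδ0 : 0 < δ := by positivity
  refine ⟨2 ^ K * (1 + A / δ) ^ E + 1, by positivity, fun X hX hL => ?_⟩
  rw [errTerm, ← hKdef, ← hE]
  set L := Real.log X
  have hL0 : 0 < L := by linarith
  have hX0 : 0 < X := by linarith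
  have h1 : (1 + L) ^ K ≤ 2 ^ K * L ^ K := by
    rw [← Real.mul_rpow (by norm_num) hL0.le]
    exact Real.rpow_le_rpow (by positivity) (by linarith) hK
  have h2 : (1 + Real.log (L ^ A)) ^ E ≤ (1 + A / δ) ^ E * L ^ ε := by
    have hδE : L ^ ε = (L ^ δ) ^ E := by
      rw [← Real.rpow_mul hL0.le, hδ, div_mul_cancel₀ _ hE0.ne']
    rw [hδE, ← Real.mul_rpow (by positivity) (by positivity), Real.log_rpow hL0]
    have hlog := Real.log_le_rpow_div hL0.le hδ0
    have hone : 1 ≤ L ^ δ := Real.one_le_rpow hL hδ0.le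
    have hl := Real.log_nonneg hL
    refine Real.rpow_le_rpow (by positivity) ?_ hE0.le
    calc 1 + A * Real.log L ≤ L ^ δ + A * (L ^ δ / δ) :=
          add_le_add hone (mul_le_mul_of_nonneg_left hlog hA.le)
      _ = _ := by ring
  have h3 : L ^ (K - 1 + ε) = L ^ K * L ^ ε / L := by
    rw [show K - 1 + ε = K + ε - 1 by ring, Real.rpow_sub hL0, Real.rpow_one, Real.rpow_add hL0]
  have h4 : 1 ≤ L ^ K * L ^ ε :=
    one_le_mul_of_one_le_of_one_le (Real.one_le_rpow hL hK) (Real.one_le_rpow hL hε.le)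
  have hl : 0 ≤ Real.log (L ^ A) := Real.log_nonneg (Real.one_le_rpow hL hA.le)
  rw [h3]
  calc _ ≤ X / L * (2 ^ K * L ^ K) * ((1 + A / δ) ^ E * L ^ ε) + X / L * (L ^ K * L ^ ε) :=
        add_le_add (mul_le_mul (mul_le_mul_of_nonneg_left h1 (by positivity)) h2 (by positivity)
          (by positivity)) (le_mul_of_one_le_right (by positivity) h4)
    _ = _ := by ring

lemma sum_Dplus_one_four (X : ℝ) (f : ℤ → ℝ) :
    ∑ d ∈ Dplus X 1 4, f d = ∑ n ∈ admSet X, f n := by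
  refine (sum_bij (fun (n : ℕ) _ => (n : ℤ)) (fun n hn => ?_) (fun _ _ _ _ h => by exact_mod_cast h)
    (fun d hd => ?_) fun _ _ => rfl).symm
  · obtain ⟨hnX, hsq, h4⟩ := mem_admSet.1 hn
    have hceil : (n : ℤ) ≤ ⌈X⌉ := by
      have : ((n : ℤ) : ℝ) ≤ ⌈X⌉ := by push_cast; exact hnX.le.trans (Int.le_ceil X)
      exact_mod_cast this
    simp only [Dplus, mem_filter, mem_Icc]
    refine ⟨⟨by omega, hceil⟩, Or.inl ⟨by omega, Int.squarefree_natCast.2 hsq⟩, by omega,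
      by exact_mod_cast hnX, by omega⟩
  · simp only [Dplus, mem_filter, mem_Icc] at hd
    obtain ⟨-, hfd, hpos, hdX, h4⟩ := hd
    lift d to ℕ using hpos.le
    refine ⟨d, mem_admSet.2 ⟨by exact_mod_cast hdX, ?_, by omega⟩, rfl⟩
    exact Int.squarefree_natCast.1 ((isFundDisc_iff_of_odd (by omega)).1 hfd).2

lemma sum_pow_ftilde_eq (X a : ℝ) :
    96 ^ k * ∑ d ∈ Dplus X 1 4, (a ^ omegaZ d * ftilde d) ^ k =
      ∑ D ∈ admTup (Lab k) X, summand (a ^ k) D := by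
  rw [sum_Dplus_one_four, mul_sum]
  simp only [summand]
  rw [← sum_admTup X (fun n => (a ^ k) ^ #n.primeFactors)
    fun D => if goodLab D then jacForm D D else 0]
  refine sum_congr rfl fun n hn => ?_
  obtain ⟨-, hsq, h4⟩ := mem_admSet.1 hn
  rw [← pow_ftilde_eq k hsq h4, omegaZ, Int.natAbs_natCast, mul_pow, mul_pow, ← pow_mul, ← pow_mul,
    mul_comm k]
  ring

lemma sum_pow_omegaZ_eq (X a : ℝ) : ∑ d ∈ Dplus X 1 4, (3 * a) ^ (k * omegaZ d) =
    ∑ n ∈ admSet X, (3 ^ k * a ^ k) ^ #n.primeFactors := by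
  rw [sum_Dplus_one_four]
  refine sum_congr rfl fun n _ => ?_
  rw [omegaZ, Int.natAbs_natCast, pow_mul, mul_pow]

end

theorem moments_pos_1_mod_4 (k : ℕ) (hk : 1 ≤ k) (a : ℝ) (ha : 1 / 3 ≤ a)
    (ε : ℝ) (hε : 0 < ε) :
    (fun X : ℝ =>
        (∑ d ∈ Dplus X 1 4, (a ^ omegaZ d * ftilde d) ^ k) -
          (1 / ((3 : ℝ) ^ k * 2 ^ (6 * k))) * ∑ d ∈ Dplus X 1 4, (3 * a) ^ (k * omegaZ d))
      =O[atTop] fun X : ℝ => X * Real.log X ^ ((3 * a) ^ k - a ^ k - 1 + ε) := by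
  have ha0 : 0 ≤ a := by linarith
  obtain ⟨A, hA, C₁, hC₁, h₁⟩ := exists_eventually_abs_sum_admTup_sub_le hk (pow_nonneg ha0 k)
  obtain ⟨C₂, hC₂, h₂⟩ := exists_errTerm_add_le hk (pow_nonneg ha0 k) hA hε
  refine IsBigO.of_bound ((96 ^ k)⁻¹ * (C₁ * C₂)) ?_
  filter_upwards [h₁, eventually_gt_atTop 1, eventually_le_log 1] with X h₁ hX hL
  have hconst : 1 / ((3 : ℝ) ^ k * 2 ^ (6 * k)) = (96 ^ k)⁻¹ * (1 / 2) ^ k := by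
    rw [pow_mul, ← mul_pow, ← inv_pow, ← mul_pow, ← one_div_pow]
    norm_num
  have hdiff : ∑ d ∈ Dplus X 1 4, (a ^ omegaZ d * ftilde d) ^ k -
      1 / ((3 : ℝ) ^ k * 2 ^ (6 * k)) * ∑ d ∈ Dplus X 1 4, (3 * a) ^ (k * omegaZ d) =
      (96 ^ k)⁻¹ * (∑ D ∈ admTup (Lab k) X, summand (a ^ k) D -
        (1 / 2) ^ k * ∑ n ∈ admSet X, (3 ^ k * a ^ k) ^ #n.primeFactors) := by
    rw [← sum_pow_ftilde_eq, sum_pow_omegaZ_eq, hconst, mul_sub,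
      inv_mul_cancel_left₀ (by positivity), mul_assoc]
  have hL0 : 0 < Real.log X := by linarith
  rw [hdiff, Real.norm_eq_abs, Real.norm_of_nonneg (by positivity), abs_mul,
    abs_of_pos (by positivity : (0 : ℝ) < (96 ^ k)⁻¹), mul_assoc, mul_assoc,
    show (3 * a) ^ k - a ^ k = (3 ^ k - 1) * a ^ k by rw [mul_pow]; ring]
  exact mul_le_mul_of_nonneg_left (h₁.trans (mul_le_mul_of_nonneg_left (h₂ X hX hL) hC₁))
    (by positivity)
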